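/- (Main Theorem) Let K be a number field that is Galois over ℚ with cyclic Galois group generated by σ, and let T = ker Σ / log U with Haar probability measure μ. Then Ñ is equidistributed in T with respect to the ordering by h: for every continuous function f : T → ℂ, the averages (1/#Ñ(r)) · Σ_{β̃ ∈ Ñ(r)} f(β̃) converge to ∫_T f dμ as r → ∞. -/

import Mathlib

open NumberField

/-- The logarithmic embedding `β ↦ (log ‖β‖_v)_{v | ∞}`, where `‖·‖_v` is the usual absolute
value at a real place and its square at a complex place. -/
noncomputable def logMap (K : Type*) [Field K] [NumberField K] (β : K) :
    InfinitePlace K → ℝ :=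
  fun w => Real.log ((w β) ^ w.mult)

/-- The kernel of the coordinate-sum map `Σ : ℝ^{r₁+r₂} → ℝ`. -/
noncomputable def sumKer (K : Type*) [Field K] [NumberField K] :
    AddSubgroup (InfinitePlace K → ℝ) where
  carrier := {x | ∑ w, x w = 0}
  add_mem' := by
    intro a b ha hb
    simp only [Set.mem_setOf_eq, Pi.add_apply] at *
    rw [Finset.sum_add_distrib, ha, hb, add_zero]
  zero_mem' := by simp
  neg_mem' := by
    intro a ha
    simp only [Set.mem_setOf_eq, Pi.neg_apply] at *
    rw [Finset.sum_neg_distrib, ha, neg_zero]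

/-- The image `log U` of the unit group under the logarithmic embedding, as a subgroup of
`ker Σ` (a lattice therein, by Dirichlet's unit theorem). -/
noncomputable def logUnits (K : Type*) [Field K] [NumberField K] :
    AddSubgroup (sumKer K) :=
  AddSubgroup.closure
    {x : sumKer K | ∃ u : (𝓞 K)ˣ, (x : InfinitePlace K → ℝ) = logMap K ((u : 𝓞 K) : K)}

/-- The torus `T = ker Σ / log U`. -/
noncomputable abbrev Torus (K : Type*) [Field K] [NumberField K] :=
  sumKer K ⧸ logUnits K

/-- `Ñ = log 𝒩 / log U ⊆ T`, the image of the norm-one elements of `K` in `T`. -/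
noncomputable def Ntilde (K : Type*) [Field K] [NumberField K] : Set (Torus K) :=
  {t | ∃ β : K, Algebra.norm ℚ β = 1 ∧ ∃ hb : logMap K β ∈ sumKer K,
    t = QuotientAddGroup.mk (⟨logMap K β, hb⟩ : sumKer K)}

/-- The height `h(β̃)` of a class `t ∈ T`: the least value of `|N(α)|` over nonzero algebraic
integers `α` with `log π(α) ≡ t (mod log U)`, where `π(α) = α / σ(α)`. -/
noncomputable def hclass (K : Type*) [Field K] [NumberField K]
    (σ : K ≃ₐ[ℚ] K) (t : Torus K) : ℕ :=
  sInf {m : ℕ | ∃ γ : 𝓞 K, γ ≠ 0 ∧ m = (Algebra.norm ℤ γ).natAbs ∧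
    ∃ hg : logMap K ((γ : K) / σ (γ : K)) ∈ sumKer K,
      QuotientAddGroup.mk (⟨logMap K ((γ : K) / σ (γ : K)), hg⟩ : sumKer K) = t}

/-- Equip the torus `T` with its Borel σ-algebra. -/
noncomputable instance (K : Type*) [Field K] [NumberField K] :
    MeasurableSpace (Torus K) := borel _

instance (K : Type*) [Field K] [NumberField K] : BorelSpace (Torus K) := ⟨rfl⟩

section
open Filter Topology MeasureTheory Set

noncomputable def fej (u : ℝ) : ℝ := 2 * ∫ t in (0:ℝ)..1, (1 - t) * Real.cos (t * u)

lemma fej_eq (u : ℝ) (hu : u ≠ 0) : fej u = 2 * (1 - Real.cos u) / u ^ 2 := by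
  have : ∀ t ∈ uIcc (0:ℝ) 1, HasDerivAt
      (fun t => (1 - t) * (Real.sin (t * u) / u) - Real.cos (t * u) / u ^ 2)
      ((1 - t) * Real.cos (t * u)) t := by
    intro t _
    have h1 : HasDerivAt (fun t : ℝ => t * u) u t := by simpa using (hasDerivAt_id t).mul_const u
    have h2 := ((hasDerivAt_id t).const_sub 1).mul ((h1.sin).div_const u)
    have h3 := h2.sub ((h1.cos).div_const (u^2))
    refine HasDerivAt.congr_deriv (f := fun t => (1 - t) * (Real.sin (t * u) / u) - Real.cos (t * u) / u ^ 2) h3 ?_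
    dsimp; field_simp; ring
  rw [fej, intervalIntegral.integral_eq_sub_of_hasDerivAt this
    (Continuous.intervalIntegrable (by fun_prop) _ _)]
  simp; field_simp; ring

lemma fej_nonneg (u : ℝ) : 0 ≤ fej u := by
  by_cases hu : u = 0
  · subst hu; simp only [fej, mul_zero, Real.cos_zero, mul_one]
    rw [intervalIntegral.integral_sub] <;> norm_num
  · rw [fej_eq u hu]; have := Real.cos_le_one u; positivity [sub_nonneg.2 this]

lemma fej_cont : Continuous fej := by
  unfold fej
  refine continuous_const.mul ?_
  exact intervalIntegral.continuous_parametric_intervalIntegral_of_continuous' (by fun_prop) 0 1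

lemma fej_le (u : ℝ) : fej u ≤ 6 * (1 + u ^ 2)⁻¹ := by
  have h1 : fej u ≤ 2 := by
    have := intervalIntegral.norm_integral_le_of_norm_le_const (a := (0:ℝ)) (b := 1) (C := 1)
      (f := fun t => (1 - t) * Real.cos (t * u)) (by
        intro t ht
        rw [uIoc_of_le zero_le_one] at ht
        rw [norm_mul]
        have h1 := Real.abs_cos_le_one (t * u)
        have h2 : |1 - t| ≤ 1 := by rw [abs_le]; constructor <;> linarith [ht.1, ht.2]
        simpa using mul_le_mul h2 h1 (abs_nonneg _) zero_le_one)
    rw [Real.norm_eq_abs] at this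
    have := (abs_le.1 this).2
    unfold fej; norm_num at this ⊢; linarith
  rw [← div_eq_mul_inv, le_div_iff₀ (by positivity)]
  by_cases hu : u = 0
  · subst hu; linarith
  · have h2 : fej u * u ^ 2 ≤ 4 := by
      rw [fej_eq u hu, div_mul_cancel₀ _ (by positivity)]; linarith [Real.neg_one_le_cos u]
    linarith

lemma fej_int : Integrable fej :=
  (integrable_inv_one_add_sq.const_mul 6).mono' fej_cont.aestronglyMeasurable
    (Eventually.of_forall fun u => by
      rw [Real.norm_eq_abs, abs_of_nonneg (fej_nonneg u)]; exact fej_le u)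

lemma fej_pos : 0 < ∫ u, fej u := by
  refine integral_pos_of_integrable_nonneg_nonzero (x := 0) fej_cont fej_int fej_nonneg ?_
  simp only [fej, mul_zero, Real.cos_zero, mul_one]
  rw [intervalIntegral.integral_sub] <;> norm_num

lemma fej_fourier (u : ℝ) : (fej u : ℂ) =
    ∫ t in (-1:ℝ)..1, ((1 - |t| : ℝ) : ℂ) * Complex.exp (Complex.I * t * u) := by
  have hc : Continuous fun t : ℝ => ((1 - |t| : ℝ) : ℂ) * Complex.exp (Complex.I * t * u) := by
    fun_prop
  rw [← intervalIntegral.integral_add_adjacent_intervals (b := 0) (hc.intervalIntegrable _ _)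
    (hc.intervalIntegrable _ _)]
  have h1 := intervalIntegral.integral_comp_neg (a := 0) (b := 1)
    (fun t : ℝ => ((1 - |t| : ℝ) : ℂ) * Complex.exp (Complex.I * t * u))
  rw [neg_zero] at h1
  rw [← h1, ← intervalIntegral.integral_add
    (Continuous.intervalIntegrable (by fun_prop) _ _) (hc.intervalIntegrable _ _), fej]
  push_cast
  rw [← intervalIntegral.integral_ofReal, ← intervalIntegral.integral_const_mul]
  refine intervalIntegral.integral_congr fun t ht => ?_
  rw [uIcc_of_le zero_le_one] at ht
  simp only [abs_neg, abs_of_nonneg ht.1]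
  push_cast
  rw [Complex.cos]
  have e1 : Complex.I * -(t:ℂ) * u = -(t * u) * Complex.I := by ring
  have e2 : Complex.I * (t:ℂ) * u = (t * u) * Complex.I := by ring
  rw [e1, e2]; ring

/-- smoothed convergence -/
lemma WI_smooth (b : ℝ → ℝ) (C : ℝ) (hm : Measurable b) (hC : ∀ v, |b v| ≤ C)
    (hneg : ∀ v < 0, b v = 0) (H : ℂ → ℂ) (hH : ContinuousOn H {s | 0 ≤ s.re})
    (hL : ∀ s : ℂ, 0 < s.re → ∫ v, (b v : ℂ) * Complex.exp (-s * v) = H s) (R : ℝ) (hR : 0 < R) :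
    Tendsto (fun y => ∫ v, b v * fej (R * (y - v))) atTop (𝓝 0) := by
  have key : ∀ y, ((∫ v, b v * fej (R * (y - v)) : ℝ) : ℂ) =
      ∫ t in (-1:ℝ)..1, ((1 - |t| : ℝ) : ℂ) * Complex.exp (Complex.I * t * (R * y)) *
        H (Complex.I * (t * R)) := by
    intro y
    have hfi : Integrable fun v => fej (R * (y - v)) := by
      have := (fej_int.comp_mul_left' hR.ne').comp_sub_left y
      simpa using this
    -- delta version
    have hδ : ∀ δ : ℝ, 0 < δ → ∫ v, ((b v * Real.exp (-δ * v) * fej (R * (y - v)) : ℝ) : ℂ) =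
        ∫ t in (-1:ℝ)..1, ((1 - |t| : ℝ) : ℂ) * Complex.exp (Complex.I * t * (R * y)) *
          H (δ + Complex.I * (t * R)) := by
      intro δ hδ
      have hbi : Integrable fun v => ((b v * Real.exp (-δ * v) : ℝ) : ℂ) := by
        refine Integrable.ofReal ?_
        have : (fun v => b v * Real.exp (-δ * v)) =
            indicator (Ici 0) (fun v => b v * Real.exp (-δ * v)) := by
          ext v; by_cases hv : v < 0
          · rw [indicator_of_notMem (by simpa using hv), hneg v hv, zero_mul]
          · rw [indicator_of_mem (by simpa using hv)]
        change Integrable (fun v => b v * Real.exp (-δ * v))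
        rw [this, integrable_indicator_iff measurableSet_Ici, integrableOn_Ici_iff_integrableOn_Ioi]
        refine Integrable.bdd_mul (c := C) (exp_neg_integrableOn_Ioi 0 hδ)
          hm.aestronglyMeasurable (Eventually.of_forall fun v => hC v)
      have h1 : ∀ v, ((b v * Real.exp (-δ * v) * fej (R * (y - v)) : ℝ) : ℂ) =
          ∫ t in (-1:ℝ)..1, ((b v * Real.exp (-δ * v) : ℝ) : ℂ) *
            (((1 - |t| : ℝ) : ℂ) * Complex.exp (Complex.I * t * (R * (y - v) : ℝ))) := by
        intro v
        rw [intervalIntegral.integral_const_mul, ← fej_fourier]; push_cast; ring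
      simp_rw [h1, intervalIntegral.integral_of_le (show (-1:ℝ) ≤ 1 by norm_num)]
      rw [integral_integral_swap]
      · refine integral_congr_ae (Eventually.of_forall fun t => ?_)
        simp only
        rw [← hL _ (by simpa using hδ), ← integral_const_mul]
        refine integral_congr_ae (Eventually.of_forall fun v => ?_)
        simp only
        have e1 : Complex.exp (-(δ + Complex.I * (t * R)) * v) =
          Complex.exp (-δ * v) * Complex.exp (Complex.I * t * (-(R * v))) := by
          rw [← Complex.exp_add]; congr 1; ring
        have e2 : Complex.exp (Complex.I * t * (R * (y - v) : ℝ)) =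
          Complex.exp (Complex.I * t * (R * y)) * Complex.exp (Complex.I * t * (-(R * v))) := by
          rw [← Complex.exp_add]; congr 1; push_cast; ring
        rw [e1, e2]; push_cast; ring
      · have hb2 : Integrable (fun z : ℝ × ℝ => ((b z.1 * Real.exp (-δ * z.1) : ℝ) : ℂ) * 1)
            (volume.prod (volume.restrict (Ioc (-1:ℝ) 1))) :=
          hbi.mul_prod (integrable_const _)
        refine (hb2.bdd_mul (c := 1) (f := fun z : ℝ × ℝ => (((1 - |z.2| : ℝ) : ℂ) *
          Complex.exp (Complex.I * z.2 * (R * (y - z.1) : ℝ)))) ?_ ?_).congr ?_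
        · exact (by fun_prop : Continuous _).aestronglyMeasurable
        · have : ∀ᵐ z : ℝ × ℝ ∂(volume.prod (volume.restrict (Ioc (-1:ℝ) 1))),
              z.2 ∈ Ioc (-1:ℝ) 1 :=
            Measure.quasiMeasurePreserving_snd.ae (ae_restrict_mem measurableSet_Ioc)
          filter_upwards [this] with z hz
          rw [norm_mul, mul_assoc, mul_comm Complex.I, ← Complex.ofReal_mul,
            Complex.norm_exp_ofReal_mul_I, mul_one, Complex.norm_real, Real.norm_eq_abs, abs_le]
          have := abs_le.2 ⟨hz.1.le, hz.2⟩
          constructor <;> linarith [abs_nonneg z.2]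
        · exact Eventually.of_forall fun z => by simp [mul_comm, Function.uncurry]
    -- limit
    have hl : Tendsto (fun n : ℕ => ∫ v, ((b v * Real.exp (-(1 / ((n:ℝ) + 1)) * v) *
        fej (R * (y - v)) : ℝ) : ℂ)) atTop (𝓝 (∫ v, ((b v * fej (R * (y - v)) : ℝ) : ℂ))) := by
      refine tendsto_integral_of_dominated_convergence (fun v => C * fej (R * (y - v))) ?_
        (hfi.const_mul C) ?_ ?_
      · intro n
        refine Measurable.aestronglyMeasurable ?_
        have := fej_cont.measurable
        fun_prop
      · intro n
        refine Eventually.of_forall fun v => ?_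
        rw [Complex.norm_real, Real.norm_eq_abs, abs_mul, abs_of_nonneg (fej_nonneg _), abs_mul]
        refine mul_le_mul_of_nonneg_right ?_ (fej_nonneg _)
        by_cases hv : v < 0
        · simpa [hneg v hv] using (abs_nonneg _).trans (hC v)
        · push Not at hv
          refine (mul_le_mul_of_nonneg_left (b := |Real.exp _|) (c := 1) ?_ (abs_nonneg _)).trans
            (by rw [mul_one]; exact hC v)
          rw [abs_of_pos (Real.exp_pos _), Real.exp_le_one_iff]
          have : (0:ℝ) ≤ 1 / ((n:ℝ) + 1) := by positivity
          nlinarith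
      · refine Eventually.of_forall fun v => ?_
        have h2 : Tendsto (fun n : ℕ => b v * Real.exp (-(1 / ((n:ℝ) + 1)) * v) *
          fej (R * (y - v))) atTop (𝓝 (b v * Real.exp (-0 * v) * fej (R * (y - v)))) := by
          have := tendsto_one_div_add_atTop_nhds_zero_nat (𝕜 := ℝ)
          exact (((Real.continuous_exp.tendsto _).comp (this.neg.mul_const v)).const_mul _).mul_const _
        simp only [neg_zero, zero_mul, Real.exp_zero, mul_one] at h2
        exact (Complex.continuous_ofReal.tendsto _).comp h2
    have hK : IsCompact ((fun p : ℝ × ℝ => ((p.1 : ℂ) + Complex.I * (p.2 * R))) ''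
        (Icc 0 1 ×ˢ Icc (-1) 1)) :=
      (isCompact_Icc.prod isCompact_Icc).image (by fun_prop)
    obtain ⟨D, hD⟩ := hK.exists_bound_of_continuousOn (hH.mono (by
      rintro _ ⟨p, hp, rfl⟩; simpa using hp.1.1))
    have hr : Tendsto (fun n : ℕ => ∫ t in (-1:ℝ)..1, ((1 - |t| : ℝ) : ℂ) *
        Complex.exp (Complex.I * t * (R * y)) *
          H ((1 / ((n:ℝ) + 1) : ℝ) + Complex.I * (t * R))) atTop
        (𝓝 (∫ t in (-1:ℝ)..1, ((1 - |t| : ℝ) : ℂ) * Complex.exp (Complex.I * t * (R * y)) *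
          H (Complex.I * (t * R)))) := by
      have hmem : ∀ (x t : ℝ), 0 ≤ x → ((x : ℂ) + Complex.I * (t * R)) ∈ {s : ℂ | 0 ≤ s.re} := by
        intro x t hx; simpa using hx
      refine intervalIntegral.tendsto_integral_filter_of_dominated_convergence (fun _ => D)
        (Eventually.of_forall fun n => ?_) (Eventually.of_forall fun n =>
          Eventually.of_forall fun t ht => ?_) (by simp) (Eventually.of_forall fun t ht => ?_)
      · refine Continuous.aestronglyMeasurable ((by fun_prop : Continuous _).mul ?_)
        exact hH.comp_continuous (by fun_prop) (fun t => hmem _ t (by positivity))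
      · rw [uIoc_of_le (by norm_num)] at ht
        have h3 := hD _ ⟨(1 / ((n:ℝ) + 1), t), ⟨⟨by positivity, by
          rw [div_le_one (by positivity)]; linarith [n.cast_nonneg (α := ℝ)]⟩, ht.1.le, ht.2⟩, rfl⟩
        rw [norm_mul, norm_mul]
        have e : Complex.I * (t:ℂ) * (R * y) = ((t * (R * y) : ℝ) : ℂ) * Complex.I := by
          push_cast; ring
        rw [e, Complex.norm_exp_ofReal_mul_I, mul_one, Complex.norm_real, Real.norm_eq_abs]
        have h4 := abs_le.2 ⟨ht.1.le, ht.2⟩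
        have h5 : abs (1 - |t|) ≤ 1 := by rw [abs_le]; constructor <;> linarith [abs_nonneg t]
        calc _ ≤ 1 * D := mul_le_mul h5 h3 (norm_nonneg _) zero_le_one
          _ = D := one_mul D
      · refine Tendsto.const_mul _ ?_
        have h6 := hH _ (show Complex.I * (t * R) ∈ {s : ℂ | 0 ≤ s.re} by simp)
        refine h6.tendsto.comp (tendsto_nhdsWithin_iff.2 ⟨?_, Eventually.of_forall fun n =>
          hmem _ t (by positivity)⟩)
        have := (Complex.continuous_ofReal.tendsto _).comp
          (tendsto_one_div_add_atTop_nhds_zero_nat (𝕜 := ℝ))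
        simpa using this.add_const (Complex.I * (t * R))
    have := tendsto_nhds_unique (hl.congr fun n => hδ _ (by positivity)) hr
    rw [← this]; exact integral_ofReal.symm
  -- Riemann Lebesgue
  have hRL := Real.tendsto_integral_exp_smul_cocompact
    (indicator (Ioc (-1:ℝ) 1) fun t => ((1 - |t| : ℝ) : ℂ) * H (Complex.I * (t * R)))
  have hlim : Tendsto (fun y : ℝ => -(R * y) / (2 * Real.pi)) atTop (cocompact ℝ) := by
    rw [cocompact_eq_atBot_atTop]
    refine Tendsto.mono_right ?_ le_sup_left
    have : Tendsto (fun y : ℝ => (R / (2 * Real.pi)) * y) atTop atTop :=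
      tendsto_id.const_mul_atTop (by positivity)
    refine (tendsto_neg_atTop_atBot.comp this).congr fun y => ?_
    simp; ring
  have h7 := hRL.comp hlim
  rw [← Complex.ofReal_zero] at h7
  have h8 : Tendsto (fun y => ((∫ v, b v * fej (R * (y - v)) : ℝ) : ℂ)) atTop (𝓝 ((0:ℝ):ℂ)) := by
    refine h7.congr fun y => ?_
    rw [key, intervalIntegral.integral_of_le (by norm_num), ← integral_indicator measurableSet_Ioc]
    refine integral_congr_ae (Eventually.of_forall fun t => ?_)
    simp only [indicator]
    split_ifs
    · rw [Circle.smul_def, Real.fourierChar_apply, smul_eq_mul]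
      have : ((2 * Real.pi * -(t * (-(R * y) / (2 * Real.pi))) : ℝ) : ℂ) * Complex.I =
        Complex.I * t * (R * y) := by
        have := Real.pi_ne_zero
        push_cast; field_simp
      rw [this]; ring
    · simp
  exact tendsto_ofReal_iff.1 h8

theorem WI_core (B : ℝ → ℝ) (A C : ℝ) (hm : Measurable B) (h0 : ∀ v, 0 ≤ B v) (hC : ∀ v, B v ≤ C)
    (hneg : ∀ v < 0, B v = 0) (hmono : ∀ u v, u ≤ v → Real.exp u * B u ≤ Real.exp v * B v)
    (H : ℂ → ℂ) (hH : ContinuousOn H {s | 0 ≤ s.re})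
    (hL : ∀ s : ℂ, 0 < s.re → ∫ v, ((B v - indicator (Ici 0) (fun _ => A) v : ℝ) : ℂ) *
      Complex.exp (-s * v) = H s) : Tendsto B atTop (𝓝 A) := by
  set κ := ∫ u, fej u with hκ
  have hκ0 : 0 < κ := fej_pos
  have hind : ∀ v, |indicator (Ici (0:ℝ)) (fun _ => A) v| ≤ |A| := fun v => by
    simp only [indicator]; split_ifs <;> simp
  have hBm : ∀ R y : ℝ, Integrable fun x => B (y - x / R) * fej x := fun R y =>
    fej_int.bdd_mul (c := C) (hm.comp (by fun_prop)).aestronglyMeasurable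
      (Eventually.of_forall fun v => by
        rw [Real.norm_eq_abs, abs_of_nonneg (h0 _)]; exact hC _)
  have hS : ∀ R : ℝ, 0 < R → Tendsto (fun y => ∫ x, B (y - x / R) * fej x) atTop (𝓝 (A * κ)) := by
    intro R hR
    have h1 := WI_smooth (fun v => B v - indicator (Ici 0) (fun _ => A) v) (C + |A|)
      (hm.sub (measurable_const.indicator measurableSet_Ici)) (fun v => by
        refine (abs_sub _ _).trans (add_le_add ?_ (hind v))
        rw [abs_of_nonneg (h0 _)]; exact hC _)
      (fun v hv => by simp [hneg v hv, hv]) H hH hL R hR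
    have h2 : Tendsto (fun y => ∫ x, indicator (Ici (0:ℝ)) (fun _ => A) (y - x / R) * fej x) atTop
        (𝓝 (∫ x, A * fej x)) := by
      refine tendsto_integral_filter_of_dominated_convergence (fun x => |A| * fej x)
        (Eventually.of_forall fun y => ?_) (Eventually.of_forall fun y => Eventually.of_forall
          fun x => ?_) (fej_int.const_mul _) (Eventually.of_forall fun x => ?_)
      · exact (((measurable_const.indicator measurableSet_Ici).comp (by fun_prop)).mul
          fej_cont.measurable).aestronglyMeasurable
      · rw [norm_mul, Real.norm_eq_abs, Real.norm_eq_abs, abs_of_nonneg (fej_nonneg x)]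
        exact mul_le_mul_of_nonneg_right (hind _) (fej_nonneg x)
      · refine tendsto_const_nhds.congr' ?_
        filter_upwards [eventually_ge_atTop (x / R)] with y hy
        rw [indicator_of_mem]; simpa using hy
    rw [integral_const_mul] at h2
    have h3 := (h1.const_mul R).add h2
    rw [mul_zero, zero_add] at h3
    refine h3.congr fun y => ?_
    have e : (fun v => (B v - indicator (Ici 0) (fun _ => A) v) * fej (R * (y - v))) =
        fun v => (fun x => (B (y - x / R) - indicator (Ici 0) (fun _ => A) (y - x / R)) * fej x)
          (R * (y - v)) := by
      ext v; simp only
      rw [mul_div_cancel_left₀ _ hR.ne', sub_sub_cancel]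
    rw [e, integral_sub_left_eq_self (fun w => (fun x => (B (y - x / R) -
      indicator (Ici 0) (fun _ => A) (y - x / R)) * fej x) (R * w)) volume y,
      Measure.integral_comp_mul_left (fun x => (B (y - x / R) -
      indicator (Ici 0) (fun _ => A) (y - x / R)) * fej x), abs_of_pos (inv_pos.2 hR), smul_eq_mul,
      mul_inv_cancel_left₀ hR.ne', ← integral_add]
    · refine integral_congr_ae (Eventually.of_forall fun x => ?_)
      simp only; ring
    · simp_rw [sub_mul]
      refine (hBm R y).sub (fej_int.bdd_mul (c := |A|) ?_ (Eventually.of_forall fun x => hind _))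
      exact ((measurable_const.indicator measurableSet_Ici).comp (by fun_prop)).aestronglyMeasurable
    · refine (fej_int.bdd_mul (c := |A|) ?_ (Eventually.of_forall fun x => hind _))
      exact ((measurable_const.indicator measurableSet_Ici).comp (by fun_prop)).aestronglyMeasurable
  have hC0 : 0 ≤ C := (h0 0).trans (hC 0)
  -- quantitative bounds
  have hq : ∀ h ε : ℝ, 0 < h → 0 < ε → ε < 1 →
      ∀ᶠ y in atTop, B y * (Real.exp (-2 * h) * (1 - ε)) ≤ A + ε ∧
        A - ε ≤ B y * Real.exp (2 * h) + C * ε := by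
    intro h ε hh hε hε1
    have hX : ∃ X : ℝ, 0 < X ∧ (1 - ε) * κ ≤ ∫ x in Icc (-X) X, fej x := by
      have : Tendsto (fun X : ℝ => ∫ x in Icc (-X) X, fej x) atTop (𝓝 κ) := by
        have := (aecover_Icc (μ := volume) (tendsto_neg_atTop_atBot (G := ℝ))
          tendsto_id).integral_tendsto_of_countably_generated fej_int
        exact this
      obtain ⟨X, hX⟩ := ((this.eventually (lt_mem_nhds
        (show (1 - ε) * κ < κ by nlinarith))).and (eventually_gt_atTop 0)).exists
      exact ⟨X, hX.2, hX.1.le⟩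
    obtain ⟨X, hX0, hX⟩ := hX
    have hR : 0 < X / h := by positivity
    have hdiv : ∀ x ∈ Icc (-X) X, -h ≤ x / (X / h) ∧ x / (X / h) ≤ h := by
      intro x hx
      rw [le_div_iff₀ hR, div_le_iff₀ hR]
      have : h * (X / h) = X := by field_simp
      constructor <;> nlinarith [hx.1, hx.2]
    have hsplit := integral_add_compl (μ := volume) (s := Icc (-X) X) measurableSet_Icc fej_int
    have hup := ((tendsto_atTop_add_const_right atTop h tendsto_id).eventually
      ((hS _ hR).eventually (gt_mem_nhds (show A * κ < (A + ε) * κ by nlinarith))))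
    have hlo := ((tendsto_atTop_add_const_right atTop (-h) tendsto_id).eventually
      ((hS _ hR).eventually (lt_mem_nhds (show (A - ε) * κ < A * κ by nlinarith))))
    have hcomp : ∀ u v, u ≤ v → v ≤ u + 2 * h → B u * Real.exp (-2 * h) ≤ B v := by
      intro u v huv hvu
      have h1 := hmono u v huv
      have h2 : B v = Real.exp (-v) * (Real.exp v * B v) := by
        rw [← mul_assoc, ← Real.exp_add]; simp
      rw [h2]
      calc B u * Real.exp (-2 * h) ≤ B u * Real.exp (-v + u) :=
            mul_le_mul_of_nonneg_left (Real.exp_le_exp.2 (by linarith)) (h0 u)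
        _ = Real.exp (-v) * (Real.exp u * B u) := by rw [Real.exp_add]; ring
        _ ≤ _ := mul_le_mul_of_nonneg_left h1 (Real.exp_pos _).le
    filter_upwards [hup, hlo] with y h1 h2
    simp only [id] at h1 h2
    have hBp : ∀ R y x, 0 ≤ B (y - x / R) * fej x := fun _ _ x => mul_nonneg (h0 _) (fej_nonneg x)
    constructor
    · have h3 : ∫ x in Icc (-X) X, B y * Real.exp (-2 * h) * fej x ≤
          ∫ x, B (y + h - x / (X / h)) * fej x := by
        refine le_trans ?_ (setIntegral_le_integral (s := Icc (-X) X) (hBm _ _)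
          (Eventually.of_forall (hBp _ _)))
        refine setIntegral_mono_on (fej_int.const_mul _).integrableOn (hBm _ _).integrableOn
          measurableSet_Icc fun x hx => mul_le_mul_of_nonneg_right (hcomp _ _ ?_ ?_) (fej_nonneg x)
        · linarith [(hdiv x hx).2]
        · linarith [(hdiv x hx).1]
      rw [integral_const_mul] at h3
      have h4 := mul_le_mul_of_nonneg_left hX (mul_nonneg (h0 y) (Real.exp_pos (-2 * h)).le)
      refine le_of_mul_le_mul_right (?_ : _ ≤ (A + ε) * κ) hκ0
      linarith
    · have h3 : ∫ x, B (y + -h - x / (X / h)) * fej x ≤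
          B y * Real.exp (2 * h) * κ + C * (ε * κ) := by
        rw [← integral_add_compl (s := Icc (-X) X) measurableSet_Icc (hBm _ _)]
        refine add_le_add ?_ ?_
        · calc _ ≤ ∫ x in Icc (-X) X, B y * Real.exp (2 * h) * fej x := by
                refine setIntegral_mono_on (hBm _ _).integrableOn (fej_int.const_mul _).integrableOn
                  measurableSet_Icc fun x hx => mul_le_mul_of_nonneg_right ?_ (fej_nonneg x)
                have h5 := hcomp (y + -h - x / (X / h)) y (by linarith [(hdiv x hx).1])
                  (by linarith [(hdiv x hx).2])
                have h6 := mul_le_mul_of_nonneg_right h5 (Real.exp_pos (2 * h)).le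
                rwa [mul_assoc, ← Real.exp_add, show -2 * h + 2 * h = 0 by ring, Real.exp_zero,
                  mul_one] at h6
            _ ≤ _ := by
                rw [integral_const_mul]
                refine mul_le_mul_of_nonneg_left ?_ (mul_nonneg (h0 y) (Real.exp_pos _).le)
                exact setIntegral_le_integral fej_int (Eventually.of_forall fej_nonneg)
        · calc _ ≤ ∫ x in (Icc (-X) X)ᶜ, C * fej x :=
                setIntegral_mono (hBm _ _).integrableOn (fej_int.const_mul _).integrableOn
                  fun x => mul_le_mul_of_nonneg_right (hC _) (fej_nonneg x)
            _ ≤ _ := by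
                rw [integral_const_mul]
                refine mul_le_mul_of_nonneg_left ?_ hC0
                linarith
      refine le_of_mul_le_mul_right (?_ : _ * κ ≤ _) hκ0
      linarith
  -- conclude
  rw [Metric.tendsto_nhds]
  intro e he
  have hbd : Tendsto (fun x : ℝ => (A + x) / (Real.exp (-2 * x) * (1 - x))) (𝓝[>] 0) (𝓝 A) := by
    have : ContinuousAt (fun x : ℝ => (A + x) / (Real.exp (-2 * x) * (1 - x))) 0 := by
      refine ContinuousAt.div (by fun_prop) (by fun_prop) (by simp)
    simpa using this.tendsto.mono_left nhdsWithin_le_nhds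
  have hbd2 : Tendsto (fun x : ℝ => (A - x - C * x) / Real.exp (2 * x)) (𝓝[>] 0) (𝓝 A) := by
    have : ContinuousAt (fun x : ℝ => (A - x - C * x) / Real.exp (2 * x)) 0 :=
      ContinuousAt.div (by fun_prop) (by fun_prop) (by simp)
    simpa using this.tendsto.mono_left nhdsWithin_le_nhds
  obtain ⟨x, ⟨⟨hx1, hx2⟩, hx3⟩, hx4⟩ := (((hbd.eventually (gt_mem_nhds (show A < A + e by linarith))).and
    (hbd2.eventually (lt_mem_nhds (show A - e < A by linarith)))).and
    (Ioo_mem_nhdsGT (show (0:ℝ) < 1 by norm_num))).and self_mem_nhdsWithin |>.exists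
  filter_upwards [hq x x hx3.1 hx3.1 hx3.2] with y hy
  rw [Real.dist_eq, abs_lt]
  have p1 : 0 < Real.exp (-2 * x) * (1 - x) := mul_pos (Real.exp_pos _) (by linarith [hx3.2])
  have h5 := (le_div_iff₀ p1).2 hy.1
  have h6 : (A - x - C * x) / Real.exp (2 * x) ≤ B y := by
    rw [div_le_iff₀ (Real.exp_pos _)]; linarith [hy.2]
  constructor <;> linarith

end

section
open Filter Topology MeasureTheory Set

theorem WI_nat (a : ℕ → ℝ) (ha : ∀ n, 0 ≤ a n) (C : ℝ)
    (hC : ∀ n : ℕ, ∑ k ∈ Finset.Icc 1 n, a k ≤ C * n) (A : ℝ) (G : ℂ → ℂ)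
    (hG : ContinuousOn G {s | 1 ≤ s.re})
    (hL : ∀ s : ℂ, 1 < s.re → LSeries (fun n => (a n : ℂ)) s = G s + A / (s - 1)) :
    Tendsto (fun x : ℝ => (∑ k ∈ Finset.Icc 1 ⌊x⌋₊, a k) / x) atTop (𝓝 A) := by
  set S : ℝ → ℝ := fun x => ∑ k ∈ Finset.Icc 1 ⌊x⌋₊, a k with hSdef
  have hSmono : Monotone S := fun x y hxy => Finset.sum_le_sum_of_subset_of_nonneg
    (Finset.Icc_subset_Icc_right (Nat.floor_mono hxy)) fun i _ _ => ha i
  have hS0 : ∀ x, 0 ≤ S x := fun x => Finset.sum_nonneg fun i _ => ha i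
  have hC0 : 0 ≤ C := by have := (hS0 1).trans (by simpa [hSdef] using hC 1); simpa using this
  have hSle : ∀ x, 0 ≤ x → S x ≤ C * x := fun x hx =>
    (hC _).trans (mul_le_mul_of_nonneg_left (Nat.floor_le hx) hC0)
  set B : ℝ → ℝ := indicator (Ici 0) fun v => S (Real.exp v) * Real.exp (-v) with hB
  have hBv : ∀ v, 0 ≤ v → B v = S (Real.exp v) * Real.exp (-v) := fun v hv => by
    rw [hB, indicator_of_mem]; exact hv
  have hBn : ∀ v < 0, B v = 0 := fun v hv => by
    rw [hB, indicator_of_notMem]; simpa using hv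
  have hB0 : ∀ v, 0 ≤ B v := fun v => indicator_nonneg
    (fun v _ => mul_nonneg (hS0 _) (Real.exp_pos _).le) v
  have hBC : ∀ v, B v ≤ C := fun v => by
    rcases lt_or_ge v 0 with hv | hv
    · rw [hBn v hv]; exact hC0
    · rw [hBv v hv, Real.exp_neg, ← div_eq_mul_inv, div_le_iff₀ (Real.exp_pos _)]
      exact hSle _ (Real.exp_pos _).le
  have hBm : Measurable B := ((hSmono.measurable.comp Real.measurable_exp).mul
    (by fun_prop)).indicator measurableSet_Ici
  have hlim : Tendsto B atTop (𝓝 A) := by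
    refine WI_core B A C hBm hB0 hBC hBn ?_ (fun z => (G (1 + z) - A) / (1 + z)) ?_ ?_
    · intro u v huv
      rcases lt_or_ge u 0 with hu | hu
      · rw [hBn u hu, mul_zero]; exact mul_nonneg (Real.exp_pos _).le (hB0 v)
      · rw [hBv u hu, hBv v (hu.trans huv), mul_comm, mul_assoc, ← Real.exp_add,
          mul_comm, mul_comm (Real.exp v), mul_assoc (S _), ← Real.exp_add]
        simpa using hSmono (Real.exp_le_exp.2 huv)
    · refine ContinuousOn.div ?_ (by fun_prop) ?_
      · refine (hG.comp (f := fun z : ℂ => 1 + z) (by fun_prop) ?_).sub continuousOn_const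
        intro z hz; simpa using hz
      · intro z hz h
        have := congrArg Complex.re h
        simp at this
        have hz : 0 ≤ z.re := hz
        linarith
    · intro z hz
      have hs : 1 < (1 + z).re := by simpa using hz
      have h1 := LSeries_eq_mul_integral_of_nonneg a zero_le_one hs
        (by
          refine Asymptotics.IsBigO.of_bound C (Eventually.of_forall fun n => ?_)
          rw [Real.rpow_one, Real.norm_eq_abs, Real.norm_eq_abs, abs_of_nonneg (Finset.sum_nonneg fun i _ => ha i),
            Nat.abs_cast]
          exact hC n) ha
      have hne : (1 + z) ≠ 0 := fun h => by
        have := congrArg Complex.re h; simp at this; linarith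
      have hz0 : z ≠ 0 := fun h => by simp [h] at hz
      have himg : Real.exp '' Ioi 0 = Ioi 1 := by
        ext x; constructor
        · rintro ⟨v, hv, rfl⟩; exact Real.one_lt_exp_iff.2 hv
        · intro hx; exact ⟨Real.log x, Real.log_pos hx, Real.exp_log (by linarith [mem_Ioi.1 hx])⟩
      rw [← himg, integral_image_eq_integral_abs_deriv_smul measurableSet_Ioi
        (fun v _ => (Real.hasDerivAt_exp v).hasDerivWithinAt) Real.exp_injective.injOn, hL _ hs] at h1
      have h2 : ∫ v in Ioi (0:ℝ), (B v : ℂ) * Complex.exp (-z * v) = (G (1 + z) + A / z) / (1 + z) := by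
        rw [eq_div_iff hne, mul_comm, show (A:ℂ) / z = A / (1 + z - 1) by simp, h1]
        congr 1
        refine setIntegral_congr_fun measurableSet_Ioi fun v hv => ?_
        rw [hBv v (le_of_lt hv), abs_of_pos (Real.exp_pos _), Complex.real_smul]
        have e1 : ((Real.exp v : ℝ) : ℂ) ^ (-(1 + z + 1)) = Complex.exp (-z * v) *
            Complex.exp (-v) * Complex.exp (-v) := by
          rw [Complex.cpow_def_of_ne_zero (by exact_mod_cast (Real.exp_pos v).ne'),
            ← Complex.ofReal_log (Real.exp_pos _).le, Real.log_exp, ← Complex.exp_add,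
            ← Complex.exp_add]
          congr 1; ring
        rw [e1]
        have e2 : (Real.exp v : ℂ) * Complex.exp (-v) = 1 := by
          rw [Complex.ofReal_exp, ← Complex.exp_add]; simp
        simp only [hSdef]
        push_cast at e2 ⊢
        linear_combination (-(∑ k ∈ Finset.Icc 1 ⌊Real.exp v⌋₊, (a k:ℂ)) * Complex.exp (-z * v) *
            Complex.exp (-v)) * e2
      have h3 : ∫ v in Ioi (0:ℝ), (A : ℂ) * Complex.exp (-z * v) = A / z := by
        rw [integral_const_mul, integral_exp_mul_complex_Ioi (by simpa using hz)]
        simp [div_eq_mul_inv]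
      have h4 : ∀ b : ℝ → ℝ, Measurable b → (∃ D, ∀ v, |b v| ≤ D) → IntegrableOn
          (fun v => (b v : ℂ) * Complex.exp (-z * v)) (Ioi 0) := by
        rintro b hb ⟨D, hD⟩
        refine Integrable.bdd_mul (c := D) ?_ (by fun_prop) (Eventually.of_forall fun v => by simpa using hD v)
        exact integrableOn_exp_mul_complex_Ioi (by simpa using hz) 0
      have h5 : ∫ v, ((B v - indicator (Ici 0) (fun _ => A) v : ℝ) : ℂ) * Complex.exp (-z * v) =
          ∫ v in Ioi (0:ℝ), ((B v : ℂ) * Complex.exp (-z * v) - (A : ℂ) * Complex.exp (-z * v)) := by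
        rw [← integral_Ici_eq_integral_Ioi, ← integral_indicator measurableSet_Ici]
        congr 1; ext v
        by_cases hv : v ∈ Ici (0:ℝ)
        · simp only [indicator_of_mem hv]; push_cast; ring
        · simp only [indicator_of_notMem hv]; rw [hBn v (by simpa using hv)]; simp
      rw [h5, integral_sub (h4 B hBm ⟨C, fun v => by rw [abs_of_nonneg (hB0 v)]; exact hBC v⟩)
        (h4 (fun _ => A) measurable_const ⟨|A|, fun _ => le_rfl⟩), h2, h3]
      field_simp; ring
  refine (hlim.comp Real.tendsto_log_atTop).congr' ?_
  filter_upwards [eventually_ge_atTop 1] with x hx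
  have : 0 < x := by linarith
  simp only [Function.comp]
  rw [hBv _ (Real.log_nonneg hx), Real.exp_neg, Real.exp_log this, div_eq_mul_inv]

end

section
open Filter Topology MeasureTheory Set
open NumberField

/-- Dirichlet series over a general index. -/
noncomputable def ds {ι : Type*} (N : ι → ℕ) (F : ι → ℂ) (s : ℂ) : ℂ := ∑' i, F i * (N i : ℂ) ^ (-s)

/-- absolute convergence for `Re s > 1` -/
def dsConv {ι : Type*} (N : ι → ℕ) (F : ι → ℂ) : Prop :=
  (∀ i, 1 ≤ N i) ∧ ∀ x : ℝ, 1 < x → Summable fun i => ‖F i‖ * (N i : ℝ) ^ (-x)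

section
variable {ι : Type*} {N : ι → ℕ} {F : ι → ℂ}

lemma norm_ds_term (hN : ∀ i, 1 ≤ N i) (s : ℂ) (i : ι) :
    ‖F i * (N i : ℂ) ^ (-s)‖ = ‖F i‖ * (N i : ℝ) ^ (-s.re) := by
  rw [norm_mul, Complex.norm_natCast_cpow_of_pos (hN i), Complex.neg_re]

lemma dsConv.summable (h : dsConv N F) {s : ℂ} (hs : 1 < s.re) :
    Summable fun i => F i * (N i : ℂ) ^ (-s) := by
  refine Summable.of_norm ?_
  simp_rw [norm_ds_term h.1]; exact h.2 _ hs

lemma dsConv.mono {G : ι → ℂ} (h : dsConv N F) (hG : ∀ i, ‖G i‖ ≤ ‖F i‖) : dsConv N G :=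
  ⟨h.1, fun x hx => (h.2 x hx).of_nonneg_of_le (fun i => by positivity)
    fun i => mul_le_mul_of_nonneg_right (hG i) (by positivity)⟩

lemma dsConv.log (h : dsConv N F) : dsConv N fun i => F i * Real.log (N i) := by
  refine ⟨h.1, fun x hx => ?_⟩
  have h1 := h.2 (x - (x - 1) / 2) (by linarith)
  refine (h1.mul_left (1 / ((x - 1) / 2))).of_nonneg_of_le (fun i => by positivity) fun i => ?_
  have hN : (1:ℝ) ≤ N i := by exact_mod_cast h.1 i
  have h2 := Real.log_le_rpow_div (x := N i) (by positivity) (show 0 < (x - 1) / 2 by linarith)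
  rw [norm_mul, Complex.norm_real, Real.norm_eq_abs, abs_of_nonneg (Real.log_nonneg hN)]
  rw [show -(x - (x - 1) / 2) = -x + (x - 1) / 2 by ring, Real.rpow_add (by positivity)]
  calc _ ≤ ‖F i‖ * ((N i : ℝ) ^ ((x - 1) / 2) / ((x - 1) / 2)) * (N i : ℝ) ^ (-x) := by gcongr
    _ = _ := by ring

lemma dsConv.hasDerivAt (h : dsConv N F) {s : ℂ} (hs : 1 < s.re) :
    HasDerivAt (ds N F) (-ds N (fun i => F i * Real.log (N i)) s) s := by
  obtain ⟨x, hx1, hx2⟩ := exists_between hs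
  have := hasDerivAt_tsum_of_isPreconnected (h.log.2 x hx1)
    (isOpen_lt continuous_const Complex.continuous_re : IsOpen {z : ℂ | x < z.re})
    (convex_halfSpace_re_gt x).isPreconnected
    (g := fun i z => F i * (N i : ℂ) ^ (-z))
    (g' := fun i z => -(F i * Real.log (N i) * (N i : ℂ) ^ (-z))) ?_ ?_ hx2 (h.summable hs) hx2
  · rw [tsum_neg] at this; exact this
  · intro i z _
    have hn : (N i : ℂ) ≠ 0 := Nat.cast_ne_zero.2 (by have := h.1 i; omega)
    have h1 := ((hasDerivAt_neg z).const_cpow (c := (N i : ℂ)) (Or.inl hn)).const_mul (F i)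
    refine h1.congr_deriv ?_
    rw [Complex.ofReal_log (Nat.cast_nonneg _), Complex.ofReal_natCast]; ring
  · intro i z hz
    refine (norm_neg _).trans_le ((norm_ds_term (F := fun i => F i * Real.log (N i)) h.1 z i).trans_le ?_)
    refine mul_le_mul_of_nonneg_left ?_ (norm_nonneg _)
    exact Real.rpow_le_rpow_of_exponent_le (by exact_mod_cast h.1 i) (by simpa using le_of_lt hz)

/-- limit at infinity -/
lemma dsConv.tendsto (h : dsConv N F) :
    Tendsto (fun x : ℝ => ds N F x) atTop (𝓝 (∑' i, if N i = 1 then F i else 0)) := by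
  refine tendsto_tsum_of_dominated_convergence (h.2 2 one_lt_two) (fun i => ?_) ?_
  · by_cases h1 : N i = 1
    · simp [h1]
    · rw [if_neg h1]
      have h2 : (1:ℝ) < N i := by have := h.1 i; exact_mod_cast (show 1 < N i by omega)
      rw [tendsto_zero_iff_norm_tendsto_zero]
      simp_rw [norm_ds_term h.1]
      have := (tendsto_rpow_atBot_of_base_gt_one (N i : ℝ) h2).comp tendsto_neg_atTop_atBot
      simpa using this.const_mul ‖F i‖
  · filter_upwards [eventually_ge_atTop 2] with x hx i
    rw [norm_ds_term h.1]
    refine mul_le_mul_of_nonneg_left ?_ (norm_nonneg _)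
    exact Real.rpow_le_rpow_of_exponent_le (by exact_mod_cast h.1 i) (by simpa using hx)

/-- coefficient sequence -/
noncomputable def coef (N : ι → ℕ) (a : ι → ℝ) (n : ℕ) : ℝ := ∑' i : N ⁻¹' {n}, a i

lemma LSeries_coef {a : ι → ℝ} (h : dsConv N fun i => (a i : ℂ)) {s : ℂ} (hs : 1 < s.re) :
    LSeries (fun n => (coef N a n : ℂ)) s = ds N (fun i => (a i : ℂ)) s := by
  have h1 := (Equiv.sigmaFiberEquiv N).hasSum_iff.2 (h.summable hs).hasSum
  have h2 := h1.sigma fun n => (h1.summable.sigma_factor n).hasSum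
  rw [LSeries, ds, ← h2.tsum_eq]
  congr 1; ext n
  simp only [Function.comp, Equiv.sigmaFiberEquiv, Equiv.coe_fn_mk]
  rcases eq_or_ne n 0 with rfl | hn
  · rw [LSeries.term_zero]
    have : IsEmpty { x // N x = 0 } := ⟨fun x => by have := h.1 x.1; have := x.2; omega⟩
    simp
  · rw [LSeries.term_of_ne_zero hn, coef, Complex.ofReal_tsum, div_eq_mul_inv, ← tsum_mul_right]
    congr 1; ext i
    rw [show N (i : { x // N x = n }) = n from i.2, Complex.cpow_neg]

lemma sum_coef {a : ι → ℝ} (hf : ∀ n, {i | N i ≤ n}.Finite) (hN : ∀ i, 1 ≤ N i) (n : ℕ) :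
    ∑ k ∈ Finset.Icc 1 n, coef N a k = ∑ i ∈ (hf n).toFinset, a i := by
  classical
  rw [← Finset.sum_fiberwise_of_maps_to (s := (hf n).toFinset) (t := Finset.Icc 1 n) (g := N)
    (fun i hi => by simpa using ⟨hN i, by simpa using hi⟩)]
  refine Finset.sum_congr rfl fun k hk => ?_
  rw [coef, tsum_subtype (N ⁻¹' {k}) a, tsum_eq_sum (s := {i ∈ (hf n).toFinset | N i = k})]
  · refine Finset.sum_congr rfl fun i hi => ?_
    rw [indicator_of_mem]; exact (Finset.mem_filter.1 hi).2
  · intro i hi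
    rw [indicator_of_notMem]
    rintro rfl
    simp at hi hk; omega
end

end

section
open Filter Topology MeasureTheory Set
open NumberField

/-- abstract arithmetic semigroup data -/
structure Arith {I P : Type*} [CancelCommMonoid I] (nm : I →* ℕ) (pid : P → I) : Prop where
  pos : ∀ a, 1 ≤ nm a
  one : ∀ a, nm a = 1 → a = 1
  fin : ∀ n : ℕ, {a | nm a ≤ n}.Finite
  conv : ∀ x : ℝ, 1 < x → Summable fun a => (nm a : ℝ) ^ (-x)
  two : ∀ v, 2 ≤ nm (pid v)
  logid : ∀ a, HasSum (fun q : P × ℕ => open Classical in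
    if pid q.1 ^ (q.2 + 1) ∣ a then Real.log (nm (pid q.1)) else 0) (Real.log (nm a))
  cheb : ∃ C : ℝ, ∀ n : ℕ, ∀ s : Finset (P × ℕ), (∀ q ∈ s, nm (pid q.1 ^ (q.2 + 1)) ≤ n) →
    ∑ q ∈ s, Real.log (nm (pid q.1)) ≤ C * n

section
variable {I P : Type*} [CancelCommMonoid I] {nm : I →* ℕ} {pid : P → I}

/-- prime power -/
def qid (pid : P → I) (q : P × ℕ) : I := pid q.1 ^ (q.2 + 1)
/-- its von Mangoldt value -/
noncomputable def lgq (nm : I →* ℕ) (pid : P → I) (q : P × ℕ) : ℝ := Real.log (nm (pid q.1))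
/-- norm of a prime power -/
def nq (nm : I →* ℕ) (pid : P → I) (q : P × ℕ) : ℕ := nm (qid pid q)

variable (A : Arith nm pid)
include A

lemma Arith.lgq_ge (q : P × ℕ) : Real.log 2 ≤ lgq nm pid q :=
  Real.log_le_log two_pos (by exact_mod_cast A.two q.1)

lemma Arith.lgq_pos (q : P × ℕ) : 0 < lgq nm pid q := (Real.log_pos one_lt_two).trans_le (A.lgq_ge q)

lemma Arith.nq_ge (q : P × ℕ) : 2 ≤ nq nm pid q := by
  rw [nq, qid, map_pow]
  exact (A.two q.1).trans (Nat.le_self_pow (by omega) _)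

lemma Arith.log_nq (q : P × ℕ) : Real.log (nq nm pid q) = (q.2 + 1) * lgq nm pid q := by
  rw [nq, qid, map_pow, Nat.cast_pow, Real.log_pow, lgq]; push_cast; ring

lemma Arith.finQ (n : ℕ) : {q | nq nm pid q ≤ n}.Finite := by
  by_contra h
  obtain ⟨C, hC⟩ := A.cheb
  obtain ⟨s, hs, hc⟩ := Set.Infinite.exists_subset_card_eq h (⌊C * n / Real.log 2⌋₊ + 1)
  have h1 := hC n s (fun q hq => hs hq)
  have h2 : (s.card : ℝ) * Real.log 2 ≤ C * n :=
    le_trans (by rw [← nsmul_eq_mul]; exact Finset.card_nsmul_le_sum _ _ _ fun q _ => A.lgq_ge q) h1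
  have h3 := Nat.lt_floor_add_one (C * n / Real.log 2)
  rw [div_lt_iff₀ (Real.log_pos one_lt_two)] at h3
  rw [hc] at h2; push_cast at h2; linarith

lemma Arith.dsI {χ : I → ℂ} (hχ : ∀ a, ‖χ a‖ = 1) : dsConv (fun a => nm a) χ :=
  ⟨A.pos, fun x hx => by simpa [hχ] using A.conv x hx⟩

lemma Arith.LDaux {χ : I →* ℂ} (hχ : ∀ a, ‖χ a‖ = 1) {s : ℂ} (hs : 1 < s.re) :
    HasSum (fun p : (P × ℕ) × I => (lgq nm pid p.1 * χ (qid pid p.1) * (nq nm pid p.1 : ℂ) ^ (-s)) *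
      (χ p.2 * (nm p.2 : ℂ) ^ (-s))) (ds (fun a => nm a) (fun a => χ a * Real.log (nm a)) s) := by
  classical
  set g : I × (P × ℕ) → ℂ := fun p => (if qid pid p.2 ∣ p.1 then lgq nm pid p.2 else 0 : ℝ) *
    (χ p.1 * (nm p.1 : ℂ) ^ (-s)) with hg
  have hlog := (A.dsI hχ).log
  have hsum : Summable g := by
    refine Summable.of_norm ?_
    rw [summable_prod_of_nonneg (fun _ => norm_nonneg _)]
    have key : ∀ a, HasSum (fun q => ‖g (a, q)‖) (Real.log (nm a) * ‖χ a * (nm a : ℂ) ^ (-s)‖) := by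
      intro a
      have := (A.logid a).mul_right ‖χ a * (nm a : ℂ) ^ (-s)‖
      refine this.congr_fun fun q => ?_
      simp only [hg, norm_mul, Complex.norm_real, Real.norm_eq_abs]
      congr 1
      rw [abs_of_nonneg]; · rfl
      split_ifs; exacts [(A.lgq_pos q).le, le_rfl]
    refine ⟨fun a => (key a).summable, ?_⟩
    simp_rw [fun a => (key a).tsum_eq]
    refine (hlog.2 _ hs).congr fun a => ?_
    rw [norm_ds_term (fun a => A.pos a), norm_mul, Complex.norm_real, Real.norm_eq_abs, abs_of_nonneg
      (Real.log_natCast_nonneg _)]; ring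
  have h1 : HasSum g (ds (fun a => nm a) (fun a => χ a * Real.log (nm a)) s) := by
    have h2 := hsum.hasSum.prod_fiberwise (fun a => (hsum.prod_factor a).hasSum)
    have h3 : ∀ a, ∑' q, g (a, q) = χ a * Real.log (nm a) * (nm a : ℂ) ^ (-s) := by
      intro a
      have := ((Complex.hasSum_ofReal.2 (A.logid a)).mul_right (χ a * (nm a : ℂ) ^ (-s))).tsum_eq
      rw [show χ a * Real.log (nm a) * (nm a : ℂ) ^ (-s) = Real.log (nm a) * (χ a * (nm a : ℂ) ^ (-s)) by ring,
        ← this]; rfl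
    simp_rw [h3] at h2
    rw [ds, h2.tsum_eq]; exact hsum.hasSum
  have hinj : Function.Injective (fun p : (P × ℕ) × I => (qid pid p.1 * p.2, p.1)) := by
    rintro ⟨q, m⟩ ⟨q', m'⟩ h
    simp only [Prod.mk.injEq] at h
    obtain ⟨h, rfl⟩ := h
    simpa using h
  have h4 := (hinj.hasSum_iff (f := g) ?_).2 h1
  · refine h4.congr_fun fun p => ?_
    simp only [hg, Function.comp, dvd_mul_right, if_true, map_mul, nq, Nat.cast_mul]
    rw [Complex.natCast_mul_natCast_cpow]; ring
  · rintro ⟨a, q⟩ hx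
    simp only [hg]
    rw [if_neg, Complex.ofReal_zero, zero_mul]
    rintro ⟨m, rfl⟩
    exact hx ⟨(q, m), rfl⟩

lemma Arith.dsQ : dsConv (nq nm pid) (fun q => (lgq nm pid q : ℂ)) := by
  refine ⟨fun q => (A.nq_ge q).trans' one_le_two, fun x hx => ?_⟩
  have := A.LDaux (χ := 1) (by simp) (s := x) (by simpa)
  have h2 : Summable fun q : P × ℕ => _ := this.summable.comp_injective
    (i := fun q : P × ℕ => (q, (1 : I))) (fun a b h => by simpa using h)
  refine h2.norm.congr fun q => ?_
  simp only [Function.comp, norm_mul, map_one, MonoidHom.one_apply]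
  rw [Complex.norm_natCast_cpow_of_pos ((A.nq_ge q).trans_lt' two_pos)]
  simp

lemma Arith.LD {χ : I →* ℂ} (hχ : ∀ a, ‖χ a‖ = 1) {s : ℂ} (hs : 1 < s.re) :
    ds (fun a => nm a) (fun a => χ a * Real.log (nm a)) s =
      ds (nq nm pid) (fun q => lgq nm pid q * χ (qid pid q)) s * ds (fun a => nm a) χ s := by
  have h1 : Summable fun q => lgq nm pid q * χ (qid pid q) * (nq nm pid q : ℂ) ^ (-s) :=
    (A.dsQ.mono (G := fun q => lgq nm pid q * χ (qid pid q)) fun q => by simp [hχ]).summable hs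
  have h2 := (A.dsI hχ).summable hs
  have h := A.LDaux hχ hs
  rw [← h.tsum_eq]
  exact (h1.tsum_mul_tsum h2 h.summable).symm

/-- logarithm of the L-series -/
noncomputable def Eser (nm : I →* ℕ) (pid : P → I) (χ : I →* ℂ) (s : ℂ) : ℂ :=
  ds (nq nm pid) (fun q => χ (qid pid q) / (q.2 + 1)) s

lemma Arith.convE {χ : I →* ℂ} (hχ : ∀ a, ‖χ a‖ = 1) :
    dsConv (nq nm pid) (fun q => χ (qid pid q) / (q.2 + 1)) := by
  have h := A.dsQ
  refine ⟨h.1, fun x hx => ((h.2 x hx).mul_left (1 / Real.log 2)).of_nonneg_of_le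
    (fun i => by positivity) fun q => ?_⟩
  have h1 : ‖χ (qid pid q) / ((q.2 : ℂ) + 1)‖ ≤ 1 := by
    rw [norm_div, hχ]
    rw [show ((q.2 : ℂ) + 1) = ((q.2 + 1 : ℕ) : ℂ) by push_cast; rfl, Complex.norm_natCast]
    exact div_le_self zero_le_one (by simp)
  have h2 : 1 ≤ 1 / Real.log 2 * lgq nm pid q := by
    rw [one_div, inv_mul_eq_div, one_le_div (Real.log_pos one_lt_two)]; exact A.lgq_ge q
  rw [Complex.norm_real, Real.norm_eq_abs, abs_of_pos (A.lgq_pos q), ← mul_assoc]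
  gcongr; linarith

lemma Arith.L_eq_exp {χ : I →* ℂ} (hχ : ∀ a, ‖χ a‖ = 1) {s : ℂ} (hs : 1 < s.re) :
    ds (fun a => nm a) χ s = Complex.exp (Eser nm pid χ s) := by
  have hE : ∀ z : ℂ, 1 < z.re → HasDerivAt (Eser nm pid χ)
      (-ds (nq nm pid) (fun q => lgq nm pid q * χ (qid pid q)) z) z := by
    intro z hz
    refine ((A.convE hχ).hasDerivAt hz).congr_deriv ?_
    congr 2; ext q
    rw [A.log_nq q]
    have : (q.2 : ℂ) + 1 ≠ 0 := Nat.cast_add_one_ne_zero _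
    push_cast; field_simp
  have hd : ∀ z : ℂ, 1 < z.re → HasDerivAt (fun z => ds (fun a => nm a) χ z * Complex.exp (-Eser nm pid χ z)) 0 z := by
    intro z hz
    refine (((A.dsI hχ).hasDerivAt hz).mul (hE z hz).neg.cexp).congr_deriv ?_
    rw [A.LD hχ hz]; ring
  have hopen : IsOpen {z : ℂ | 1 < z.re} := isOpen_lt continuous_const Complex.continuous_re
  have hconst : ∀ z : ℂ, 1 < z.re → ds (fun a => nm a) χ z * Complex.exp (-Eser nm pid χ z) =
      ds (fun a => nm a) χ s * Complex.exp (-Eser nm pid χ s) := fun z hz =>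
    hopen.is_const_of_deriv_eq_zero (convex_halfSpace_re_gt 1).isPreconnected
      (f := fun z => ds (fun a => nm a) χ z * Complex.exp (-Eser nm pid χ z))
      (fun z hz => (hd z hz).differentiableAt.differentiableWithinAt) (fun z hz => (hd z hz).deriv) hz hs
  have h1 := (A.dsI hχ).tendsto
  have h2 := (A.convE hχ).tendsto
  rw [tsum_eq_single 1 (fun a ha => if_neg fun h => ha (A.one a h))] at h1
  rw [tsum_congr (g := fun _ => 0) (fun q => if_neg (by have := A.nq_ge q; omega)), tsum_zero] at h2
  have h3 := h1.mul h2.neg.cexp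
  simp only [map_one, if_true, neg_zero, Complex.exp_zero, mul_one] at h3
  have h4 : ds (fun a => nm a) χ s * Complex.exp (-Eser nm pid χ s) = 1 := by
    refine tendsto_nhds_unique (tendsto_const_nhds.congr' ?_) h3
    filter_upwards [eventually_gt_atTop 1] with x hx
    exact (hconst x (by simpa)).symm
  rw [Complex.exp_neg] at h4
  field_simp at h4; exact h4

lemma Arith.three_four_one {χ : I →* ℂ} (hχ : ∀ a, ‖χ a‖ = 1) {x : ℝ} (hx : 1 < x) (t : ℝ) :
    1 ≤ ‖ds (fun a => nm a) (1 : I →* ℂ) x‖ ^ 3 * ‖ds (fun a => nm a) χ (x + t * Complex.I)‖ ^ 4 *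
      ‖ds (fun a => nm a) (χ ^ 2 : I →* ℂ) (x + 2 * t * Complex.I)‖ := by
  have h1 : ∀ a, ‖(1 : I →* ℂ) a‖ = 1 := by simp
  have h2 : ∀ a, ‖(χ ^ 2 : I →* ℂ) a‖ = 1 := by simp [hχ]
  have e1 : 1 < (x : ℂ).re := by simpa
  have e2 : 1 < (x + t * Complex.I : ℂ).re := by simpa
  have e3 : 1 < (x + 2 * t * Complex.I : ℂ).re := by simpa
  rw [A.L_eq_exp h1 e1, A.L_eq_exp hχ e2, A.L_eq_exp h2 e3]
  simp only [Complex.norm_exp, ← Real.exp_nat_mul, ← Real.exp_add]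
  rw [Real.one_le_exp_iff]
  have s1 := (Complex.hasSum_re ((A.convE h1).summable e1).hasSum).mul_left 3
  have s2 := (Complex.hasSum_re ((A.convE hχ).summable e2).hasSum).mul_left 4
  have s3 := Complex.hasSum_re ((A.convE h2).summable e3).hasSum
  have := (s1.add s2).add s3
  refine (this.nonneg fun q => ?_).trans_eq (by push_cast; rfl)
  have hpos : (0:ℝ) < nq nm pid q := by have := A.nq_ge q; positivity
  have hN : (nq nm pid q : ℂ) ≠ 0 := by exact_mod_cast hpos.ne'
  set u : ℂ := (nq nm pid q : ℂ) ^ (-(t * Complex.I)) with hu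
  set r : ℝ := (nq nm pid q : ℝ) ^ (-x) with hr
  have c1 : (nq nm pid q : ℂ) ^ (-(x:ℂ)) = r := by
    rw [hr, Complex.ofReal_cpow hpos.le]; push_cast; rfl
  have c2 : (nq nm pid q : ℂ) ^ (-(x + t * Complex.I : ℂ)) = r * u := by
    rw [neg_add, Complex.cpow_add _ _ hN, c1]
  have c3 : (nq nm pid q : ℂ) ^ (-(x + 2 * t * Complex.I : ℂ)) = r * u ^ 2 := by
    rw [neg_add, Complex.cpow_add _ _ hN, c1, hu, ← Complex.cpow_nat_mul]; congr 2; push_cast; ring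
  have hun : ‖u‖ = 1 := by
    rw [hu, Complex.norm_natCast_cpow_of_pos (by exact_mod_cast hpos)]; simp
  set z : ℂ := χ (qid pid q) * u with hz
  have hzn : ‖z‖ = 1 := by rw [hz, norm_mul, hχ, hun, one_mul]
  have hzz : z.re ^ 2 + z.im ^ 2 = 1 := by
    have := Complex.sq_norm z; rw [hzn, Complex.normSq_apply] at this; nlinarith
  rw [c1, c2, c3]
  have r1 : ((1 : I →* ℂ) (qid pid q) / ((q.2:ℂ) + 1) * r).re = r / (q.2 + 1) := by
    rw [show ((1 : I →* ℂ) (qid pid q) / ((q.2:ℂ) + 1) * r) = ((r / (q.2 + 1) : ℝ) : ℂ) by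
      simp; ring]; simp [-Complex.ofReal_div]
  have r2 : (χ (qid pid q) / ((q.2:ℂ) + 1) * (r * u)).re = r / (q.2 + 1) * z.re := by
    rw [show (χ (qid pid q) / ((q.2:ℂ) + 1) * (r * u)) = ((r / (q.2 + 1) : ℝ) : ℂ) * z by
      rw [hz]; push_cast; ring, Complex.re_ofReal_mul]
  have r3 : ((χ ^ 2 : I →* ℂ) (qid pid q) / ((q.2:ℂ) + 1) * (r * u ^ 2)).re =
      r / (q.2 + 1) * (z.re ^ 2 - z.im ^ 2) := by
    rw [show ((χ ^ 2 : I →* ℂ) (qid pid q) / ((q.2:ℂ) + 1) * (r * u ^ 2)) =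
      ((r / (q.2 + 1) : ℝ) : ℂ) * (z * z) by
      rw [hz, MonoidHom.pow_apply]; push_cast; ring, Complex.re_ofReal_mul, Complex.mul_re]; ring
  rw [r1, r2, r3]
  have : 0 ≤ r / (q.2 + 1) * (2 * (1 + z.re) ^ 2) := by positivity
  calc (0:ℝ) ≤ _ := this
    _ = 3 * (r / (q.2 + 1)) + 4 * (r / (q.2 + 1) * z.re) + r / (q.2 + 1) * (z.re ^ 2 - z.im ^ 2)
       + r / (q.2 + 1) * (z.re ^ 2 + z.im ^ 2 - 1) := by ring
    _ = _ := by rw [hzz]; ring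
end

end

section
open Filter Topology MeasureTheory Set
open NumberField

section
variable {I P : Type*} [CancelCommMonoid I] {nm : I →* ℕ} {pid : P → I}
variable (A : Arith nm pid)
include A

/-- the Dirichlet series of a character -/
noncomputable abbrev Lser (nm : I →* ℕ) (χ : I →* ℂ) (s : ℂ) : ℂ := ds (fun a => nm a) χ s
/-- the Dirichlet series of the von Mangoldt function twisted -/
noncomputable abbrev Dser (nm : I →* ℕ) (pid : P → I) (χ : I →* ℂ) (s : ℂ) : ℂ :=
  ds (nq nm pid) (fun q => lgq nm pid q * χ (qid pid q)) s

lemma Arith.L_ne {χ : I →* ℂ} (hχ : ∀ a, ‖χ a‖ = 1) {s : ℂ} (hs : 1 < s.re) : Lser nm χ s ≠ 0 := by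
  rw [Lser, A.L_eq_exp hχ hs]; exact Complex.exp_ne_zero _

lemma Arith.L_hasDeriv {χ : I →* ℂ} (hχ : ∀ a, ‖χ a‖ = 1) {s : ℂ} (hs : 1 < s.re) :
    HasDerivAt (Lser nm χ) (-(Dser nm pid χ s * Lser nm χ s)) s := by
  have := (A.dsI hχ).hasDerivAt hs
  rwa [A.LD hχ hs] at this

lemma Arith.nonvanish {χ : I →* ℂ} (hχ : ∀ a, ‖χ a‖ = 1) {Z1 Y Y2 : ℂ → ℂ} {t : ℝ}
    (hZ1 : ContinuousAt Z1 1) (hZ1L : ∀ s : ℂ, 1 < s.re → Z1 s = (s - 1) * Lser nm 1 s)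
    (hY : DifferentiableAt ℂ Y (1 + t * Complex.I))
    (hYL : ∀ s : ℂ, 1 < s.re → Y s = Lser nm χ s)
    (hY2 : ContinuousAt Y2 (1 + 2 * t * Complex.I))
    (hY2L : ∀ s : ℂ, 1 < s.re → Y2 s = Lser nm (χ ^ 2) s) :
    Y (1 + t * Complex.I) ≠ 0 := by
  intro h0
  have hcx : Tendsto (fun x : ℝ => (x : ℂ)) (𝓝[>] 1) (𝓝 1) :=
    (Complex.continuous_ofReal.tendsto' (1:ℝ) 1 (by simp)).mono_left nhdsWithin_le_nhds
  have l1 : Tendsto (fun x : ℝ => ‖Z1 x‖ ^ 3) (𝓝[>] 1) (𝓝 (‖Z1 1‖ ^ 3)) :=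
    ((hZ1.tendsto.comp hcx).norm).pow 3
  have l3 : Tendsto (fun x : ℝ => ‖Y2 (x + 2 * t * Complex.I)‖) (𝓝[>] 1)
      (𝓝 ‖Y2 (1 + 2 * t * Complex.I)‖) := (hY2.tendsto.comp (hcx.add_const _)).norm
  have l2 : Tendsto (fun x : ℝ => ‖((x:ℂ) - 1)⁻¹ * Y (x + t * Complex.I)‖) (𝓝[>] 1)
      (𝓝 ‖deriv Y (1 + t * Complex.I)‖) := by
    have h1 := hY.hasDerivAt.tendsto_slope
    have h2 : Tendsto (fun x : ℝ => (x + t * Complex.I : ℂ)) (𝓝[>] 1) (𝓝[≠] (1 + t * Complex.I)) := by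
      rw [tendsto_nhdsWithin_iff]
      refine ⟨hcx.add_const _, ?_⟩
      filter_upwards [self_mem_nhdsWithin] with x hx h
      have : (x : ℂ) = 1 := by simpa using h
      have hx' : (1:ℝ) < x := hx
      have : x = 1 := by exact_mod_cast this
      linarith
    have h3 := (h1.comp h2).norm
    refine h3.congr fun x => ?_
    simp [slope, h0]
  have l4 : Tendsto (fun x : ℝ => x - 1) (𝓝[>] 1) (𝓝 0) :=
    ((continuous_id.sub continuous_const).tendsto' (1:ℝ) 0 (by simp)).mono_left nhdsWithin_le_nhds
  have l := ((l1.mul (l2.pow 4)).mul l3).mul l4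
  rw [mul_zero] at l
  have : ∀ᶠ x : ℝ in 𝓝[>] 1, 1 ≤ ‖Z1 x‖ ^ 3 * ‖((x:ℂ) - 1)⁻¹ * Y (x + t * Complex.I)‖ ^ 4 *
      ‖Y2 (x + 2 * t * Complex.I)‖ * (x - 1) := by
    filter_upwards [self_mem_nhdsWithin] with x hx
    have hx' : (1:ℝ) < x := hx
    refine (A.three_four_one hχ hx' t).trans_eq ?_
    rw [hZ1L x (by simpa), hYL _ (by simpa), hY2L _ (by simpa)]
    have hn : ‖(x:ℂ) - 1‖ = x - 1 := by
      rw [show (x:ℂ) - 1 = ((x - 1 : ℝ) : ℂ) by push_cast; rfl, Complex.norm_real, Real.norm_eq_abs,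
        abs_of_pos (by linarith)]
    rw [norm_mul, norm_mul, norm_inv, hn]
    have : x - 1 ≠ 0 := by linarith
    simp only [Lser]
    field_simp
  have := ge_of_tendsto l this
  linarith

/-- sum over prime powers of norm at most x -/
noncomputable def Arith.psum {E : Type*} [AddCommMonoid E] (A : Arith nm pid) (F : P × ℕ → E) (x : ℝ) : E :=
  ∑ q ∈ (A.finQ ⌊x⌋₊).toFinset, F q

lemma Arith.wi (a : P × ℕ → ℝ) (ha : ∀ q, 0 ≤ a q) (ha2 : ∀ q, a q ≤ 2 * lgq nm pid q) (R : ℝ) (G : ℂ → ℂ)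
    (hG : ContinuousOn G {s | 1 ≤ s.re})
    (hL : ∀ s, 1 < s.re → ds (nq nm pid) (fun q => (a q : ℂ)) s = G s + R / (s - 1)) :
    Tendsto (fun x => A.psum a x / x) atTop (𝓝 R) := by
  obtain ⟨C, hC⟩ := A.cheb
  have hpos : ∀ q, 1 ≤ nq nm pid q := fun q => (A.nq_ge q).trans' one_le_two
  have hconv : dsConv (nq nm pid) (fun q => (a q : ℂ)) := by
    refine ⟨hpos, fun x hx => ((A.dsQ.2 x hx).mul_left 2).of_nonneg_of_le (fun q => by positivity) fun q => ?_⟩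
    simp only [Complex.norm_real, Real.norm_eq_abs, abs_of_nonneg (ha q), abs_of_pos (A.lgq_pos q), ← mul_assoc]
    exact mul_le_mul_of_nonneg_right (ha2 q) (by positivity)
  have := WI_nat (coef (nq nm pid) a) (fun n => tsum_nonneg fun i => ha _) (2 * C) (fun n => ?_) R G hG
    (fun s hs => by rw [LSeries_coef hconv hs, hL s hs])
  · refine this.congr fun x => ?_
    rw [sum_coef A.finQ hpos]; rfl
  · rw [sum_coef A.finQ hpos]
    have := hC n (A.finQ n).toFinset (fun q hq => (A.finQ n).mem_toFinset.1 hq)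
    calc _ ≤ ∑ q ∈ (A.finQ n).toFinset, 2 * lgq nm pid q := Finset.sum_le_sum fun q _ => ha2 q
      _ = 2 * ∑ q ∈ (A.finQ n).toFinset, lgq nm pid q := by rw [Finset.mul_sum]
      _ ≤ 2 * (C * n) := by gcongr; exact this
      _ = _ := by ring

variable {δ : ℝ} (hδ : 0 < δ) {Z1 : ℂ → ℂ} (hZ1 : DifferentiableOn ℂ Z1 {s | 1 - δ < s.re})
  (hZ1L : ∀ s : ℂ, 1 < s.re → Z1 s = (s - 1) * Lser nm 1 s) (hZ11 : Z1 1 ≠ 0)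
include hδ hZ1 hZ1L

omit A in
lemma half_mem_nhds {s : ℂ} (hs : 1 ≤ s.re) : {s : ℂ | 1 - δ < s.re} ∈ 𝓝 s :=
  (isOpen_lt continuous_const Complex.continuous_re).mem_nhds (by simp; linarith)

include hZ11 in
omit hZ1L hZ1 A in
lemma contG {Z : ℂ → ℂ} (hZ : DifferentiableOn ℂ Z {s | 1 - δ < s.re}) (hne : ∀ s : ℂ, 1 ≤ s.re → Z s ≠ 0) :
    ContinuousOn (fun s => -(deriv Z s / Z s)) {s | 1 ≤ s.re} := by
  have ho : IsOpen {s : ℂ | 1 - δ < s.re} := isOpen_lt continuous_const Complex.continuous_re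
  have hsub : {s : ℂ | 1 ≤ s.re} ⊆ {s | 1 - δ < s.re} := fun s (hs : 1 ≤ s.re) => by
    simp only [mem_ofPred_eq]; linarith
  exact (((hZ.deriv ho).continuousOn.mono hsub).div (hZ.continuousOn.mono hsub) hne).neg

omit A hδ hZ1 hZ1L in
lemma re_one {s : ℂ} (h : s.re = 1) : s = 1 + s.im * Complex.I := by
  apply Complex.ext <;> simp [h]

include hZ11 in
lemma Arith.one_G : ∃ G : ℂ → ℂ, ContinuousOn G {s | 1 ≤ s.re} ∧
    ∀ s, 1 < s.re → Dser nm pid 1 s = G s + 1 / (s - 1) := by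
  have h1 : ∀ a, ‖(1 : I →* ℂ) a‖ = 1 := by simp
  have hda : ∀ s : ℂ, 1 ≤ s.re → DifferentiableAt ℂ Z1 s := fun s hs =>
    hZ1.differentiableAt (half_mem_nhds (δ := δ) hδ hZ1 hZ1L hs)
  have hne : ∀ s : ℂ, 1 ≤ s.re → Z1 s ≠ 0 := by
    intro s hs
    rcases hs.lt_or_eq with hs | hs
    · rw [hZ1L s hs]
      refine mul_ne_zero (fun h => ?_) (A.L_ne h1 hs)
      rw [sub_eq_zero.1 h] at hs; simp at hs
    · rw [re_one hs.symm]
      rcases eq_or_ne s.im 0 with h | h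
      · rw [h]; simpa
      · have hd : ∀ t : ℝ, t ≠ 0 → DifferentiableAt ℂ (fun s => Z1 s / (s - 1)) (1 + t * Complex.I) :=
          fun t ht => (hda _ (by simp)).div (differentiableAt_id.sub_const _) (by simpa)
        have hL : ∀ z : ℂ, 1 < z.re → Z1 z / (z - 1) = Lser nm 1 z := by
          intro z hz
          rw [hZ1L z hz, mul_div_cancel_left₀]
          intro h; rw [sub_eq_zero.1 h] at hz; simp at hz
        have := A.nonvanish h1 (hda 1 (by simp)).continuousAt hZ1L (hd _ h) hL (Y2 := fun s => Z1 s / (s - 1))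
          (by have := (hd (2 * s.im) (by simpa)).continuousAt; push_cast at this; exact this)
          (by rw [one_pow]; exact hL)
        exact (div_ne_zero_iff.1 this).1
  refine ⟨_, contG hδ hZ11 hZ1 hne, fun s hs => ?_⟩
  have hs1 : s - 1 ≠ 0 := by intro h; rw [sub_eq_zero.1 h] at hs; simp at hs
  have hd : HasDerivAt (fun z => (z - 1) * Lser nm 1 z)
      (1 * Lser nm 1 s + (s - 1) * -(Dser nm pid 1 s * Lser nm 1 s)) s :=
    ((hasDerivAt_id s).sub_const 1).mul (A.L_hasDeriv h1 hs)
  have he : Z1 =ᶠ[𝓝 s] (fun z => (z - 1) * Lser nm 1 z) := by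
    filter_upwards [(isOpen_lt continuous_const Complex.continuous_re).mem_nhds hs] with z hz
    exact hZ1L z hz
  have hL0 := A.L_ne h1 hs
  rw [he.deriv_eq, hd.deriv, hZ1L s hs]
  field_simp; ring

include hZ11 in
lemma Arith.chi_G {χ : I →* ℂ} (hχ : ∀ a, ‖χ a‖ = 1) {Z Z2 : ℂ → ℂ}
    (hZ : DifferentiableOn ℂ Z {s | 1 - δ < s.re}) (hZL : ∀ s : ℂ, 1 < s.re → Z s = Lser nm χ s)
    (hZ2 : DifferentiableOn ℂ Z2 {s | 1 - δ < s.re}) (hZ2L : ∀ s : ℂ, 1 < s.re → Z2 s = Lser nm (χ ^ 2) s) :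
    ∃ G : ℂ → ℂ, ContinuousOn G {s | 1 ≤ s.re} ∧ ∀ s, 1 < s.re → Dser nm pid χ s = G s := by
  have hm : ∀ s : ℂ, 1 ≤ s.re → _ := fun s hs => half_mem_nhds (δ := δ) hδ hZ1 hZ1L hs
  have hne : ∀ s : ℂ, 1 ≤ s.re → Z s ≠ 0 := by
    intro s hs
    rcases hs.lt_or_eq with hs | hs
    · rw [hZL s hs]; exact A.L_ne hχ hs
    · rw [re_one hs.symm]
      exact A.nonvanish hχ (hZ1.differentiableAt (hm 1 (by simp))).continuousAt hZ1L
        (hZ.differentiableAt (hm _ (by simp))) hZL (hZ2.differentiableAt (hm _ (by simp))).continuousAt hZ2L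
  refine ⟨_, contG hδ hZ11 hZ hne, fun s hs => ?_⟩
  have he : Z =ᶠ[𝓝 s] Lser nm χ := by
    filter_upwards [(isOpen_lt continuous_const Complex.continuous_re).mem_nhds hs] with z hz
    exact hZL z hz
  have hL0 := A.L_ne hχ hs
  rw [he.deriv_eq, (A.L_hasDeriv hχ hs).deriv, hZL s hs]
  field_simp

include hZ11 in
lemma Arith.pit_one : Tendsto (fun x => A.psum (lgq nm pid) x / x) atTop (𝓝 1) := by
  obtain ⟨G, hG, hGL⟩ := A.one_G hδ hZ1 hZ1L hZ11
  refine A.wi (lgq nm pid) (fun q => (A.lgq_pos q).le) (fun q => by linarith [A.lgq_pos q]) 1 G hG fun s hs => ?_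
  have := hGL s hs
  simpa [Dser] using this

include hZ11 in
lemma Arith.pit_chi {χ χ' : I →* ℂ} (hχ : ∀ a, ‖χ a‖ = 1) (hχ' : ∀ a, χ' a = starRingEnd ℂ (χ a))
    {Z Z2 Z' Z2' : ℂ → ℂ}
    (hZ : DifferentiableOn ℂ Z {s | 1 - δ < s.re}) (hZL : ∀ s : ℂ, 1 < s.re → Z s = Lser nm χ s)
    (hZ2 : DifferentiableOn ℂ Z2 {s | 1 - δ < s.re}) (hZ2L : ∀ s : ℂ, 1 < s.re → Z2 s = Lser nm (χ ^ 2) s)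
    (hZ' : DifferentiableOn ℂ Z' {s | 1 - δ < s.re}) (hZL' : ∀ s : ℂ, 1 < s.re → Z' s = Lser nm χ' s)
    (hZ2' : DifferentiableOn ℂ Z2' {s | 1 - δ < s.re}) (hZ2L' : ∀ s : ℂ, 1 < s.re → Z2' s = Lser nm (χ' ^ 2) s) :
    Tendsto (fun x : ℝ => A.psum (fun q => lgq nm pid q * χ (qid pid q)) x / x) atTop (𝓝 0) := by
  have hn' : ∀ a, ‖χ' a‖ = 1 := fun a => by rw [hχ' a, RCLike.norm_conj, hχ]
  obtain ⟨G, hG, hGL⟩ := A.one_G hδ hZ1 hZ1L hZ11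
  obtain ⟨H, hH, hHL⟩ := A.chi_G hδ hZ1 hZ1L hZ11 hχ hZ hZL hZ2 hZ2L
  obtain ⟨H', hH', hHL'⟩ := A.chi_G hδ hZ1 hZ1L hZ11 hn' hZ' hZL' hZ2' hZ2L'
  have s1 : ∀ {s : ℂ}, 1 < s.re → _ := fun {s} hs => A.dsQ.summable hs
  have sc : ∀ {χ : I →* ℂ} (_ : ∀ a, ‖χ a‖ = 1) {s : ℂ}, 1 < s.re → _ := fun {χ} hχ {s} hs =>
    (A.dsQ.mono (G := fun q => lgq nm pid q * χ (qid pid q)) fun q => by simp [hχ]).summable hs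
  have one := A.pit_one hδ hZ1 hZ1L hZ11
  have gen : ∀ (u v : ℂ) (b : P × ℕ → ℝ), (∀ q, |b q| ≤ 1) →
      (∀ q, (b q : ℂ) = u * χ (qid pid q) + v * χ' (qid pid q)) →
      Tendsto (fun x => A.psum (fun q => lgq nm pid q * b q) x / x) atTop (𝓝 0) := by
    intro u v b hb hbe
    have := A.wi (fun q => lgq nm pid q * (1 + b q))
      (fun q => mul_nonneg (A.lgq_pos q).le (by have := abs_le.1 (hb q); linarith))
      (fun q => by have := abs_le.1 (hb q); nlinarith [A.lgq_pos q]) 1 (fun s => G s + (u * H s + v * H' s))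
      (hG.add ((continuousOn_const.mul hH).add (continuousOn_const.mul hH'))) ?_
    · have h2 := this.sub one
      rw [sub_self] at h2
      refine h2.congr fun x => ?_
      rw [← sub_div, Arith.psum, Arith.psum, Arith.psum, ← Finset.sum_sub_distrib]
      congr 2; ext q; ring
    · intro s hs
      have e1 := hGL s hs
      have e2 := hHL s hs
      have e3 := hHL' s hs
      have t1 := s1 hs
      have t2 := sc hχ hs
      have t3 := sc hn' hs
      rw [← e2, ← e3, show G s = Dser nm pid 1 s - 1 / (s - 1) by rw [e1]; ring]
      simp only [Dser, ds, MonoidHom.one_apply, mul_one, Complex.ofReal_one]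
      rw [← tsum_mul_left, ← tsum_mul_left, ← (t2.mul_left u).tsum_add (t3.mul_left v)]
      rw [show ∀ a b c : ℂ, a - c + b + c = a + b by intros; ring, ← t1.tsum_add ((t2.mul_left u).add (t3.mul_left v))]
      congr 1; ext q
      push_cast; rw [hbe q]; ring
  have hre := gen (1 / 2) (1 / 2) (fun q => (χ (qid pid q)).re) (fun q => (Complex.abs_re_le_norm _).trans (hχ _).le)
    (fun q => by rw [hχ', ← mul_add, Complex.add_conj]; push_cast; ring)
  have him := gen (1 / (2 * Complex.I)) (-(1 / (2 * Complex.I))) (fun q => (χ (qid pid q)).im)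
    (fun q => (Complex.abs_im_le_norm _).trans (hχ _).le)
    (fun q => by
      rw [hχ', neg_mul, ← sub_eq_add_neg, ← mul_sub, Complex.sub_conj]; push_cast; field_simp)
  have := hre.ofReal.add (him.ofReal.mul_const Complex.I)
  simp only [Complex.ofReal_zero, zero_mul, add_zero, Complex.coe_algebraMap] at this
  refine Tendsto.congr (fun x => ?_) (by simpa using this)
  simp only [Arith.psum]
  push_cast
  rw [div_mul_eq_mul_div, ← add_div, Finset.sum_mul, ← Finset.sum_add_distrib]
  congr 2; ext q
  conv_rhs => rw [← Complex.re_add_im (χ (qid pid q))]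
  ring
end

end

section
open Filter Topology MeasureTheory Set
open NumberField nonZeroDivisors IsDedekindDomain

section
variable (K : Type*) [Field K] [NumberField K]

/-- nonzero ideals -/
abbrev ID := ↥((Ideal (𝓞 K))⁰)

noncomputable instance : CancelCommMonoid (ID K) :=
  { (inferInstance : CommMonoid (ID K)) with
    mul_left_cancel := fun a b c h => Subtype.ext
      (mul_left_cancel₀ (nonZeroDivisors.coe_ne_zero a) (congrArg Subtype.val h)) }

/-- norm -/
noncomputable def nmK : ID K →* ℕ := (Ideal.absNorm : Ideal (𝓞 K) →*₀ ℕ).toMonoidHom.comp (Submonoid.subtype _)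

/-- primes -/
noncomputable def pidK (v : HeightOneSpectrum (𝓞 K)) : ID K :=
  ⟨v.asIdeal, mem_nonZeroDivisors_of_ne_zero v.ne_bot⟩

variable {K}

lemma nmK_apply (a : ID K) : nmK K a = Ideal.absNorm (a : Ideal (𝓞 K)) := rfl

lemma ID_dvd {a b : ID K} : a ∣ b ↔ (a : Ideal (𝓞 K)) ∣ b := by
  refine ⟨fun ⟨c, h⟩ => ⟨c, congrArg Subtype.val h⟩, fun ⟨c, h⟩ => ?_⟩
  have hc : c ≠ 0 := by rintro rfl; rw [mul_zero] at h; exact nonZeroDivisors.coe_ne_zero b h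
  exact ⟨⟨c, mem_nonZeroDivisors_of_ne_zero hc⟩, Subtype.ext h⟩

lemma ideal_logid (a : Ideal (𝓞 K)) (ha : a ≠ 0) :
    HasSum (fun q : HeightOneSpectrum (𝓞 K) × ℕ => open Classical in
    if q.1.asIdeal ^ (q.2 + 1) ∣ a then Real.log (Ideal.absNorm q.1.asIdeal) else 0)
      (Real.log (Ideal.absNorm a)) := by
  classical
  induction a using UniqueFactorizationMonoid.induction_on_prime with
  | h₁ => exact absurd rfl ha
  | h₂ a hu =>
    rw [Ideal.isUnit_iff] at hu; subst hu
    rw [Ideal.absNorm_top, Nat.cast_one, Real.log_one]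
    convert hasSum_zero with q
    rw [if_neg]
    intro h
    have := (Ideal.dvd_iff_le.1 ((dvd_pow_self q.1.asIdeal (Nat.succ_ne_zero q.2)).trans h))
    exact q.1.isPrime.ne_top (top_le_iff.1 this)
  | h₃ a p ha' hp ih =>
    set v0 : HeightOneSpectrum (𝓞 K) := ⟨p, Ideal.isPrime_of_prime hp, hp.ne_zero⟩ with hv0
    have hfm : FiniteMultiplicity p a := FiniteMultiplicity.of_prime_left hp ha'
    have h1 := (ih ha').add (hasSum_ite_eq (v0, multiplicity p a) (Real.log (Ideal.absNorm p)))
    rw [map_mul, Nat.cast_mul, Real.log_mul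
      (by simpa [Ideal.absNorm_eq_zero_iff] using hp.ne_zero) (by simpa [Ideal.absNorm_eq_zero_iff] using ha'),
      add_comm]
    refine h1.congr_fun ?_
    rintro ⟨v, k⟩
    by_cases hv : v = v0
    · subst hv
      have e1 : p ^ (k + 1) ∣ p * a ↔ k ≤ multiplicity p a := by
        rw [pow_succ', mul_dvd_mul_iff_left hp.ne_zero, hfm.pow_dvd_iff_le_multiplicity]
      have e2 : p ^ (k + 1) ∣ a ↔ k + 1 ≤ multiplicity p a := hfm.pow_dvd_iff_le_multiplicity
      simp only [hv0, e1, e2, Prod.mk.injEq, true_and]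
      split_ifs <;> first | omega | simp
    · have e1 : v.asIdeal ^ (k + 1) ∣ p * a ↔ v.asIdeal ^ (k + 1) ∣ a := by
        refine ⟨fun h => ?_, fun h => h.mul_left _⟩
        refine v.prime.pow_dvd_of_dvd_mul_left _ (fun h' => hv ?_) h
        have := (Prime.dvd_prime_iff_associated v.prime hp).1 h'
        exact HeightOneSpectrum.ext (associated_iff_eq.1 this)
      simp only [e1, Prod.mk.injEq, hv, false_and, if_false, add_zero]

lemma card_le_linear : ∃ C : ℝ, 0 ≤ C ∧ ∀ n : ℕ, ∀ s : Finset (ID K), (∀ a ∈ s, nmK K a ≤ n) → (s.card : ℝ) ≤ C * n := by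
  have h := (NumberField.Ideal.tendsto_norm_le_div_atTop₀ K).comp tendsto_natCast_atTop_atTop
  obtain ⟨C, hC⟩ := h.isBoundedUnder_le.bddAbove_range
  have hC0 : 0 ≤ C := le_trans (by simp) (hC ⟨0, rfl⟩)
  refine ⟨C, hC0, fun n s hs => ?_⟩
  have hfin := Ideal.finite_setOfPred_absNorm_le₀ (S := 𝓞 K) n
  rcases Nat.eq_zero_or_pos n with rfl | hn
  · have : s = ∅ := by
      refine Finset.eq_empty_of_forall_notMem fun a ha => ?_
      have := hs a ha
      rw [Nat.le_zero, nmK_apply, Ideal.absNorm_eq_zero_iff] at this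
      exact nonZeroDivisors.coe_ne_zero a this
    simp [this]
  · have h2 := hC ⟨n, rfl⟩
    simp only [Function.comp] at h2
    rw [div_le_iff₀ (by exact_mod_cast hn)] at h2
    refine le_trans ?_ h2
    norm_cast
    rw [← Nat.card_eq_finsetCard]
    exact Nat.card_mono (s := (s : Set (ID K))) hfin (fun a ha => hs a ha)

lemma conv_K (x : ℝ) (hx : 1 < x) : Summable fun a : ID K => (nmK K a : ℝ) ^ (-x) := by
  obtain ⟨C, hC0, hC⟩ := card_le_linear (K := K)
  have hpos : ∀ a : ID K, 1 ≤ nmK K a := fun a => Nat.one_le_iff_ne_zero.2 (by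
    rw [nmK_apply, Ne, Ideal.absNorm_eq_zero_iff]; exact nonZeroDivisors.coe_ne_zero a)
  have hf : ∀ n : ℕ, {a : ID K | nmK K a ≤ n}.Finite := fun n => Ideal.finite_setOfPred_absNorm_le₀ n
  have h1 : LSeriesSummable (fun n => (coef (nmK K) (fun _ => 1) n : ℂ)) x := by
    refine LSeriesSummable_of_sum_norm_bigO_and_nonneg (r := 1) ?_ (fun n => tsum_nonneg fun i => zero_le_one)
      zero_le_one (by simpa)
    refine Asymptotics.isBigO_of_le' (c := C) _ fun n => ?_
    rw [sum_coef hf hpos]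
    simp only [Finset.sum_const, nsmul_eq_mul, mul_one, Real.rpow_one, Real.norm_natCast]
    exact hC n _ (fun a ha => (hf n).mem_toFinset.1 ha)
  have hfib : ∀ n, Finite {a : ID K // nmK K a = n} := fun n => (hf n).subset (fun a (ha : _ = n) => ha.le)
  rw [← (Equiv.sigmaFiberEquiv (nmK K)).summable_iff, summable_sigma_of_nonneg
    (fun y => by simp only [Function.comp]; positivity)]
  refine ⟨fun n => Summable.of_finite, ?_⟩
  refine h1.norm.congr fun n => ?_
  rcases eq_or_ne n 0 with rfl | hn
  · have : IsEmpty { a // nmK K a = 0 } := ⟨fun a => by have := hpos a.1; have := a.2; omega⟩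
    simp
  · rw [LSeries.norm_term_eq, if_neg hn, coef, Complex.norm_real, Real.norm_of_nonneg
      (tsum_nonneg fun i => zero_le_one), div_eq_mul_inv, ← tsum_mul_right]
    refine tsum_congr fun i => ?_
    simp only [Function.comp, Equiv.sigmaFiberEquiv, Equiv.coe_fn_mk]
    rw [show nmK K (i : { a // nmK K a = n }) = n from i.2, Real.rpow_neg (by positivity)]; simp

lemma prime_norm (v : HeightOneSpectrum (𝓞 K)) :
    ∃ p f : ℕ, p.Prime ∧ 1 ≤ f ∧ Ideal.absNorm v.asIdeal = p ^ f ∧ (p : 𝓞 K) ∈ v.asIdeal := by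
  have : v.asIdeal.IsMaximal := v.isMaximal
  letI := Ideal.Quotient.field v.asIdeal
  have hfin : Finite (𝓞 K ⧸ v.asIdeal) := Ideal.finiteQuotientOfFreeOfNeBot _ v.ne_bot
  letI := Fintype.ofFinite (𝓞 K ⧸ v.asIdeal)
  have h1 := Fintype.isPrimePow_card_of_field (α := 𝓞 K ⧸ v.asIdeal)
  rw [isPrimePow_nat_iff] at h1
  obtain ⟨p, f, hp, hf, he⟩ := h1
  have hN : Ideal.absNorm v.asIdeal = p ^ f := by
    rw [he, Ideal.absNorm_apply, Submodule.cardQuot_apply, Nat.card_eq_fintype_card]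
  refine ⟨p, f, hp, hf, hN, ?_⟩
  have h2 := Ideal.absNorm_mem v.asIdeal
  rw [hN, Nat.cast_pow] at h2
  exact v.isPrime.mem_of_pow_mem _ h2

/-- residue characteristic -/
noncomputable def rch (v : HeightOneSpectrum (𝓞 K)) : ℕ := (prime_norm v).choose

lemma rch_prime (v : HeightOneSpectrum (𝓞 K)) : (rch v).Prime := (prime_norm v).choose_spec.choose_spec.1
lemma rch_mem (v : HeightOneSpectrum (𝓞 K)) : (rch v : 𝓞 K) ∈ v.asIdeal :=
  (prime_norm v).choose_spec.choose_spec.2.2.2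
lemma rch_norm (v : HeightOneSpectrum (𝓞 K)) : ∃ f, 1 ≤ f ∧ nmK K (pidK K v) = rch v ^ f :=
  ⟨_, (prime_norm v).choose_spec.choose_spec.2.1, (prime_norm v).choose_spec.choose_spec.2.2.1⟩
lemma rch_le (v : HeightOneSpectrum (𝓞 K)) : rch v ≤ nmK K (pidK K v) := by
  obtain ⟨f, hf, h⟩ := rch_norm v
  rw [h]; exact Nat.le_self_pow (by omega) _

lemma sum_over_p {p : ℕ} (hp : p.Prime) (s : Finset (HeightOneSpectrum (𝓞 K))) (hs : ∀ v ∈ s, rch v = p) :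
    ∑ v ∈ s, Real.log (nmK K (pidK K v)) ≤ Module.finrank ℚ K * Real.log p := by
  classical
  have hne : Ideal.span {(p : 𝓞 K)} ≠ 0 := by
    rw [Ne, Ideal.zero_eq_bot, Ideal.span_singleton_eq_bot]; exact_mod_cast hp.ne_zero
  have h := ideal_logid (Ideal.span {(p : 𝓞 K)}) hne
  have hN : Real.log (Ideal.absNorm (Ideal.span {(p : 𝓞 K)})) = Module.finrank ℚ K * Real.log p := by
    rw [Ideal.absNorm_span_singleton, show (p : 𝓞 K) = algebraMap ℤ (𝓞 K) p by simp, Algebra.norm_algebraMap,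
      RingOfIntegers.rank, Int.natAbs_pow, Nat.cast_pow, Real.log_pow]; simp
  rw [hN] at h
  refine le_trans ?_ (sum_le_hasSum (s.map ⟨fun v => (v, 0), fun a b h => by simpa using h⟩) (fun q _ => ?_) h)
  · rw [Finset.sum_map]
    refine Finset.sum_le_sum fun v hv => ?_
    change _ ≤ (if v.asIdeal ^ (0 + 1) ∣ _ then Real.log (Ideal.absNorm v.asIdeal) else 0)
    rw [zero_add, pow_one, if_pos]
    · rfl
    · rw [Ideal.dvd_span_singleton, ← hs v hv]; exact rch_mem v
  · split_ifs
    exacts [Real.log_natCast_nonneg _, le_rfl]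

lemma cheb_K (n : ℕ) (s : Finset (HeightOneSpectrum (𝓞 K) × ℕ))
    (hs : ∀ q ∈ s, nmK K (pidK K q.1 ^ (q.2 + 1)) ≤ n) :
    ∑ q ∈ s, Real.log (nmK K (pidK K q.1)) ≤ Module.finrank ℚ K * (Real.log 4 + 4) * n := by
  classical
  set t : Finset (ℕ × ℕ) := (Nat.primesLE n).sigma (fun p => Finset.range (p.log n)) |>.map
    ⟨fun x => (x.1, x.2), fun a b h => by cases a; cases b; simpa using h⟩ with ht
  have hmaps : ∀ q ∈ s, (rch q.1, q.2) ∈ t := by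
    intro q hq
    have h1 := hs q hq
    rw [map_pow] at h1
    have h2 : rch q.1 ^ (q.2 + 1) ≤ n := (Nat.pow_le_pow_left (rch_le q.1) _).trans h1
    have hn : n ≠ 0 := by have := (rch_prime q.1).pos; intro h; simp [h] at h2; omega
    simp only [ht, Finset.mem_map, Finset.mem_sigma, Finset.mem_range, Function.Embedding.coeFn_mk]
    refine ⟨⟨rch q.1, q.2⟩, ⟨?_, ?_⟩, rfl⟩
    · rw [Nat.mem_primesLE]
      exact ⟨(Nat.le_self_pow (by omega) _).trans h2, rch_prime q.1⟩
    · exact Nat.lt_of_succ_le (Nat.le_log_of_pow_le (rch_prime q.1).one_lt h2)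
  rw [← Finset.sum_fiberwise_of_maps_to hmaps]
  calc _ ≤ ∑ j ∈ t, Module.finrank ℚ K * Real.log j.1 := by
        refine Finset.sum_le_sum fun j hj => ?_
        have hp : j.1.Prime := by
          simp only [ht, Finset.mem_map, Finset.mem_sigma, Nat.mem_primesLE, Function.Embedding.coeFn_mk] at hj
          obtain ⟨a, ⟨⟨_, h⟩, _⟩, rfl⟩ := hj; exact h
        refine le_trans (le_of_eq ?_) (sum_over_p hp ((s.filter fun q => (rch q.1, q.2) = j).image Prod.fst) ?_)
        · rw [Finset.sum_image]
          intro a ha b hb hab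
          simp at ha hb
          refine Prod.ext hab ?_
          rw [← ha.2] at hb; simp at hb; exact hb.2.2.symm
        · intro v hv
          simp at hv
          obtain ⟨k, _, rfl⟩ := hv; rfl
    _ = Module.finrank ℚ K * Chebyshev.psi n := by
        rw [Chebyshev.psi_eq_sum_mul_log_prime, ht, Finset.sum_map, Finset.sum_sigma, Finset.mul_sum]
        refine Finset.sum_congr rfl fun p _ => ?_
        change ∑ k ∈ Finset.range (p.log n), Module.finrank ℚ K * Real.log p = _
        rw [Finset.sum_const, Finset.card_range, nsmul_eq_mul]; ring
    _ ≤ _ := by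
        rw [mul_assoc]; gcongr; exact Chebyshev.psi_le_const_mul_self (Nat.cast_nonneg n)

lemma arithK : Arith (nmK K) (pidK K) where
  pos a := Nat.one_le_iff_ne_zero.2 (by
    rw [nmK_apply, Ne, Ideal.absNorm_eq_zero_iff]; exact nonZeroDivisors.coe_ne_zero a)
  one a h := Subtype.ext (by rw [nmK_apply, Ideal.absNorm_eq_one_iff] at h; rw [h]; exact Ideal.one_eq_top.symm)
  fin n := Ideal.finite_setOfPred_absNorm_le₀ n
  conv := conv_K
  two v := (rch_prime v).two_le.trans (rch_le v)
  logid a := by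
    refine (ideal_logid (a : Ideal (𝓞 K)) (nonZeroDivisors.coe_ne_zero a)).congr_fun fun q => ?_
    classical
    simp only [ID_dvd]; rfl
  cheb := ⟨_, cheb_K⟩
end

end

section
open Filter Topology MeasureTheory Set
open NumberField NumberField.InfinitePlace
open scoped NNReal ENNReal
section C1
variable (K : Type*) [Field K] [NumberField K]

lemma mem_LT (f : InfinitePlace K → ℝ≥0) (x : mixedEmbedding.mixedSpace K) :
    x ∈ mixedEmbedding.convexBodyLT K f ↔ ∀ w, mixedEmbedding.normAtPlace w x < f w := by
  constructor
  · intro h w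
    rcases w.isReal_or_isComplex with hw | hw
    · rw [mixedEmbedding.normAtPlace_apply_of_isReal hw]
      simpa using h.1 ⟨w, hw⟩ trivial
    · rw [mixedEmbedding.normAtPlace_apply_of_isComplex hw]
      simpa using h.2 ⟨w, hw⟩ trivial
  · intro h
    refine ⟨fun w _ => ?_, fun w _ => ?_⟩
    · have := h w.1
      rw [mixedEmbedding.normAtPlace_apply_of_isReal w.2] at this
      simpa using this
    · have := h w.1
      rw [mixedEmbedding.normAtPlace_apply_of_isComplex w.2] at this
      simpa using this

lemma prod_smul_mult (a : ℝ≥0) (f : InfinitePlace K → ℝ≥0) :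
    ∏ w, (a * f w) ^ w.mult = a ^ (Module.finrank ℚ K) * ∏ w, f w ^ w.mult := by
  simp_rw [mul_pow, Finset.prod_mul_distrib, Finset.prod_pow_eq_pow_sum, sum_mult_eq]

lemma pow_bd (n : ℕ) {ε : ℝ} (h0 : 0 ≤ ε) (h1 : ε ≤ 1) :
    (1 + ε) ^ n ≤ 1 + 2 ^ n * ε ∧ 1 - 2 ^ n * ε ≤ (1 - ε) ^ n := by
  suffices h : (1 + ε) ^ n ≤ 1 + (2 ^ n - 1) * ε ∧ 1 - (2 ^ n - 1) * ε ≤ (1 - ε) ^ n from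
    ⟨by linarith [h.1], by linarith [h.2]⟩
  induction n with
  | zero => simp
  | succ k ih =>
    have h2 : (1:ℝ) ≤ 2 ^ k := one_le_pow₀ (by norm_num)
    have h3 : 0 ≤ ((2:ℝ) ^ k - 1) * ε := mul_nonneg (by linarith) h0
    have h4 : ((2:ℝ) ^ k - 1) * ε * ε ≤ (2 ^ k - 1) * ε := mul_le_of_le_one_right h3 h1
    have h5 := mul_nonneg h3 h0
    rw [pow_succ, pow_succ, pow_succ]
    constructor
    · linarith [mul_le_mul_of_nonneg_right ih.1 (by linarith : 0 ≤ 1 + ε)]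
    · linarith [mul_le_mul_of_nonneg_right ih.2 (by linarith : 0 ≤ 1 - ε)]

open scoped Classical Pointwise in
lemma boxcount (J : (FractionalIdeal (nonZeroDivisors (𝓞 K)) K)ˣ) : ∃ κ : ℝ, 0 < κ ∧ ∃ d : ℝ, 0 < d ∧
    ∀ (ε : ℝ≥0) (f : InfinitePlace K → ℝ≥0), ε ≤ 1 → (∀ w, d ≤ ε * f w) →
      ∃ S : Finset K, (∀ α, α ∈ S ↔ α ∈ (J : FractionalIdeal (nonZeroDivisors (𝓞 K)) K) ∧
        ∀ w : InfinitePlace K, w α < f w) ∧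
      |(S.card : ℝ) - κ * ∏ w, (f w : ℝ) ^ w.mult| ≤
        κ * 2 ^ (Module.finrank ℚ K) * ε * ∏ w, (f w : ℝ) ^ w.mult := by
  set b := mixedEmbedding.fractionalIdealLatticeBasis K J with hb
  set D := ZSpan.fundamentalDomain b
  obtain ⟨d, hd0, hd⟩ := (ZSpan.fundamentalDomain_isBounded b).exists_pos_norm_le
  have hfd := ZSpan.isAddFundamentalDomain' b (volume : Measure (mixedEmbedding.mixedSpace K))
  have hD0 : volume D ≠ 0 := ZSpan.measure_fundamentalDomain_ne_zero b
  have hDt : volume D ≠ ∞ := (ZSpan.fundamentalDomain_isBounded b).measure_lt_top.ne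
  have hDp : 0 < (volume D).toReal := ENNReal.toReal_pos hD0 hDt
  have hfac : (0:ℝ) < mixedEmbedding.convexBodyLTFactor K :=
    lt_of_lt_of_le one_pos (by exact_mod_cast mixedEmbedding.one_le_convexBodyLTFactor K)
  refine ⟨mixedEmbedding.convexBodyLTFactor K / (volume D).toReal, by positivity, d, hd0, ?_⟩
  intro ε f hε hf
  have hle : ∀ w (x : mixedEmbedding.mixedSpace K), mixedEmbedding.normAtPlace w x ≤ ‖x‖ := by
    intro w x
    rw [mixedEmbedding.norm_eq_sup'_normAtPlace]
    exact Finset.le_sup' (fun w => mixedEmbedding.normAtPlace w x) (Finset.mem_univ w)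
  have hbdd : Bornology.IsBounded (mixedEmbedding.convexBodyLT K f) :=
    (Bornology.IsBounded.pi fun _ => Metric.isBounded_ball).prod
      (Bornology.IsBounded.pi fun _ => Metric.isBounded_ball)
  have hfin := ZSpan.setFinite_inter b hbdd
  set G := (Submodule.span ℤ (Set.range b)).toAddSubgroup with hG
  haveI : Countable G := inferInstanceAs (Countable (Submodule.span ℤ (Set.range b)))
  have hSfin : {g : G | (g : mixedEmbedding.mixedSpace K) ∈ mixedEmbedding.convexBodyLT K f}.Finite := by
    refine Set.Finite.of_finite_image (f := Subtype.val) (hfin.subset ?_) Subtype.val_injective.injOn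
    rintro _ ⟨g, hg, rfl⟩
    exact ⟨hg, g.2⟩
  set S := hSfin.toFinset with hS
  have hmemS : ∀ g : G, g ∈ S ↔ ∀ w, mixedEmbedding.normAtPlace w (g:mixedEmbedding.mixedSpace K) < f w := by
    intro g
    rw [hS, Set.Finite.mem_toFinset, Set.mem_ofPred_eq, mem_LT]
  have hup : (S.card : ℝ≥0∞) * volume D ≤
      volume (mixedEmbedding.convexBodyLT K (fun w => (1 + ε) * f w)) := by
    rw [hfd.measure_eq_tsum (mixedEmbedding.convexBodyLT K (fun w => (1 + ε) * f w))]
    refine le_trans ?_ (ENNReal.sum_le_tsum S)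
    rw [← nsmul_eq_mul, ← Finset.sum_const]
    refine Finset.sum_le_sum fun g hg => measure_mono fun y hy => ⟨?_, hy⟩
    refine ⟨y - g, ?_, by change (g : mixedEmbedding.mixedSpace K) + (y - g) = y; abel⟩
    rw [mem_LT]
    intro w
    have h1 := mixedEmbedding.normAtPlace_add_le w y (-(g : mixedEmbedding.mixedSpace K))
    rw [mixedEmbedding.normAtPlace_neg, ← sub_eq_add_neg] at h1
    have h2 := (hmemS g).1 hg w
    have h3 := hle w y
    have h4 := hd y hy
    have h5 := hf w
    push_cast
    linarith
  have hlo : volume (mixedEmbedding.convexBodyLT K (fun w => (1 - ε) * f w)) ≤ 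
      (S.card : ℝ≥0∞) * volume D := by
    rw [hfd.measure_eq_tsum (mixedEmbedding.convexBodyLT K (fun w => (1 - ε) * f w)), ← nsmul_eq_mul, ← Finset.sum_const]
    rw [tsum_eq_sum (s := S)]
    · exact Finset.sum_le_sum fun g hg => measure_mono inter_subset_right
    · intro g hg
      have : (g +ᵥ mixedEmbedding.convexBodyLT K (fun w => (1 - ε) * f w)) ∩ D = ∅ := by
        by_contra hne
        obtain ⟨y, ⟨x, hx, rfl⟩, hy⟩ := Set.nonempty_iff_ne_empty.2 hne
        apply hg
        rw [hmemS]
        intro w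
        have hx' := (mem_LT K _ x).1 hx w
        have h4 := hd _ hy
        have h1 := mixedEmbedding.normAtPlace_add_le w ((g : mixedEmbedding.mixedSpace K) + x) (-x)
        rw [mixedEmbedding.normAtPlace_neg, add_neg_cancel_right] at h1
        have h3 := hle w ((g : mixedEmbedding.mixedSpace K) + x)
        have h5 := hf w
        change ‖(g : mixedEmbedding.mixedSpace K) + x‖ ≤ d at h4
        have h6 : (1 - ε : ℝ≥0) = ((1:ℝ) - ε) := NNReal.coe_sub hε
        push_cast at hx'
        rw [h6] at hx'
        linarith
      rw [this, measure_empty]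
  rw [mixedEmbedding.convexBodyLT_volume] at hup hlo
  have hup' := ENNReal.toReal_mono (by finiteness) hup
  have hlo' := ENNReal.toReal_mono (by finiteness) hlo
  have e : ∀ a : ℝ≥0, ((mixedEmbedding.convexBodyLTFactor K : ℝ≥0∞) *
      ((∏ w, (a * f w) ^ w.mult : ℝ≥0) : ℝ≥0∞)).toReal = mixedEmbedding.convexBodyLTFactor K * ((a : ℝ) ^ (Module.finrank ℚ K) *
        ∏ w, (f w : ℝ) ^ w.mult) := by
    intro a
    rw [prod_smul_mult]
    simp
  rw [e, ENNReal.toReal_mul, ENNReal.toReal_natCast] at hup' hlo'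
  generalize (mixedEmbedding.convexBodyLTFactor K : ℝ) = fc at *
  have hem : ∀ g : G, ∃ α ∈ (J : FractionalIdeal (nonZeroDivisors (𝓞 K)) K), mixedEmbedding K α = g := by
    intro g
    obtain ⟨α, h1, h2⟩ := (mixedEmbedding.mem_span_fractionalIdealLatticeBasis K J).1 g.2
    exact ⟨α, h1, h2⟩
  choose φ hφ1 hφ2 using hem
  have hinj : Function.Injective φ := by
    intro a c h
    apply Subtype.ext
    rw [← hφ2, ← hφ2, h]
  refine ⟨S.map ⟨φ, hinj⟩, fun α => ?_, ?_⟩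
  · simp only [Finset.mem_map, Function.Embedding.coeFn_mk]
    constructor
    · rintro ⟨g, hg, rfl⟩
      refine ⟨hφ1 g, fun w => ?_⟩
      rw [← mixedEmbedding.normAtPlace_apply, hφ2]
      exact (hmemS g).1 hg w
    · rintro ⟨h1, h2⟩
      let g : G := ⟨mixedEmbedding K α, (mixedEmbedding.mem_span_fractionalIdealLatticeBasis K J).2 ⟨α, h1, rfl⟩⟩
      refine ⟨g, ?_, mixedEmbedding_injective K (hφ2 g)⟩
      rw [hmemS]
      intro w
      simpa [g] using h2 w
  · rw [Finset.card_map]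
    set P := ∏ w, (f w : ℝ) ^ w.mult with hP
    have hP0 : 0 ≤ P := by positivity
    obtain ⟨p1, p2⟩ := pow_bd (Module.finrank ℚ K) (NNReal.coe_nonneg ε) (by exact_mod_cast hε)
    rw [NNReal.coe_sub hε] at hlo'
    push_cast at hup' hlo'
    have q1 := mul_le_mul_of_nonneg_right p1 hP0
    have q2 := mul_le_mul_of_nonneg_right p2 hP0
    have q3 := mul_le_mul_of_nonneg_left q1 hfac.le
    have q4 := mul_le_mul_of_nonneg_left q2 hfac.le
    rw [abs_le]
    constructor
    · rw [← mul_le_mul_iff_left₀ hDp]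
      field_simp
      linarith
    · rw [← mul_le_mul_iff_left₀ hDp]
      field_simp
      linarith
end C1

end

section
open Filter Topology MeasureTheory Set
section C2
variable {V : Type*} [Fintype V]

lemma one_dim {z : ℂ} (hz : 0 < z.re) (a : ℝ) :
    Integrable (fun c : ℝ => if a < c then Complex.exp (-z * c) else 0) ∧
    ∫ c : ℝ, (if a < c then Complex.exp (-z * c) else 0) = Complex.exp (-z * a) / z := by
  have h1 : (-z).re < 0 := by simpa using hz
  have h2 : (fun c : ℝ => if a < c then Complex.exp (-z * c) else 0) =
      (Ioi a).indicator fun c : ℝ => Complex.exp (-z * c) := by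
    ext c; simp [indicator_apply]
  rw [h2, integrable_indicator_iff measurableSet_Ioi, integral_indicator measurableSet_Ioi,
    integral_exp_mul_complex_Ioi h1]
  exact ⟨integrableOn_exp_mul_complex_Ioi h1 a, by rw [neg_div_neg_eq]⟩

lemma orth_int (lam l : V → ℝ) {s : ℂ} (hs : 0 < s.re) :
    Integrable (fun x : V → ℝ => if ∀ w, l w < x w then
      Complex.exp (-∑ w, (s - Complex.I * lam w) * x w) else 0) ∧
    ∫ x : V → ℝ, (if ∀ w, l w < x w then
      Complex.exp (-∑ w, (s - Complex.I * lam w) * x w) else 0) =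
      Complex.exp (-∑ w, (s - Complex.I * lam w) * l w) / ∏ w, (s - Complex.I * lam w) := by
  classical
  have h0 : ∀ w, 0 < (s - Complex.I * lam w).re := fun w => by simpa using hs
  have h1 : (fun x : V → ℝ => if ∀ w, l w < x w then
      Complex.exp (-∑ w, (s - Complex.I * lam w) * x w) else 0) = fun x => ∏ w,
      (fun c : ℝ => if l w < c then Complex.exp (-(s - Complex.I * lam w) * c) else 0) (x w) := by
    ext x
    dsimp only
    split_ifs with h
    · rw [← Finset.sum_neg_distrib, Complex.exp_sum]
      exact Finset.prod_congr rfl fun w _ => by rw [if_pos (h w), neg_mul]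
    · push Not at h
      obtain ⟨w, hw⟩ := h
      exact (Finset.prod_eq_zero (Finset.mem_univ w) (if_neg hw.not_gt)).symm
  rw [h1]
  refine ⟨Integrable.fintype_prod fun w => (one_dim (h0 w) (l w)).1, ?_⟩
  rw [volume_pi, integral_fintype_prod_eq_prod (𝕜 := ℂ) (fun w (c : ℝ) =>
    if l w < c then Complex.exp (-(s - Complex.I * lam w) * c) else 0), ← Finset.sum_neg_distrib,
    Complex.exp_sum, ← Finset.prod_div_distrib]
  exact Finset.prod_congr rfl fun w _ => by rw [(one_dim (h0 w) (l w)).2, neg_mul]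

variable (B : Module.Basis V ℝ (V → ℝ)) (w0 : V)

def Fk (k : {i // i ≠ w0} → ℤ) : Set (V → ℝ) := {x | ∀ i, ⌊B.repr x i.1⌋ = k i}
noncomputable def vk [DecidableEq V] (k : {i // i ≠ w0} → ℤ) : V → ℝ := ∑ i, (k i : ℝ) • B i.1

lemma repr_cont (i : V) : Continuous fun x : V → ℝ => B.repr x i :=
  (LinearMap.continuous_of_finiteDimensional (B.coord i) : _)

lemma Fk_meas (k) : MeasurableSet (Fk B w0 k) := by
  have : Fk B w0 k = ⋂ i, (fun x => ⌊B.repr x i.1⌋) ⁻¹' {k i} := by ext; simp [Fk]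
  rw [this]
  exact MeasurableSet.iInter fun i => ((repr_cont B i).measurable.floor) (measurableSet_singleton _)

lemma repr_vk [DecidableEq V] (k) (i : {i // i ≠ w0}) : B.repr (vk B w0 k) i = k i := by
  simp only [vk, map_sum, map_smul, Module.Basis.repr_self, Finsupp.coe_finsetSum, Finset.sum_apply,
    Finsupp.smul_single, smul_eq_mul, mul_one]
  rw [Finset.sum_eq_single i]
  · simp
  · intro b _ hb
    rw [Finsupp.single_eq_of_ne]
    exact fun h => hb (Subtype.ext h.symm)
  · simp

lemma unfold_int [DecidableEq V] {g : (V → ℝ) → ℂ} (hg : Integrable g) :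
    HasSum (fun k => ∫ x in Fk B w0 0, g (x + vk B w0 k)) (∫ x, g x) := by
  have h := hasSum_integral_iUnion (μ := volume) (f := g) (s := Fk B w0) (fun k => Fk_meas B w0 k) ?_
    hg.integrableOn
  · have hu : (⋃ k, Fk B w0 k) = univ := eq_univ_of_forall fun x =>
      mem_iUnion.2 ⟨fun i => ⌊B.repr x i.1⌋, fun i => rfl⟩
    rw [hu, setIntegral_univ] at h
    refine (funext fun k => ?_ : (fun k => ∫ x in Fk B w0 0, g (x + vk B w0 k)) = fun k => ∫ x in Fk B w0 k, g x) ▸ h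
    rw [← integral_indicator (Fk_meas B w0 0), ← integral_indicator (Fk_meas B w0 k),
      ← integral_add_right_eq_self ((Fk B w0 k).indicator g) (vk B w0 k)]
    congr 1
    ext x
    have : x ∈ Fk B w0 0 ↔ x + vk B w0 k ∈ Fk B w0 k := by
      refine forall_congr' fun i => ?_
      rw [map_add, Finsupp.add_apply, repr_vk, Int.floor_add_intCast]
      simp
    by_cases hx : x ∈ Fk B w0 0
    · rw [indicator_of_mem hx, indicator_of_mem (this.1 hx)]
    · rw [indicator_of_notMem hx, indicator_of_notMem fun h => hx (this.2 h)]
  · intro a b hab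
    refine Set.disjoint_left.2 fun x hx hx' => hab ?_
    ext i
    rw [← hx i, hx' i]

lemma prod_int : ∃ D : ℝ, 0 < D ∧ ∀ g : V → ℝ → ℂ, (∀ i, Integrable (g i)) →
    Integrable (fun x => ∏ i, g i (B.repr x i)) ∧
      ∫ x, ∏ i, g i (B.repr x i) = D * ∏ i, ∫ c, g i c := by
  classical
  have hd : LinearMap.det (B.equivFun : (V → ℝ) →ₗ[ℝ] (V → ℝ)) ≠ 0 :=
    (LinearEquiv.isUnit_det' B.equivFun).ne_zero
  have hm := Measure.map_linearMap_addHaar_eq_smul_addHaar (volume : Measure (V → ℝ)) hd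
  have he : MeasurableEmbedding (B.equivFun : (V → ℝ) →ₗ[ℝ] (V → ℝ)) :=
    B.equivFunL.toHomeomorph.measurableEmbedding
  have hpos := abs_pos.2 (inv_ne_zero hd)
  refine ⟨_, hpos, fun g hg => ?_⟩
  have e : (fun x => ∏ i, g i (B.repr x i)) =
    (fun c : V → ℝ => ∏ i, g i (c i)) ∘ (B.equivFun : (V → ℝ) →ₗ[ℝ] (V → ℝ)) := rfl
  constructor
  · rw [e, ← he.integrable_map_iff, hm]
    exact (Integrable.fintype_prod hg).smul_measure ENNReal.ofReal_ne_top
  · have := he.integral_map (μ := volume) (fun c : V → ℝ => ∏ i, g i (c i))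
    rw [hm, integral_smul_measure, volume_pi, integral_fintype_prod_eq_prod,
      ENNReal.toReal_ofReal hpos.le, Complex.real_smul] at this
    rw [this, volume_pi]
    rfl

lemma main_int [DecidableEq V] {n : ℝ} (hn : 0 < n) (hB0 : ∑ w, B w0 w = n) (hBi : ∀ i ≠ w0, ∑ w, B i w = 0) :
    ∃ D : ℝ, 0 < D ∧ ∀ (lam : V → ℝ) (z : ℂ), 0 < z.re → ∑ w, lam w * B w0 w = 0 →
    IntegrableOn (fun x : V → ℝ => if 0 < ∑ w, x w then
      Complex.exp (-z * (∑ w, x w : ℝ) + Complex.I * (∑ w, lam w * x w : ℝ)) else 0) (Fk B w0 0) ∧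
    ∃ M : ℂ, (∫ x in Fk B w0 0, if 0 < ∑ w, x w then
      Complex.exp (-z * (∑ w, x w : ℝ) + Complex.I * (∑ w, lam w * x w : ℝ)) else 0) =
      D * M / z ∧ M = ∏ i : {i // i ≠ w0}, ∫ c in (0:ℝ)..1,
        Complex.exp (Complex.I * (∑ w, lam w * B i.1 w : ℝ) * c) := by
  obtain ⟨D, hD, H⟩ := prod_int B
  refine ⟨D / n, by positivity, fun lam z hz hl => ?_⟩
  let th : V → ℝ := fun i => ∑ w, lam w * B i w
  let g : V → ℝ → ℂ := fun i c => if i = w0 then (if 0 < c then Complex.exp (-(z * n) * c) else 0) else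
    (Ico (0:ℝ) 1).indicator (fun c : ℝ => Complex.exp (Complex.I * th i * c)) c
  have hx : ∀ x : V → ℝ, x = ∑ i, B.repr x i • B i := fun x => (B.sum_repr x).symm
  have hsum : ∀ x : V → ℝ, ∑ w, x w = n * B.repr x w0 := by
    intro x
    conv_lhs => rw [hx x]
    simp only [Finset.sum_apply, Pi.smul_apply, smul_eq_mul]
    rw [Finset.sum_comm]
    simp only [← Finset.mul_sum]
    rw [Finset.sum_eq_single w0 (fun i _ hi => by rw [hBi i hi, mul_zero]) (by simp), hB0, mul_comm]
  have hlam : ∀ x : V → ℝ, ∑ w, lam w * x w = ∑ i, B.repr x i * th i := by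
    intro x
    conv_lhs => rw [hx x]
    simp only [Finset.sum_apply, Pi.smul_apply, smul_eq_mul, Finset.mul_sum, th]
    rw [Finset.sum_comm]
    exact Finset.sum_congr rfl fun i _ => Finset.sum_congr rfl fun w _ => by ring
  have hg : ∀ i, Integrable (g i) := by
    intro i
    by_cases hi : i = w0
    · simp only [g, hi, if_true]
      exact (one_dim (z := z * n) (by simpa using mul_pos hz hn) 0).1
    · simp only [g, hi, if_false]
      rw [integrable_indicator_iff measurableSet_Ico]
      exact (Continuous.integrableOn_Icc (by fun_prop)).mono_set Ico_subset_Icc_self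
  have key : (Fk B w0 0).indicator (fun x : V → ℝ => if 0 < ∑ w, x w then
      Complex.exp (-z * (∑ w, x w : ℝ) + Complex.I * (∑ w, lam w * x w : ℝ)) else 0) =
      fun x => ∏ i, g i (B.repr x i) := by
    ext x
    have hc : 0 < ∑ w, x w ↔ 0 < B.repr x w0 := by
      rw [hsum]; exact mul_pos_iff_of_pos_left hn
    have hF : x ∈ Fk B w0 0 ↔ ∀ i ≠ w0, B.repr x i ∈ Ico (0:ℝ) 1 := by
      simp [Fk, Int.floor_eq_zero_iff]
    by_cases h : x ∈ Fk B w0 0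
    · rw [indicator_of_mem h]
      by_cases h' : 0 < ∑ w, x w
      · rw [if_pos h', ← Finset.mul_prod_erase _ _ (Finset.mem_univ w0)]
        have : ∀ i ∈ Finset.univ.erase w0, g i (B.repr x i) = Complex.exp (Complex.I * (B.repr x i * th i : ℝ)) := by
          intro i hi
          have hi := Finset.ne_of_mem_erase hi
          simp only [g, if_neg hi]
          rw [indicator_of_mem (hF.1 h i hi)]
          push_cast; ring_nf
        rw [Finset.prod_congr rfl this, ← Complex.exp_sum, ← Finset.mul_sum, ← Complex.ofReal_sum]
        simp only [g, if_true, if_pos (hc.1 h')]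
        rw [← Complex.exp_add, hlam, hsum, ← Finset.add_sum_erase _ (fun i => B.repr x i * th i) (Finset.mem_univ w0)]
        have : th w0 = 0 := hl
        rw [this, mul_zero, zero_add]
        push_cast; ring_nf
      · rw [if_neg h']
        refine (Finset.prod_eq_zero (Finset.mem_univ w0) ?_).symm
        simp only [g, if_true]
        rw [if_neg fun h => h' (hc.2 h)]
    · rw [indicator_of_notMem h]
      rw [hF] at h
      push Not at h
      obtain ⟨i, hi, h⟩ := h
      refine (Finset.prod_eq_zero (Finset.mem_univ i) ?_).symm
      simp only [g, if_neg hi]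
      rw [indicator_of_notMem h]
  obtain ⟨h1, h2⟩ := H g hg
  rw [← integrable_indicator_iff (Fk_meas B w0 0), ← integral_indicator (Fk_meas B w0 0), key]
  refine ⟨h1, _, ?_, rfl⟩
  rw [h2, ← Finset.mul_prod_erase _ _ (Finset.mem_univ w0)]
  have e1 : ∫ c, g w0 c = 1 / (z * n) := by
    simp only [g, if_true]
    rw [(one_dim (z := z * n) (by simpa using mul_pos hz hn) 0).2]
    simp
  have e2 : ∏ i ∈ Finset.univ.erase w0, ∫ c, g i c = ∏ i : {i // i ≠ w0}, ∫ c in (0:ℝ)..1,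
        Complex.exp (Complex.I * (∑ w, lam w * B i.1 w : ℝ) * c) := by
    rw [Finset.prod_subtype (p := fun i => i ≠ w0) _ (by simp)]
    refine Finset.prod_congr rfl fun i _ => ?_
    simp only [g, if_neg i.2]
    rw [integral_indicator measurableSet_Ico, intervalIntegral.integral_of_le zero_le_one,
      integral_Ico_eq_integral_Ioc]
  rw [e1, e2]
  have : (n : ℂ) ≠ 0 := by exact_mod_cast hn.ne'
  have : z ≠ 0 := by rintro rfl; simp at hz
  push_cast
  field_simp
end C2

end

section
open Filter Topology MeasureTheory Set
section C3
variable {V : Type*} [Fintype V] [DecidableEq V] (B : Module.Basis V ℝ (V → ℝ)) (w0 : V)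

lemma E_eq (lam : V → ℝ) (s : ℂ) (x : V → ℝ) : -∑ w, (s - Complex.I * lam w) * (x w : ℂ) =
    -s * (∑ w, x w : ℝ) + Complex.I * (∑ w, lam w * x w : ℝ) := by
  push_cast
  simp_rw [sub_mul, Finset.sum_sub_distrib, Finset.mul_sum]
  rw [neg_sub, sub_eq_add_neg, add_comm, ← Finset.sum_neg_distrib]
  congr 1
  · exact Finset.sum_congr rfl fun i _ => by ring
  · exact Finset.sum_congr rfl fun i _ => by ring

lemma norm_E (lam : V → ℝ) (s : ℂ) (x : V → ℝ) :
    ‖Complex.exp (-∑ w, (s - Complex.I * lam w) * (x w : ℂ))‖ = Real.exp (-s.re * ∑ w, x w) := by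
  rw [E_eq, Complex.norm_exp, Complex.add_re, Complex.re_mul_ofReal, Complex.neg_re]
  congr 1
  simp

lemma J_hol {n : ℝ} (hn : 0 < n) (hB0 : ∑ w, B w0 w = n) (hBi : ∀ i ≠ w0, ∑ w, B i w = 0) :
    ∃ D : ℝ, 0 < D ∧ ∀ (lam : V → ℝ) (_ : ∑ w, lam w * B w0 w = 0) (Cf : (V → ℝ) → ℝ) (_ : Measurable Cf)
      (κ C1 θ : ℝ) (_ : θ < 1) (_ : ∀ x ∈ Fk B w0 0, 0 < ∑ w, x w →
        |Cf x - κ * Real.exp (∑ w, x w)| ≤ C1 * Real.exp (θ * ∑ w, x w))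
      (_ : ∀ x, ∑ w, x w ≤ 0 → Cf x = 0),
      ∃ J : ℂ → ℂ, DifferentiableOn ℂ J {s | θ < s.re} ∧ ∀ s : ℂ, 1 < s.re →
        ∫ x in Fk B w0 0, (Cf x : ℂ) * Complex.exp (-∑ w, (s - Complex.I * lam w) * x w) =
          J s + κ * D * (∏ i : {i // i ≠ w0}, ∫ c in (0:ℝ)..1,
        Complex.exp (Complex.I * (∑ w, lam w * B i.1 w : ℝ) * c)) / (s - 1) := by
  obtain ⟨D, hD, H⟩ := main_int B w0 hn hB0 hBi
  refine ⟨D, hD, fun lam hlam Cf hCf κ C1 θ hθ hb h0 => ?_⟩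
  set h : (V → ℝ) → ℝ := fun x => Cf x - if 0 < ∑ w, x w then κ * Real.exp (∑ w, x w) else 0 with hh
  have hsm : Measurable fun x : V → ℝ => ∑ w, x w := by fun_prop
  have hm : Measurable h := hCf.sub (Measurable.ite (measurableSet_lt measurable_const hsm)
    (by fun_prop) measurable_const)
  have hbd : ∀ x ∈ Fk B w0 0, |h x| ≤ if 0 < ∑ w, x w then |C1| * Real.exp (θ * ∑ w, x w) else 0 := by
    intro x hx
    simp only [hh]
    split_ifs with h'
    · exact (hb x hx h').trans (mul_le_mul_of_nonneg_right (le_abs_self _) (Real.exp_pos _).le)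
    · rw [h0 x (not_lt.1 h')]; simp
  have hdom : ∀ a : ℝ, 0 < a → IntegrableOn (fun x : V → ℝ => if 0 < ∑ w, x w then Real.exp (-a * ∑ w, x w) else 0) (Fk B w0 0) := by
    intro a ha
    have := ((H 0 a (by simpa using ha) (by simp)).1).norm
    refine this.congr (Eventually.of_forall fun x => ?_)
    dsimp only
    split_ifs
    · rw [Complex.norm_exp]
      simp
    · simp
  set Es : ℂ → (V → ℝ) → ℂ := fun s x => Complex.exp (-∑ w, (s - Complex.I * lam w) * x w) with hEs
  have hEm : ∀ s, Measurable (Es s) := fun s => by simp only [hEs]; fun_prop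
  have hEd : ∀ x s, HasDerivAt (fun s => (h x : ℂ) * Es s x) ((h x : ℂ) * (Es s x * (-(∑ w, x w : ℝ)))) s := by
    intro x s
    refine HasDerivAt.const_mul _ ?_
    have : (fun s => Es s x) = fun s => Complex.exp (-s * (∑ w, x w : ℝ) + Complex.I * (∑ w, lam w * x w : ℝ)) := by
      ext s; simp only [hEs, E_eq]
    rw [this]
    simp only [hEs, E_eq]
    refine HasDerivAt.cexp ?_
    have := ((hasDerivAt_id s).neg.mul_const ((∑ w, x w : ℝ) : ℂ)).add_const (Complex.I * (∑ w, lam w * x w : ℝ))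
    simpa using this
  have hint : ∀ s : ℂ, θ < s.re → IntegrableOn (fun x => (h x : ℂ) * Es s x) (Fk B w0 0) := by
    intro s hs
    refine Integrable.mono' ((hdom (s.re - θ) (by linarith)).const_mul |C1|)
      ((Complex.measurable_ofReal.comp hm).mul (hEm s)).aestronglyMeasurable ?_
    refine (ae_restrict_iff' (Fk_meas B w0 0)).2 (Eventually.of_forall fun x hx => ?_)
    rw [norm_mul, Complex.norm_real, Real.norm_eq_abs]
    simp only [hEs]
    rw [norm_E]
    refine (mul_le_mul_of_nonneg_right (hbd x hx) (Real.exp_pos _).le).trans ?_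
    split_ifs
    · rw [mul_assoc, ← Real.exp_add]
      apply le_of_eq; ring_nf
    · simp
  refine ⟨fun s => ∫ x in Fk B w0 0, (h x : ℂ) * Es s x, ?_, ?_⟩
  · intro s0 hs0
    have hs0 : θ < s0.re := hs0
    set η := (s0.re - θ) / 3 with hη
    have hη0 : 0 < η := by rw [hη]; linarith
    refine DifferentiableAt.differentiableWithinAt ?_
    refine (hasDerivAt_integral_of_dominated_loc_of_deriv_le (μ := volume.restrict (Fk B w0 0))
      (F := fun s x => (h x : ℂ) * Es s x) (x₀ := s0) (s := Metric.ball s0 η)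
      (bound := fun x => (|C1| / η) * if 0 < ∑ w, x w then Real.exp (-η * ∑ w, x w) else 0)
      (Metric.ball_mem_nhds _ hη0) (Eventually.of_forall fun s => 
        ((Complex.measurable_ofReal.comp hm).mul (hEm s)).aestronglyMeasurable) (hint s0 hs0)
      (F' := fun s x => (h x : ℂ) * (Es s x * (-(∑ w, x w : ℝ)))) ?_ ?_ ((hdom η hη0).const_mul _)
      (Eventually.of_forall fun x s _ => hEd x s)).2.differentiableAt
    · exact ((Complex.measurable_ofReal.comp hm).mul ((hEm s0).mul (by fun_prop))).aestronglyMeasurable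
    · refine (ae_restrict_iff' (Fk_meas B w0 0)).2 (Eventually.of_forall fun x hx s hs => ?_)
      have hs1 : s0.re - η < s.re := by
        have := (Complex.abs_re_le_norm (s - s0)).trans_lt (mem_ball_iff_norm.1 hs)
        rw [Complex.sub_re, abs_lt] at this
        linarith
      rw [norm_mul, norm_mul, norm_neg, Complex.norm_real, Complex.norm_real, Real.norm_eq_abs, Real.norm_eq_abs]
      simp only [hEs]
      rw [norm_E]
      refine (mul_le_mul_of_nonneg_right (hbd x hx) (by positivity)).trans ?_
      split_ifs with hp
      · set t := ∑ w, x w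
        rw [abs_of_pos hp]
        have h1 : t ≤ Real.exp (η * t) / η := by
          rw [le_div_iff₀ hη0]
          linarith [Real.add_one_le_exp (η * t)]
        calc |C1| * Real.exp (θ * t) * (Real.exp (-s.re * t) * t) 
            ≤ |C1| * Real.exp (θ * t) * (Real.exp (-(θ + 2 * η) * t) * (Real.exp (η * t) / η)) := by
              gcongr
              nlinarith
          _ = _ := by
              rw [show |C1| * Real.exp (θ * t) * (Real.exp (-(θ + 2 * η) * t) * (Real.exp (η * t) / η)) =
                |C1| / η * (Real.exp (θ * t) * Real.exp (-(θ + 2 * η) * t) * Real.exp (η * t)) by ring,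
                ← Real.exp_add, ← Real.exp_add]
              ring_nf
      · simp
  · intro s hs
    obtain ⟨g1, M, g2, rfl⟩ := H lam (s - 1) (by simpa using hs) hlam
    rw [mul_assoc, mul_div_assoc, ← g2, ← integral_const_mul, ← integral_add (hint s (by linarith)) (g1.const_mul _)]
    congr 1
    ext x
    simp only [hh, hEs, E_eq]
    split_ifs
    · push_cast
      rw [sub_mul, show -(s - 1) * (∑ w, (x w : ℂ)) + Complex.I * ∑ w, (lam w : ℂ) * x w = 
        (∑ w, (x w : ℂ)) + (-s * (∑ w, (x w : ℂ)) + Complex.I * ∑ w, (lam w : ℂ) * x w) by ring]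
      rw [Complex.exp_add (∑ w, (x w : ℂ))]
      ring
    · simp
end C3

end

section
open Filter Topology MeasureTheory Set
open NumberField NumberField.InfinitePlace NumberField.Units NumberField.mixedEmbedding.fundamentalCone
open NumberField.Units.dirichletUnitTheorem (w₀)
section C4
variable (K : Type*) [Field K] [NumberField K]

lemma logMap_apply (β : K) (w : InfinitePlace K) : logMap K β w = w.mult * Real.log (w β) := by
  rw [logMap, Real.log_pow]

lemma logMap_mul {a b : K} (ha : a ≠ 0) (hb : b ≠ 0) : logMap K (a * b) = logMap K a + logMap K b := by
  ext w
  rw [Pi.add_apply, logMap_apply, logMap_apply, logMap_apply, map_mul, Real.log_mul (by simpa) (by simpa)]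
  ring

lemma logMap_one : logMap K (1 : K) = 0 := by ext w; simp [logMap_apply]

lemma sum_logMap {a : K} (ha : a ≠ 0) : ∑ w, logMap K a w = Real.log |(Algebra.norm ℚ a : ℝ)| := by
  have := sum_expMap_symm_apply ha
  simp_rw [logMap_apply]
  simpa using this

lemma sum_logMap_int {a : 𝓞 K} (ha : a ≠ 0) : ∑ w, logMap K (a : K) w =
    Real.log (Ideal.absNorm (Ideal.span {a}) : ℝ) := by
  rw [sum_logMap K (by simpa using ha), Ideal.absNorm_span_singleton, ← Algebra.coe_norm_int]
  simp [Nat.cast_natAbs]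

lemma logMap_lt {a : K} (ha : a ≠ 0) (w : InfinitePlace K) (t : ℝ) :
    logMap K a w < t ↔ w a < Real.exp (t / w.mult) := by
  have h1 : (0:ℝ) < w.mult := by exact_mod_cast w.mult_pos
  have h2 : 0 < w a := by rw [InfinitePlace.pos_iff]; exact ha
  rw [logMap_apply, ← Real.log_lt_iff_lt_exp h2, lt_div_iff₀ h1, mul_comm]

lemma sumB0 : ∑ w, completeBasis K w₀ w = Module.finrank ℚ K := by
  rw [completeBasis_apply_of_eq]
  rw [← Nat.cast_sum, sum_mult_eq]

lemma B_unit (i : {w : InfinitePlace K // w ≠ w₀}) :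
    completeBasis K i = logMap K ((fundSystem K (equivFinRank.symm i) : 𝓞 K) : K) := by
  rw [completeBasis_apply_of_ne]
  ext w
  simp [logMap_apply]

lemma sum_logMap_unit (u : (𝓞 K)ˣ) : ∑ w, logMap K ((u : 𝓞 K) : K) w = 0 := by
  rw [sum_logMap_int K u.ne_zero, Ideal.span_singleton_eq_top.2 u.isUnit]; simp

lemma sumBi (i) (hi : i ≠ w₀) : ∑ w, completeBasis K i w = 0 := by
  rw [B_unit K ⟨i, hi⟩, sum_logMap_unit]

/-- log of units as hom -/
noncomputable def ulog : Additive (𝓞 K)ˣ →+ (InfinitePlace K → ℝ) where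
  toFun u := logMap K ((u.toMul : 𝓞 K) : K)
  map_zero' := by simpa using logMap_one K
  map_add' a b := by
    rw [← logMap_mul K (by simp) (by simp)]; simp

open scoped Classical in
lemma unit_equiv : ∃ e : torsion K × ({w : InfinitePlace K // w ≠ w₀} → ℤ) ≃ (𝓞 K)ˣ,
    ∀ p, logMap K ((e p : 𝓞 K) : K) = vk (completeBasis K) w₀ p.2 := by
  let f : torsion K × (Fin (rank K) → ℤ) → (𝓞 K)ˣ := fun ζe => ζe.1 * ∏ i, (fundSystem K i) ^ (ζe.2 i)
  have hf : f.Bijective := by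
    rw [Function.bijective_iff_existsUnique]
    intro x
    obtain ⟨p, h1, h2⟩ := exist_unique_eq_mul_prod K x
    exact ⟨p, h1.symm, fun y hy => h2 y hy.symm⟩
  refine ⟨(Equiv.prodCongr (Equiv.refl _) (Equiv.arrowCongr equivFinRank.symm (Equiv.refl ℤ))).trans
    (Equiv.ofBijective f hf), fun p => ?_⟩
  change ulog K (Additive.ofMul (p.1.1 * ∏ i, (fundSystem K i) ^ (p.2 (equivFinRank i)))) = _
  have ht : ulog K (Additive.ofMul p.1.1) = 0 := by
    ext w
    have := (mem_torsion K).1 p.1.2 w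
    change logMap K ((p.1.1 : 𝓞 K) : K) w = 0
    rw [logMap_apply, this]; simp
  rw [ofMul_mul, map_add, ht, zero_add, ofMul_prod, map_sum, vk, ← equivFinRank.sum_comp]
  refine Finset.sum_congr rfl fun i _ => ?_
  rw [ofMul_zpow, map_zsmul, B_unit, Equiv.symm_apply_apply, ← Int.cast_smul_eq_zsmul ℝ]
  rfl

variable {K}
/-- integrand -/
noncomputable def gE (lam : InfinitePlace K → ℝ) (s : ℂ) (l x : InfinitePlace K → ℝ) : ℂ := open Classical in
  if ∀ w, l w < x w then Complex.exp (-∑ w, (s - Complex.I * lam w) * x w) else 0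

open scoped Classical in
lemma unit_sum (lam : InfinitePlace K → ℝ)
    (hlu : ∀ u : (𝓞 K)ˣ, ∃ k : ℤ, ∑ w, lam w * logMap K ((u : 𝓞 K) : K) w = 2 * Real.pi * k)
    {s : ℂ} (hs : 0 < s.re) {α : K} (hα : α ≠ 0) :
    HasSum (fun u : (𝓞 K)ˣ => ∫ x in Fk (completeBasis K) w₀ 0, gE lam s (logMap K (((u : 𝓞 K) : K) * α)) x)
      (Nat.card (torsion K) * (Complex.exp (-∑ w, (s - Complex.I * lam w) * logMap K α w) / ∏ w, (s - Complex.I * lam w))) := by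
  obtain ⟨e, he⟩ := unit_equiv K
  obtain ⟨h1, h2⟩ := orth_int lam (logMap K α) hs
  have h3 := (Equiv.neg _).hasSum_iff.2 (unfold_int (completeBasis K) w₀ h1)
  rw [h2] at h3
  rw [← e.hasSum_iff]
  haveI := Fintype.ofFinite (torsion K)
  have h4 := (hasSum_fintype (fun _ : torsion K => (1:ℂ))).mul h3 (by
    have := summable_mul_of_summable_norm (f := fun _ : torsion K => (1:ℂ)) (by exact (hasSum_fintype _).summable)
      h3.summable.norm
    exact this)
  simp only [Finset.sum_const, Finset.card_univ, nsmul_eq_mul, mul_one, ← Nat.card_eq_fintype_card] at h4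
  refine h4.congr_fun ?_
  rintro ⟨ζ, k⟩
  simp only [Function.comp_apply, one_mul, Equiv.neg_apply]
  congr 1
  ext x
  have hv : vk (completeBasis K) w₀ (-k) = - vk (completeBasis K) w₀ k := by
    simp [vk]
  have hne : ((e (ζ, k) : 𝓞 K) : K) ≠ 0 := by simp
  rw [hv, gE, logMap_mul K hne hα, he]
  have hu1 := sum_logMap_unit K (e (ζ, k))
  obtain ⟨m, hu2⟩ := hlu (e (ζ, k))
  rw [he] at hu1 hu2
  simp only [Pi.add_apply, Pi.neg_apply]
  have : (∀ w, vk (completeBasis K) w₀ k w + logMap K α w < x w) ↔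
      (∀ w, logMap K α w < x w + -vk (completeBasis K) w₀ k w) := 
    forall_congr' fun w => by constructor <;> intro h <;> linarith
  refine if_ctx_congr this (fun _ => ?_) fun _ => rfl
  · rw [E_eq, E_eq lam s (fun w => x w + -vk (completeBasis K) w₀ k w)]
    simp only [mul_add, mul_neg, Finset.sum_add_distrib, Finset.sum_neg_distrib]
    rw [hu1, hu2, neg_zero, add_zero, Complex.exp_eq_exp_iff_exists_int]
    exact ⟨m, by push_cast; ring⟩
end C4

end

section
open Filter Topology MeasureTheory Set
open NumberField NumberField.InfinitePlace NumberField.Units NumberField.mixedEmbedding.fundamentalCone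
open NumberField.Units.dirichletUnitTheorem (w₀)
open nonZeroDivisors
section C5
variable {K : Type*} [Field K] [NumberField K]

/-- ideals in the inverse class of c -/
abbrev Icl (c : ID K) := {a : ID K // ClassGroup.mk0 (a * c) = 1}

lemma genI_ex (c : ID K) (a : Icl c) : ∃ α : 𝓞 K, α ≠ 0 ∧ ((a.1 * c : ID K) : Ideal (𝓞 K)) = Ideal.span {α} := by
  obtain ⟨α, hα⟩ := ((ClassGroup.mk0_eq_one_iff (a.1 * c).2).1 a.2).principal
  refine ⟨α, ?_, hα⟩
  rintro rfl
  have := nonZeroDivisors.coe_ne_zero (a.1 * c)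
  rw [hα] at this
  simp at this

noncomputable def genI (c : ID K) (a : Icl c) : 𝓞 K := (genI_ex c a).choose
lemma genI_ne (c : ID K) (a : Icl c) : genI c a ≠ 0 := (genI_ex c a).choose_spec.1
lemma genI_span (c : ID K) (a : Icl c) : ((a.1 * c : ID K) : Ideal (𝓞 K)) = Ideal.span {genI c a} :=
  (genI_ex c a).choose_spec.2

noncomputable def bt (c : ID K) (i : Icl c × (𝓞 K)ˣ) : 𝓞 K := i.2 * genI c i.1

lemma bt_ne (c : ID K) (i) : bt c i ≠ 0 := mul_ne_zero i.2.ne_zero (genI_ne c i.1)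

lemma bt_coe_ne (c : ID K) (i) : (bt c i : K) ≠ 0 := by simpa using bt_ne c i

lemma bt_span (c : ID K) (i) : Ideal.span {bt c i} = ((i.1.1 * c : ID K) : Ideal (𝓞 K)) := by
  rw [genI_span, bt, Ideal.span_singleton_mul_left_unit i.2.isUnit]

lemma bt_inj (c : ID K) : Function.Injective (bt c) := by
  rintro ⟨a, u⟩ ⟨a', u'⟩ h
  have h1 := congrArg (fun α => Ideal.span {α}) h
  simp only [bt_span] at h1
  have h2 : a = a' := Subtype.ext (mul_right_cancel (Subtype.ext h1))
  subst h2
  have h3 : u = u' := Units.ext (mul_right_cancel₀ (genI_ne c a) h)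
  rw [h3]

lemma bt_range (c : ID K) {α : 𝓞 K} (hα : α ≠ 0) (h : α ∈ (c : Ideal (𝓞 K))) : ∃ i, bt c i = α := by
  have h0 : Ideal.span {α} ≠ 0 := by simpa using hα
  obtain ⟨a, ha⟩ := (ID_dvd (a := c) (b := ⟨_, mem_nonZeroDivisors_of_ne_zero h0⟩)).2
    (Ideal.dvd_iff_le.2 ((Ideal.span_singleton_le_iff_mem _).2 h))
  have h1 : ((a * c : ID K) : Ideal (𝓞 K)) = Ideal.span {α} := by
    rw [mul_comm]; exact (congrArg Subtype.val ha).symm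
  have h2 : ClassGroup.mk0 (a * c) = 1 := (ClassGroup.mk0_eq_one_iff (a * c).2).2 (by rw [h1]; exact ⟨α, rfl⟩)
  have h3 := genI_span c ⟨a, h2⟩
  rw [h1, Ideal.span_singleton_eq_span_singleton] at h3
  obtain ⟨u, hu⟩ := h3.symm
  exact ⟨(⟨a, h2⟩, u), by rw [bt, mul_comm]; exact hu⟩

/-- counting set -/
def cS (c : ID K) (x : InfinitePlace K → ℝ) : Set (Icl c × (𝓞 K)ˣ) := {i | ∀ w, logMap K (bt c i : K) w < x w}

instance : Countable (Icl (K := K) c × (𝓞 K)ˣ) := by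
  haveI : Countable K := by
    have := (Module.finBasis ℚ K).equivFun.toEquiv.injective.countable
    exact this
  haveI : Countable (𝓞 K) := RingOfIntegers.coe_injective.countable
  exact (bt_inj c).countable

lemma mem_J (c : ID K) (x : K) : x ∈ ((FractionalIdeal.mk0 K c : (FractionalIdeal (𝓞 K)⁰ K)ˣ) : FractionalIdeal (𝓞 K)⁰ K) ↔
    ∃ y : 𝓞 K, y ∈ (c : Ideal (𝓞 K)) ∧ (y : K) = x := by
  rw [FractionalIdeal.coe_mk0, FractionalIdeal.mem_coeIdeal]

lemma cS_card (c : ID K) (x : InfinitePlace K → ℝ) (S : Finset K)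
    (hS : ∀ α, α ∈ S ↔ α ∈ ((FractionalIdeal.mk0 K c : (FractionalIdeal (𝓞 K)⁰ K)ˣ) : FractionalIdeal (𝓞 K)⁰ K) ∧
      ∀ w : InfinitePlace K, w α < Real.exp (x w / w.mult)) :
    (cS c x).Finite ∧ (cS c x).ncard + 1 = S.card := by
  classical
  have hinj : Function.Injective fun i => (bt c i : K) := RingOfIntegers.coe_injective.comp (bt_inj c)
  have him : (fun i => (bt c i : K)) '' cS c x = (S.erase 0 : Finset K) := by
    ext α
    simp only [Finset.coe_erase, mem_image, Set.mem_sdiff, Finset.mem_coe, mem_singleton_iff]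
    constructor
    · rintro ⟨i, hi, rfl⟩
      refine ⟨(hS _).2 ⟨(mem_J c _).2 ⟨bt c i, ?_, rfl⟩, fun w => (logMap_lt K (bt_coe_ne c i) w _).1 (hi w)⟩, bt_coe_ne c i⟩
      rw [← Ideal.span_singleton_le_iff_mem, bt_span]
      exact (Ideal.mul_le_right : (i.1.1.1 : Ideal (𝓞 K)) * (c.1 : Ideal (𝓞 K)) ≤ c.1)
    · rintro ⟨h1, h2⟩
      obtain ⟨h3, h4⟩ := (hS _).1 h1
      obtain ⟨y, hy, rfl⟩ := (mem_J c _).1 h3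
      obtain ⟨i, rfl⟩ := bt_range c (by simpa using h2) hy
      exact ⟨i, fun w => (logMap_lt K (bt_coe_ne c i) w _).2 (h4 w), rfl⟩
  have hfin : (cS c x).Finite := Set.Finite.of_finite_image (him ▸ Finset.finite_toSet _) hinj.injOn
  refine ⟨hfin, ?_⟩
  rw [← Set.ncard_image_of_injective _ hinj, him, Set.ncard_coe_finset]
  refine Finset.card_erase_add_one ((hS 0).2 ⟨Submodule.zero_mem _, fun w => ?_⟩)
  rw [map_zero]; exact Real.exp_pos _

lemma cS_mono (c : ID K) {x y : InfinitePlace K → ℝ} (h : x ≤ y) : cS c x ⊆ cS c y :=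
  fun _ hi w => (hi w).trans_le (h w)

lemma cS_empty (c : ID K) {x : InfinitePlace K → ℝ} (h : ∑ w, x w ≤ 0) : cS c x = ∅ := by
  refine eq_empty_of_forall_notMem fun i hi => ?_
  have h1 := Finset.sum_lt_sum_of_nonempty Finset.univ_nonempty fun w _ => hi w
  rw [sum_logMap_int K (bt_ne c i)] at h1
  exact absurd (Real.log_natCast_nonneg _) (by linarith)

/-- box counting on the fundamental domain -/
lemma cS_bound (c : ID K) : ∃ κ : ℝ, 0 < κ ∧ ∃ C1 : ℝ, (∀ x, (cS c x).Finite) ∧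
    ∀ x ∈ Fk (completeBasis K) w₀ 0, 0 < ∑ w, x w →
      |((cS c x).ncard : ℝ) - κ * Real.exp (∑ w, x w)| ≤
        C1 * Real.exp ((1 - 1 / (Module.finrank ℚ K : ℝ)) * ∑ w, x w) := by
  obtain ⟨κ, hκ, d, hd, H⟩ := boxcount K (FractionalIdeal.mk0 K c)
  set n := Module.finrank ℚ K with hn
  have hn0 : (1:ℝ) ≤ n := by exact_mod_cast (Module.finrank_pos : 0 < Module.finrank ℚ K)
  have hmp : ∀ w : InfinitePlace K, (1:ℝ) ≤ w.mult := fun w => by exact_mod_cast w.mult_pos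
  have hprod : ∀ x : InfinitePlace K → ℝ, ∏ w, (Real.exp (x w / w.mult)) ^ w.mult = Real.exp (∑ w, x w) := by
    intro x
    rw [Real.exp_sum]
    refine Finset.prod_congr rfl fun w _ => ?_
    rw [← Real.exp_nat_mul, mul_div_cancel₀ _ (by have := hmp w; linarith)]
  have H' : ∀ (ε : ℝ) (x : InfinitePlace K → ℝ), 0 ≤ ε → ε ≤ 1 → (∀ w, d ≤ ε * Real.exp (x w / w.mult)) →
      (cS c x).Finite ∧ |((cS c x).ncard + 1 : ℝ) - κ * Real.exp (∑ w, x w)| ≤ κ * 2 ^ n * ε * Real.exp (∑ w, x w) := by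
    intro ε x h0 h1 h2
    obtain ⟨S, hS, hb⟩ := H ⟨ε, h0⟩ (fun w => ⟨_, (Real.exp_pos (x w / w.mult)).le⟩) (by exact_mod_cast h1) h2
    obtain ⟨h3, h4⟩ := cS_card c x S hS
    refine ⟨h3, ?_⟩
    rw [← h4] at hb
    push_cast at hb
    change |_ - κ * ∏ w, (Real.exp (x w / w.mult)) ^ w.mult| ≤ κ * 2 ^ n * ε * ∏ w, (Real.exp (x w / w.mult)) ^ w.mult at hb
    rwa [hprod] at hb
  have hfin : ∀ x, (cS c x).Finite := by
    intro x
    have : x ≤ fun w => x w ⊔ (Real.log d * w.mult) := fun w => le_sup_left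
    refine (H' 1 _ zero_le_one le_rfl fun w => ?_).1.subset (cS_mono c this)
    rw [one_mul, ← Real.log_le_iff_le_exp hd, le_div_iff₀ (by have := hmp w; linarith)]
    exact le_sup_right
  set A := ∑ i, ∑ w, |completeBasis K i w| with hA
  have hA0 : 0 ≤ A := by positivity
  have hlow : ∀ x ∈ Fk (completeBasis K) w₀ 0, ∀ w, (∑ w, x w) / n - A ≤ x w / w.mult := by
    intro x hx w
    have hx' := (completeBasis K).sum_repr x
    set r := fun i => (completeBasis K).repr x i with hr
    have hs : ∑ w, x w = n * r w₀ := by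
      conv_lhs => rw [← hx']
      simp only [Finset.sum_apply, Pi.smul_apply, smul_eq_mul]
      rw [Finset.sum_comm]
      simp only [← Finset.mul_sum]
      rw [Finset.sum_eq_single w₀ (fun i _ hi => by rw [sumBi K i hi, mul_zero]) (by simp), sumB0, mul_comm]
    classical
    have hxw : x w = r w₀ * w.mult + ∑ i ∈ Finset.univ.erase w₀, r i * completeBasis K i w := by
      conv_lhs => rw [← hx']
      simp only [Finset.sum_apply, Pi.smul_apply, smul_eq_mul]
      rw [← Finset.add_sum_erase _ _ (Finset.mem_univ w₀), completeBasis_apply_of_eq]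
    have hb : |∑ i ∈ Finset.univ.erase w₀, r i * completeBasis K i w| ≤ A := by
      refine (Finset.abs_sum_le_sum_abs _ _).trans ?_
      rw [hA]
      refine (Finset.sum_le_sum fun i hi => ?_).trans (Finset.sum_le_sum_of_subset_of_nonneg
        (Finset.erase_subset _ _) fun _ _ _ => Finset.sum_nonneg fun _ _ => abs_nonneg _)
      have h1 := Int.floor_eq_zero_iff.1 (hx ⟨i, Finset.ne_of_mem_erase hi⟩)
      rw [abs_mul]
      refine le_trans ?_ (Finset.single_le_sum (fun w _ => abs_nonneg (completeBasis K i w)) (Finset.mem_univ w))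
      refine mul_le_of_le_one_left (abs_nonneg _) ?_
      rw [abs_of_nonneg h1.1]; exact h1.2.le
    rw [hs, mul_div_cancel_left₀ _ (by linarith), le_div_iff₀ (by have := hmp w; linarith), hxw, sub_mul]
    nlinarith [(abs_le.1 hb).1, hmp w]
  set R := d * Real.exp A with hR
  have hR0 : 0 < R := by positivity
  refine ⟨κ, hκ, max (κ * 2 ^ n * R + 1) ((κ * 2 ^ n + κ) * R ^ n * R ^ n + κ * R ^ n + 1), hfin, fun x hx hx0 => ?_⟩
  set t := (∑ w, x w) / n with ht
  have ht0 : 0 < t := by positivity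
  have hsum : ∑ w, x w = n * t := by rw [ht]; field_simp
  have e1 : (1 - 1 / (n:ℝ)) * (n * t) = n * t + -t := by field_simp; ring
  have hge1 : 1 ≤ Real.exp (n * t + -t) := Real.one_le_exp (by nlinarith)
  rw [hsum, e1]
  have hRt : ∀ w, d ≤ R * Real.exp (-t) * Real.exp (x w / w.mult) := by
    intro w
    rw [hR, mul_assoc, mul_assoc, ← Real.exp_add, ← Real.exp_add]
    refine le_mul_of_one_le_right hd.le (Real.one_le_exp ?_)
    linarith [hlow x hx w]
  by_cases hε : R * Real.exp (-t) ≤ 1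
  · have h1 := (H' _ x (by positivity) hε hRt).2
    rw [hsum] at h1
    rw [Real.exp_add] at hge1 ⊢
    refine le_trans ?_ (mul_le_mul_of_nonneg_right (le_max_left _ _) (by positivity))
    rw [abs_le] at h1 ⊢
    constructor <;> nlinarith [h1.1, h1.2]
  · have hRt' : Real.exp t ≤ R := by
      have := (not_le.1 hε).le
      rw [Real.exp_neg] at this
      have h3 := Real.exp_pos t
      field_simp at this
      exact this
    have hR1 : 1 ≤ R := (Real.one_le_exp ht0.le).trans hRt'
    have hnt : Real.exp (n * t) ≤ R ^ n := by
      rw [Real.exp_nat_mul]; gcongr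
    set y : InfinitePlace K → ℝ := fun w => x w + w.mult * Real.log R with hy
    have hxy : x ≤ y := fun w => by
      simp only [hy]
      have := Real.log_nonneg hR1
      have := hmp w
      nlinarith
    have hys : Real.exp (∑ w, y w) ≤ R ^ n * R ^ n := by
      simp only [hy, Finset.sum_add_distrib, ← Finset.sum_mul]
      rw [hsum, ← Nat.cast_sum, sum_mult_eq, Real.exp_add, Real.exp_nat_mul (Real.log R), Real.exp_log hR0]
      gcongr
    have h1 := (H' 1 y zero_le_one le_rfl fun w => by
      refine (hRt w).trans ?_
      simp only [hy]
      rw [one_mul, add_div, mul_div_cancel_left₀ _ (by have := hmp w; linarith), Real.exp_add, Real.exp_log hR0, mul_comm (Real.exp _)]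
      refine mul_le_mul_of_nonneg_right ?_ (Real.exp_pos _).le
      exact mul_le_of_le_one_right hR0.le (Real.exp_le_one_iff.2 (by linarith))).2
    have h2 : ((cS c x).ncard : ℝ) ≤ (cS c y).ncard := by
      exact_mod_cast Set.ncard_le_ncard (cS_mono c hxy) (hfin y)
    have h3 := (abs_le.1 h1).2
    have h4 : (0:ℝ) ≤ (cS c x).ncard := Nat.cast_nonneg _
    refine le_trans ?_ (le_mul_of_one_le_right (by positivity) hge1)
    refine le_trans ?_ (le_max_right _ _)
    have h5 := mul_le_mul_of_nonneg_left hnt hκ.le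
    have h6 := mul_le_mul_of_nonneg_left hys (by positivity : 0 ≤ κ * 2 ^ n + κ)
    have h7 : 0 ≤ κ * Real.exp (n * t) := by positivity
    have h8 : 0 ≤ (κ * 2 ^ n + κ) * (R ^ n * R ^ n) := by positivity
    rw [abs_le]
    constructor <;> nlinarith
end C5

end

section
open Filter Topology MeasureTheory Set
open NumberField NumberField.InfinitePlace NumberField.Units NumberField.mixedEmbedding.fundamentalCone
open NumberField.Units.dirichletUnitTheorem (w₀)
open nonZeroDivisors
section C6
variable {K : Type*} [Field K] [NumberField K]

lemma summ_prod {A U : Type*} {f : A × U → ℝ} (h0 : ∀ i, 0 ≤ f i) {g : A → ℝ} (h1 : ∀ a, HasSum (fun u => f (a, u)) (g a))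
    (hg : Summable g) : Summable f := by
  rw [summable_prod_of_nonneg h0]
  refine ⟨fun a => (h1 a).summable, ?_⟩
  rwa [funext fun a => (h1 a).tsum_eq]

lemma gE_int (lam l : InfinitePlace K → ℝ) {s : ℂ} (hs : 0 < s.re) : Integrable (gE lam s l) := by
  classical
  have := (orth_int lam l hs).1
  exact this.congr (Eventually.of_forall fun x => by unfold gE; congr)

lemma gE_norm (lam l : InfinitePlace K → ℝ) (s : ℂ) (x) : ‖gE lam s l x‖ = (gE (fun _ => 0) (s.re : ℂ) l x).re := by
  classical
  unfold gE
  split_ifs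
  · rw [norm_E, E_eq]
    simp only [zero_mul, Finset.sum_const_zero]
    rw [← Complex.ofReal_neg, Complex.ofReal_zero, mul_zero, add_zero, ← Complex.ofReal_mul, Complex.exp_ofReal_re]
  · simp

lemma cS_meas (c : ID K) : Measurable fun x => ((cS c x).ncard : ℝ) := by
  have h : (fun x => ((cS c x).ncard : ℝ)) = fun x => (∑' i : Icl c × (𝓞 K)ˣ,
      ({y | ∀ w, logMap K (bt c i : K) w < y w} : Set (InfinitePlace K → ℝ)).indicator (fun _ => (1 : ENNReal)) x).toReal := by
    ext x
    have h1 : ∀ i, ({y | ∀ w, logMap K (bt c i : K) w < y w} : Set (InfinitePlace K → ℝ)).indicator (fun _ => (1 : ENNReal)) x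
      = (cS c x).indicator (fun _ => 1) i := fun i => rfl
    simp_rw [h1]
    rw [← tsum_subtype, ENNReal.tsum_set_one, Set.ncard_def]
    generalize (cS c x).encard = e
    cases e <;> simp
  rw [h]
  refine (Measurable.tsum fun i => measurable_const.indicator ?_).ennreal_toReal
  simp only [Set.ofPred_forall]
  exact MeasurableSet.iInter fun w => measurableSet_lt measurable_const (measurable_pi_apply w)

lemma gen_sum (c : ID K) (a : Icl c) : ∑ w, logMap K (genI c a : K) w = Real.log (nmK K a.1 * nmK K c : ℝ) := by
  rw [sum_logMap_int K (genI_ne c a), ← genI_span, ← nmK_apply, map_mul]; push_cast; rfl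

lemma nmK_pos (a : ID K) : (0:ℝ) < nmK K a := by exact_mod_cast (arithK (K := K)).pos a

lemma gen_val (c : ID K) (a : Icl c) (t : ℝ) : (Nat.card (torsion K) * (Complex.exp (-∑ w, ((t:ℂ) - Complex.I * (0:ℝ)) * logMap K (genI c a : K) w) /
        ∏ _w : InfinitePlace K, ((t:ℂ) - Complex.I * (0:ℝ))) : ℂ) =
    ((Nat.card (torsion K) * ((nmK K a.1 : ℝ) ^ (-t) * (nmK K c : ℝ) ^ (-t) / t ^ Fintype.card (InfinitePlace K)) : ℝ) : ℂ) := by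
  classical
  rw [E_eq (fun _ => 0), gen_sum, ← Real.mul_rpow (nmK_pos _).le (nmK_pos _).le, Real.rpow_def_of_pos (mul_pos (nmK_pos _) (nmK_pos _))]
  simp only [zero_mul, Finset.sum_const_zero, Complex.ofReal_zero, mul_zero, add_zero, sub_zero, Finset.prod_const, Finset.card_univ]
  push_cast
  rw [mul_comm (-(t:ℂ))]

lemma class_int (c : ID K) (hfin : ∀ x, (cS c x).Finite) (lam : InfinitePlace K → ℝ)
    (hlu : ∀ u : (𝓞 K)ˣ, ∃ k : ℤ, ∑ w, lam w * logMap K ((u : 𝓞 K) : K) w = 2 * Real.pi * k) {s : ℂ} (hs : 1 < s.re) :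
    ∑' a : Icl c, Nat.card (torsion K) * (Complex.exp (-∑ w, (s - Complex.I * lam w) * logMap K (genI c a : K) w) /
        ∏ w, (s - Complex.I * lam w)) = ∫ x in Fk (completeBasis K) w₀ 0, ((cS c x).ncard : ℂ) *
          Complex.exp (-∑ w, (s - Complex.I * lam w) * x w) := by
  classical
  have hs0 : 0 < s.re := by linarith
  set F := Fk (completeBasis K) w₀ 0
  have hint : ∀ i : Icl c × (𝓞 K)ˣ, Integrable (gE lam s (logMap K (bt c i : K))) (volume.restrict F) :=
    fun i => (gE_int _ _ hs0).integrableOn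
  have hbt : ∀ a u, logMap K (bt c (a, u) : K) = logMap K (((u : 𝓞 K) : K) * (genI c a : K)) := fun a u => by
    simp [bt]
  have hne : ∀ a, (genI c a : K) ≠ 0 := fun a => by simpa using genI_ne c a
  have hsum : Summable fun i : Icl c × (𝓞 K)ˣ => ∫ x in F, ‖gE lam s (logMap K (bt c i : K)) x‖ := by
    have hre : ∀ i : Icl c × (𝓞 K)ˣ, ∫ x in F, ‖gE lam s (logMap K (bt c i : K)) x‖ =
        Complex.reCLM (∫ x in F, gE (fun _ => 0) (s.re : ℂ) (logMap K (bt c i : K)) x) := by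
      intro i
      simp_rw [gE_norm]
      exact Complex.reCLM.integral_comp_comm (gE_int _ _ (by simpa)).integrableOn
    have h1 : ∀ a : Icl c, HasSum (fun u => ∫ x in F, ‖gE lam s (logMap K (bt c (a, u) : K)) x‖)
        (Nat.card (torsion K) * ((nmK K a.1 : ℝ) ^ (-s.re) * (nmK K c : ℝ) ^ (-s.re) / s.re ^ Fintype.card (InfinitePlace K))) := by
      intro a
      have h2 := Complex.reCLM.hasSum (unit_sum (fun _ => 0) (fun u => ⟨0, by simp⟩) (s := (s.re : ℂ)) (by simpa) (hne a))
      simp_rw [hre, hbt]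
      have hv := gen_val c a s.re
      rw [hv] at h2
      exact h2
    refine summ_prod (fun i => integral_nonneg fun x => norm_nonneg _) h1 ?_
    exact (((conv_K s.re hs).comp_injective (Subtype.val_injective : Function.Injective (fun a : Icl c => a.1))).mul_right _ |>.div_const _).mul_left _
  have h3 := hasSum_integral_of_summable_integral_norm hint hsum
  have h4 : ∀ x, ∑' i : Icl c × (𝓞 K)ˣ, gE lam s (logMap K (bt c i : K)) x = ((cS c x).ncard : ℂ) *
          Complex.exp (-∑ w, (s - Complex.I * lam w) * x w) := by
    intro x
    have : ∀ i, gE lam s (logMap K (bt c i : K)) x = (cS c x).indicator (fun _ => Complex.exp (-∑ w, (s - Complex.I * lam w) * x w)) i := by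
      intro i
      unfold gE
      rw [Set.indicator_apply]
      exact if_ctx_congr Iff.rfl (fun _ => rfl) fun _ => rfl
    simp_rw [this]
    rw [← tsum_subtype]
    haveI := (hfin x).fintype
    rw [tsum_fintype, Finset.sum_const, nsmul_eq_mul, Finset.card_univ, ← Nat.card_eq_fintype_card]
    rfl
  simp_rw [h4] at h3
  refine (h3.prod_fiberwise fun a => ?_).tsum_eq
  simp_rw [hbt]
  exact unit_sum lam hlu hs0 (hne a)

lemma gen_exp (c : ID K) (a : Icl c) (lam : InfinitePlace K → ℝ) (χ : ID K →* ℂ)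
    (hχ : ∀ (α : 𝓞 K) (b : ID K), (b : Ideal (𝓞 K)) = Ideal.span {α} → χ b = Complex.exp (Complex.I * (∑ w, lam w * logMap K (α : K) w : ℝ)))
    (s : ℂ) : Complex.exp (-∑ w, (s - Complex.I * lam w) * logMap K (genI c a : K) w) =
      χ a.1 * (nmK K a.1 : ℂ) ^ (-s) * (χ c * (nmK K c : ℂ) ^ (-s)) := by
  classical
  rw [E_eq, Complex.exp_add, ← hχ _ _ (genI_span c a), gen_sum, map_mul]
  have h1 : Complex.exp (-s * (Real.log (nmK K a.1 * nmK K c : ℝ) : ℝ)) = ((nmK K a.1 : ℝ) : ℂ) ^ (-s) * ((nmK K c : ℝ) : ℂ) ^ (-s) := by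
    rw [← Complex.mul_cpow_ofReal_nonneg (nmK_pos _).le (nmK_pos _).le, Complex.cpow_def_of_ne_zero, ← Complex.ofReal_mul,
      ← Complex.ofReal_log (mul_pos (nmK_pos _) (nmK_pos _)).le, mul_comm]
    exact_mod_cast (mul_pos (nmK_pos _) (nmK_pos _)).ne'
  rw [h1]
  push_cast
  ring

open scoped Classical in
lemma class_L (c : ID K) : ∃ R : ℝ, 0 < R ∧ ∀ (lam : InfinitePlace K → ℝ) (_ : ∑ w, lam w * w.mult = 0)
    (_ : ∀ u : (𝓞 K)ˣ, ∃ k : ℤ, ∑ w, lam w * logMap K ((u : 𝓞 K) : K) w = 2 * Real.pi * k) (χ : ID K →* ℂ) (_ : ∀ a, ‖χ a‖ = 1)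
    (_ : ∀ (α : 𝓞 K) (b : ID K), (b : Ideal (𝓞 K)) = Ideal.span {α} → χ b = Complex.exp (Complex.I * (∑ w, lam w * logMap K (α : K) w : ℝ))),
    ∃ J : ℂ → ℂ, DifferentiableOn ℂ J {s | 1 - 1 / (Module.finrank ℚ K : ℝ) < s.re} ∧ ∀ s : ℂ, 1 < s.re →
      ∑' a : Icl c, χ a.1 * (nmK K a.1 : ℂ) ^ (-s) = (χ c)⁻¹ * (nmK K c : ℂ) ^ s * (∏ w, (s - Complex.I * lam w)) *
       (J s + R * (∏ i : {i // i ≠ w₀}, ∫ c in (0:ℝ)..1,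
        Complex.exp (Complex.I * (∑ w, lam w * completeBasis K i.1 w : ℝ) * c)) / (s - 1)) := by
  classical
  have hn : (0:ℝ) < Module.finrank ℚ K := by exact_mod_cast (Module.finrank_pos : 0 < Module.finrank ℚ K)
  obtain ⟨D, hD, H⟩ := J_hol (completeBasis K) w₀ hn (sumB0 K) (sumBi K)
  obtain ⟨κ, hκ, C1, hfin, hb⟩ := cS_bound c
  have hw : 0 < (Nat.card (torsion K) : ℝ) := by exact_mod_cast Nat.card_pos
  have hw' : (Nat.card (torsion K) : ℂ) ≠ 0 := by exact_mod_cast hw.ne'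
  refine ⟨κ * D / Nat.card (torsion K), by positivity, fun lam hl0 hlu χ hχ1 hχ => ?_⟩
  obtain ⟨J, hJ, hJ'⟩ := H lam (by rwa [completeBasis_apply_of_eq]) _ (cS_meas c) κ C1 (1 - 1 / (Module.finrank ℚ K : ℝ))
    (by have := one_div_pos.2 hn; linarith) hb (fun x hx => by rw [cS_empty c hx]; simp)
  refine ⟨fun s => J s / Nat.card (torsion K), hJ.div_const _, fun s hs => ?_⟩
  have h1 := class_int c hfin lam hlu hs
  have h2 := hJ' s hs
  push_cast at h2
  rw [h2, tsum_mul_left] at h1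
  simp_rw [gen_exp c _ lam χ hχ] at h1
  rw [tsum_div_const, tsum_mul_right] at h1
  have hP : ∏ w, (s - Complex.I * lam w) ≠ 0 := Finset.prod_ne_zero_iff.2 fun w _ h => by
    have := congrArg Complex.re h
    simp at this; linarith
  have hc : χ c ≠ 0 := fun h => by have := hχ1 c; rw [h] at this; simp at this
  have hN : (nmK K c : ℂ) ≠ 0 := by exact_mod_cast (nmK_pos c).ne'
  have hs1 : s - 1 ≠ 0 := fun h => by
    rw [sub_eq_zero.1 h] at hs; simp at hs
  have hNs : (nmK K c : ℂ) ^ s ≠ 0 := by rw [Ne, Complex.cpow_eq_zero_iff]; tauto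
  rw [Complex.cpow_neg] at h1
  push_cast
  field_simp at h1 ⊢
  linear_combination h1
end C6

end

section
open Filter Topology MeasureTheory Set
open NumberField NumberField.InfinitePlace NumberField.Units NumberField.mixedEmbedding.fundamentalCone
open NumberField.Units.dirichletUnitTheorem (w₀)
open nonZeroDivisors
section C7
variable {K : Type*} [Field K] [NumberField K]

/-- compatibility of an ideal character with an infinity type -/
structure HasLam (χ : ID K →* ℂ) (lam : InfinitePlace K → ℝ) : Prop where
  l0 : ∑ w, lam w * w.mult = 0
  nrm : ∀ a, ‖χ a‖ = 1
  val : ∀ (α : 𝓞 K) (b : ID K), (b : Ideal (𝓞 K)) = Ideal.span {α} →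
    χ b = Complex.exp (Complex.I * (∑ w, lam w * logMap K (α : K) w : ℝ))

lemma HasLam.lu {χ : ID K →* ℂ} {lam : InfinitePlace K → ℝ} (h : HasLam χ lam) (u : (𝓞 K)ˣ) :
    ∃ k : ℤ, ∑ w, lam w * logMap K ((u : 𝓞 K) : K) w = 2 * Real.pi * k := by
  have h1 := h.val u 1 (by rw [Ideal.span_singleton_eq_top.2 u.isUnit]; exact Ideal.one_eq_top)
  rw [map_one] at h1
  obtain ⟨k, hk⟩ := Complex.exp_eq_one_iff.1 h1.symm
  refine ⟨k, ?_⟩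
  have h2 : ((∑ w, lam w * logMap K ((u : 𝓞 K) : K) w : ℝ) : ℂ) = ((2 * Real.pi * k : ℝ) : ℂ) := by
    refine mul_left_cancel₀ Complex.I_ne_zero (hk.trans ?_)
    push_cast; ring
  exact_mod_cast h2

lemma HasLam.one : HasLam (1 : ID K →* ℂ) (fun _ => 0) := ⟨by simp, by simp, by simp⟩

open scoped Classical in
lemma M_zero {χ : ID K →* ℂ} {lam : InfinitePlace K → ℝ} (h : HasLam χ lam) (hl : lam ≠ 0) :
    (∏ i : {i // i ≠ w₀}, ∫ c in (0:ℝ)..1, Complex.exp (Complex.I * (∑ w, lam w * completeBasis K i.1 w : ℝ) * c)) = 0 := by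
  by_contra h0
  refine hl ?_
  have h1 : ∀ i, ∑ w, lam w * completeBasis K i w = 0 := by
    intro i
    by_cases hi : i = w₀
    · rw [hi, completeBasis_apply_of_eq]; exact h.l0
    have h2 := Finset.prod_ne_zero_iff.1 h0 ⟨i, hi⟩ (Finset.mem_univ _)
    obtain ⟨k, hk⟩ := h.lu (fundSystem K (equivFinRank.symm ⟨i, hi⟩))
    rw [← B_unit K ⟨i, hi⟩] at hk
    dsimp only at h2 hk
    rw [hk] at h2 ⊢
    by_contra h3
    have h4 : Complex.I * ((2 * Real.pi * k : ℝ) : ℂ) ≠ 0 := mul_ne_zero Complex.I_ne_zero (by exact_mod_cast h3)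
    refine h2 ?_
    rw [integral_exp_mul_complex h4]
    have : Complex.exp (Complex.I * ((2 * Real.pi * k : ℝ) : ℂ) * (1:ℝ)) = 1 :=
      Complex.exp_eq_one_iff.2 ⟨k, by push_cast; ring⟩
    rw [this]; simp
  have h5 : (Fintype.linearCombination ℝ lam : (InfinitePlace K → ℝ) →ₗ[ℝ] ℝ) = 0 := by
    refine (completeBasis K).ext fun i => ?_
    rw [Fintype.linearCombination_apply, LinearMap.zero_apply, ← h1 i]
    exact Finset.sum_congr rfl fun w _ => by rw [smul_eq_mul, mul_comm]
  ext w
  have := LinearMap.congr_fun h5 (Pi.single w 1)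
  simpa [Fintype.linearCombination_apply, Pi.single_apply] using this

lemma L_split {χ : ID K →* ℂ} {lam : InfinitePlace K → ℝ} (h : HasLam χ lam) (c : ClassGroup (𝓞 K) → ID K)
    (hc : ∀ C, ClassGroup.mk0 (c C) = C⁻¹) {s : ℂ} (hs : 1 < s.re) :
    Lser (nmK K) χ s = ∑ C, ∑' a : Icl (c C), χ a.1 * (nmK K a.1 : ℂ) ^ (-s) := by
  have hsum : Summable fun a : ID K => χ a * (nmK K a : ℂ) ^ (-s) := by
    refine dsConv.summable (N := fun a => nmK K a) ⟨fun a => arithK.pos a, fun x hx => ?_⟩ hs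
    simpa [h.nrm] using conv_K x hx
  rw [Lser, ds, ← (Equiv.sigmaFiberEquiv fun a : ID K => ClassGroup.mk0 a).tsum_eq,
    Summable.tsum_sigma, tsum_fintype]
  swap
  · exact (Equiv.sigmaFiberEquiv fun a : ID K => ClassGroup.mk0 a).summable_iff.2 hsum
  refine Finset.sum_congr rfl fun C _ => ?_
  refine (Equiv.subtypeEquivRight fun a => ?_ : {a : ID K // ClassGroup.mk0 a = C} ≃ Icl (c C)).tsum_eq
    (fun a : Icl (c C) => χ a.1 * (nmK K a.1 : ℂ) ^ (-s)) 
  rw [map_mul, hc, mul_inv_eq_one]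

lemma exists_reps : ∃ c : ClassGroup (𝓞 K) → ID K, ∀ C, ClassGroup.mk0 (c C) = C⁻¹ := by
  choose c hc using fun C : ClassGroup (𝓞 K) => ClassGroup.mk0_surjective C⁻¹
  exact ⟨c, hc⟩

variable (K) in
/-- width of the continuation -/
noncomputable def dK : ℝ := 1 / (Module.finrank ℚ K : ℝ)
lemma dK_pos : 0 < dK K := one_div_pos.2 (by exact_mod_cast (Module.finrank_pos : 0 < Module.finrank ℚ K))

lemma contL {χ : ID K →* ℂ} {lam : InfinitePlace K → ℝ} (h : HasLam χ lam) (hl : lam ≠ 0) :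
    ∃ Z : ℂ → ℂ, DifferentiableOn ℂ Z {s | 1 - dK K < s.re} ∧ ∀ s : ℂ, 1 < s.re → Z s = Lser (nmK K) χ s := by
  classical
  obtain ⟨c, hc⟩ := exists_reps (K := K)
  choose R hR H using fun C => class_L (c C)
  choose J hJ hJ' using fun C => H C lam h.l0 h.lu χ h.nrm h.val
  refine ⟨fun s => ∑ C, (χ (c C))⁻¹ * (nmK K (c C) : ℂ) ^ s * (∏ w, (s - Complex.I * lam w)) * J C s, ?_, fun s hs => ?_⟩
  · refine DifferentiableOn.fun_sum fun C _ => ?_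
    have hN : (nmK K (c C) : ℂ) ≠ 0 := by exact_mod_cast (nmK_pos (c C)).ne'
    refine DifferentiableOn.fun_mul (Differentiable.differentiableOn ?_) (hJ C)
    refine Differentiable.fun_mul ((differentiable_const _).mul (differentiable_id.const_cpow (Or.inl hN))) ?_
    fun_prop
  · rw [L_split h c hc hs]
    refine Finset.sum_congr rfl fun C _ => ?_
    rw [hJ' C s hs, M_zero h hl]; simp

lemma contZ : ∃ Z : ℂ → ℂ, DifferentiableOn ℂ Z {s | 1 - dK K < s.re} ∧
    (∀ s : ℂ, 1 < s.re → Z s = (s - 1) * Lser (nmK K) 1 s) ∧ Z 1 ≠ 0 := by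
  classical
  obtain ⟨c, hc⟩ := exists_reps (K := K)
  choose R hR H using fun C => class_L (c C)
  have h := HasLam.one (K := K)
  choose J hJ hJ' using fun C => H C (fun _ => 0) h.l0 h.lu 1 h.nrm h.val
  refine ⟨fun s => ∑ C, (nmK K (c C) : ℂ) ^ s * s ^ Fintype.card (InfinitePlace K) * ((s - 1) * J C s + R C), ?_, fun s hs => ?_, ?_⟩
  · refine DifferentiableOn.fun_sum fun C _ => ?_
    have hN : (nmK K (c C) : ℂ) ≠ 0 := by exact_mod_cast (nmK_pos (c C)).ne'
    refine DifferentiableOn.fun_mul (Differentiable.differentiableOn ?_) ?_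
    · exact Differentiable.fun_mul (differentiable_id.const_cpow (Or.inl hN)) (by fun_prop)
    · exact (DifferentiableOn.fun_mul (by fun_prop) (hJ C)).add_const _
  · have hs1 : s - 1 ≠ 0 := fun h => by
      rw [sub_eq_zero.1 h] at hs; simp at hs
    rw [L_split h c hc hs, Finset.mul_sum]
    refine Finset.sum_congr rfl fun C _ => ?_
    rw [hJ' C s hs]
    simp
    field_simp
  · have : (∑ C, (nmK K (c C) : ℂ) ^ (1:ℂ) * 1 ^ Fintype.card (InfinitePlace K) * ((1 - 1) * J C 1 + R C)) =
      ((∑ C, (nmK K (c C) : ℝ) * R C : ℝ) : ℂ) := by push_cast; simp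
    dsimp only
    rw [this]
    exact_mod_cast (Finset.sum_pos (fun C _ => mul_pos (nmK_pos _) (hR C)) Finset.univ_nonempty).ne'

/-- prime ideal theorem, twisted by a character with nontrivial infinity type -/
lemma PITchi {χ : ID K →* ℂ} {lam : InfinitePlace K → ℝ} (h : HasLam χ lam) (hl : lam ≠ 0) :
    Tendsto (fun x : ℝ => arithK.psum (fun q => lgq (nmK K) (pidK K) q * χ (qid (pidK K) q)) x / x) atTop (𝓝 0) := by
  obtain ⟨Z1, a1, a2, a3⟩ := contZ (K := K)
  have h2 : HasLam (χ ^ 2) (2 • lam) := ⟨by simp [mul_assoc, ← Finset.mul_sum, h.l0], by simp [h.nrm], fun α b hb => by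
    rw [MonoidHom.pow_apply, h.val α b hb, ← Complex.exp_nat_mul]; simp [mul_assoc, ← Finset.mul_sum]; ring_nf⟩
  set χ' : ID K →* ℂ := (starRingEnd ℂ : ℂ →* ℂ).comp χ with hχ'
  have h' : HasLam χ' (-lam) := ⟨by simp [h.l0], by simp [hχ', h.nrm], fun α b hb => by
    simp [hχ', h.val α b hb, ← Complex.exp_conj]⟩
  have h2' : HasLam (χ' ^ 2) (2 • -lam) := ⟨by simp [mul_assoc, ← Finset.mul_sum, h.l0], by simp [h'.nrm], fun α b hb => by
    rw [MonoidHom.pow_apply, h'.val α b hb, ← Complex.exp_nat_mul]; simp [mul_assoc, ← Finset.mul_sum]; ring_nf⟩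
  obtain ⟨Z, b1, b2⟩ := contL h hl
  obtain ⟨Z2, c1, c2⟩ := contL h2 (smul_ne_zero two_ne_zero hl)
  obtain ⟨Z', d1, d2⟩ := contL h' (by simpa using hl)
  obtain ⟨Z2', e1, e2⟩ := contL h2' (smul_ne_zero two_ne_zero (neg_ne_zero.2 hl))
  exact arithK.pit_chi dK_pos a1 a2 a3 h.nrm (fun a => rfl) b1 b2 c1 c2 d1 d2 e1 e2

lemma PIT1 : Tendsto (fun x : ℝ => (arithK (K := K)).psum (lgq (nmK K) (pidK K)) x / x) atTop (𝓝 1) := by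
  obtain ⟨Z1, a1, a2, a3⟩ := contZ (K := K)
  exact arithK.pit_one dK_pos a1 a2 a3
end C7

end

section
open Filter Topology MeasureTheory Set
section F1
variable {I P G : Type*} [CancelCommMonoid I] [CommGroup G] {nm : I →* ℕ} {pid : P → I}

open scoped Classical in
/-- an element of minimal norm with given type -/
noncomputable def rho (nm : I →* ℕ) (typ : I →* G) (x : G) : I :=
  if h : {a | typ a = x}.Nonempty then Function.argminOn nm {a | typ a = x} h else 1

/-- height of a type -/
noncomputable def Hh (nm : I →* ℕ) (typ : I →* G) (x : G) : ℕ := nm (rho nm typ x)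

lemma rho_typ (typ : I →* G) (a : I) : typ (rho nm typ (typ a)) = typ a := by
  have h : {b | typ b = typ a}.Nonempty := ⟨a, rfl⟩
  rw [rho, dif_pos h]
  exact Function.argminOn_mem nm {b | typ b = typ a} h

lemma Hh_le (typ : I →* G) (a : I) : Hh nm typ (typ a) ≤ nm a := by
  have h : {b | typ b = typ a}.Nonempty := ⟨a, rfl⟩
  rw [Hh, rho, dif_pos h]
  exact Function.argminOn_le nm {b | typ b = typ a} (rfl : typ a = typ a)

variable (A : Arith nm pid) (typ : I →* G)
include A

open scoped Classical in
/-- types of height at most X -/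
noncomputable def Arith.TX (X : ℝ) : Finset G := (A.fin ⌊X⌋₊).toFinset.image typ

variable {typ}
lemma Arith.mem_TX {X : ℝ} {x : G} : x ∈ A.TX typ X ↔ ∃ a, typ a = x ∧ (nm a : ℝ) ≤ X := by
  classical
  simp only [Arith.TX, Finset.mem_image, Set.Finite.mem_toFinset, Set.mem_ofPred_eq]
  refine exists_congr fun a => ?_
  rw [and_comm, Nat.le_floor_iff' (by have := A.pos a; omega)]

lemma Arith.TX_H {X : ℝ} {x : G} (h : x ∈ A.TX typ X) : (Hh nm typ x : ℝ) ≤ X := by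
  obtain ⟨a, rfl, h'⟩ := A.mem_TX.1 h
  have h1 : Hh nm typ (typ a) ≤ nm a := Hh_le typ a
  have h2 : (Hh nm typ (typ a) : ℝ) ≤ nm a := by exact_mod_cast h1
  exact h2.trans h'

lemma Arith.TX_rho {X : ℝ} {x : G} (h : x ∈ A.TX typ X) : typ (rho nm typ x) = x := by
  obtain ⟨a, rfl, h⟩ := A.mem_TX.1 h
  exact rho_typ typ a

lemma Arith.TX_of (X : ℝ) (a : I) (h : (Hh nm typ (typ a) : ℝ) ≤ X) : typ a ∈ A.TX typ X :=
  A.mem_TX.2 ⟨_, rho_typ typ a, h⟩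

lemma Arith.H_pos (x : G) : (0:ℝ) < Hh nm typ x := by exact_mod_cast A.pos _

/-- number of types -/
noncomputable def Arith.Wt (A : Arith nm pid) (typ : I →* G) (X : ℝ) : ℝ := (A.TX typ X).card
/-- harmonic sum of types, scaled -/
noncomputable def Arith.Mt (A : Arith nm pid) (typ : I →* G) (X : ℝ) : ℝ := ∑ x ∈ A.TX typ X, X / Hh nm typ x

lemma Arith.W_le_M {X : ℝ} : A.Wt typ X ≤ A.Mt typ X := by
  rw [Arith.Wt, Arith.Mt, Finset.card_eq_sum_ones, Nat.cast_sum]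
  refine Finset.sum_le_sum fun x hx => ?_
  rw [Nat.cast_one, one_le_div (A.H_pos x)]; exact A.TX_H hx

lemma Arith.M_ge {X : ℝ} (hX : 1 ≤ X) : 1 ≤ A.Wt typ X := by
  have : (1:G) ∈ A.TX typ X := A.mem_TX.2 ⟨1, map_one _, by simpa using hX⟩
  rw [Arith.Wt]
  exact_mod_cast Finset.card_pos.2 ⟨_, this⟩

lemma Arith.mem_Q {x : ℝ} {q : P × ℕ} : q ∈ (A.finQ ⌊x⌋₊).toFinset ↔ (nq nm pid q : ℝ) ≤ x := by
  rw [Set.Finite.mem_toFinset, Set.mem_ofPred_eq, Nat.le_floor_iff' (by have := A.nq_ge q; omega)]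

lemma Arith.psum_le : ∃ C : ℝ, 0 < C ∧ ∀ u, 0 ≤ u → A.psum (lgq nm pid) u ≤ C * u := by
  obtain ⟨C, hC⟩ := A.cheb
  refine ⟨|C| + 1, by positivity, fun u hu => ?_⟩
  refine (hC ⌊u⌋₊ _ fun q hq => ?_).trans ?_
  · have := (Set.Finite.mem_toFinset _).1 hq; exact this
  · have h1 := Nat.floor_le hu
    have h2 := le_abs_self C
    have h3 : (0:ℝ) ≤ ⌊u⌋₊ := by positivity
    nlinarith [abs_nonneg C]

/-- bounding a sum over pairs -/
lemma Arith.pair_bound (t : P × ℕ → G) (E : Finset (G × (P × ℕ))) (Bq : P × ℕ → ℝ) (hB : ∀ q, 0 ≤ Bq q) (φ : ℝ → ℝ)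
    (hφ : Monotone φ) {X : ℝ} (hX : 0 < X)
    (h : ∀ p ∈ E, ∃ a, typ a = p.1 * (t p.2)⁻¹ ∧ (nm a : ℝ) ≤ X ∧ (nq nm pid p.2 : ℝ) ≤ φ (X / nm a)) :
    ∑ p ∈ E, Bq p.2 ≤ ∑ z ∈ A.TX typ X, A.psum Bq (φ (X / Hh nm typ z)) := by
  classical
  simp only [Arith.psum]
  rw [Finset.sum_sigma']
  set e : G × (P × ℕ) → (_ : G) × (P × ℕ) := fun p => ⟨p.1 * (t p.2)⁻¹, p.2⟩ with he
  have hinj : Function.Injective e := by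
    rintro ⟨x, q⟩ ⟨x', q'⟩ h
    simp only [he, Sigma.mk.injEq, heq_eq_eq] at h
    obtain ⟨h1, rfl⟩ := h
    rw [mul_left_injective _ h1]
  rw [← Finset.sum_image (f := fun p : (_ : G) × (P × ℕ) => Bq p.2) (g := e) hinj.injOn]
  refine Finset.sum_le_sum_of_subset_of_nonneg ?_ fun _ _ _ => hB _
  intro s hs
  obtain ⟨p, hp, rfl⟩ := Finset.mem_image.1 hs
  obtain ⟨a, h1, h2, h3⟩ := h p hp
  rw [Finset.mem_sigma, A.mem_Q]
  refine ⟨A.mem_TX.2 ⟨a, h1, h2⟩, h3.trans (hφ ?_)⟩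
  refine div_le_div_of_nonneg_left hX.le (A.H_pos _) ?_
  simp only [he, ← h1]
  exact_mod_cast Hh_le typ a

lemma Arith.dvd_pair {X : ℝ} {x : G} (hx : x ∈ A.TX typ X) {d : I} (hd : d ∣ rho nm typ x) :
    ∃ a, typ a = x * (typ d)⁻¹ ∧ (nm a : ℝ) ≤ X ∧ (nm d : ℝ) ≤ X / nm a ∧ (nm d : ℝ) ≤ X := by
  obtain ⟨a, ha⟩ := hd
  have h1 : (nm d : ℝ) * nm a ≤ X := by
    have := A.TX_H hx
    rw [Hh, ha, map_mul] at this; exact_mod_cast this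
  have h2 : (1:ℝ) ≤ nm d := by exact_mod_cast A.pos d
  have h3 : (1:ℝ) ≤ nm a := by exact_mod_cast A.pos a
  refine ⟨a, ?_, by nlinarith, by rwa [le_div_iff₀ (by linarith)], by nlinarith⟩
  rw [eq_mul_inv_iff_mul_eq, ← map_mul, mul_comm, ← ha, A.TX_rho hx]

open scoped Classical in
lemma Arith.logH {X : ℝ} {x : G} (hx : x ∈ A.TX typ X) : Real.log (Hh nm typ x) =
    ∑ q ∈ (A.finQ ⌊X⌋₊).toFinset, if qid pid q ∣ rho nm typ x then lgq nm pid q else 0 := by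
  refine (A.logid (rho nm typ x)).unique ?_
  refine hasSum_sum_of_ne_finset_zero fun q hq => if_neg fun h => hq ?_
  rw [A.mem_Q]
  exact (A.dvd_pair hx h).choose_spec.2.2.2

lemma Arith.Wlog : ∃ C : ℝ, 0 < C ∧ ∀ X, 1 ≤ X → A.Wt typ X * Real.log X ≤ C * A.Mt typ X := by
  classical
  obtain ⟨C, hC, h⟩ := A.psum_le
  refine ⟨C + 1, by positivity, fun X hX => ?_⟩
  have h1 : A.Wt typ X * Real.log X = ∑ x ∈ A.TX typ X, Real.log (Hh nm typ x) + ∑ x ∈ A.TX typ X, Real.log (X / Hh nm typ x) := by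
    rw [← Finset.sum_add_distrib, Arith.Wt, ← nsmul_eq_mul, ← Finset.sum_const]
    refine Finset.sum_congr rfl fun x _ => ?_
    rw [Real.log_div (by positivity) (A.H_pos x).ne']; ring
  have h2 : ∑ x ∈ A.TX typ X, Real.log (X / Hh nm typ x) ≤ A.Mt typ X := Finset.sum_le_sum fun x _ => by
    have := A.H_pos (typ := typ) x
    exact (Real.log_le_sub_one_of_pos (by positivity)).trans (by linarith)
  have h3 : ∑ x ∈ A.TX typ X, Real.log (Hh nm typ x) ≤ C * A.Mt typ X := by
    rw [Finset.sum_congr rfl fun x hx => A.logH hx, ← Finset.sum_product', ← Finset.sum_filter]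
    refine (A.pair_bound (typ := typ) (fun q => typ (qid pid q)) _ (lgq nm pid) (fun q => (A.lgq_pos q).le) id monotone_id (X := X) (by positivity) ?_).trans ?_
    · intro p hp
      obtain ⟨h4, h5⟩ := Finset.mem_filter.1 hp
      obtain ⟨a, e1, e2, e3, _⟩ := A.dvd_pair (Finset.mem_product.1 h4).1 h5
      exact ⟨a, e1, e2, e3⟩
    · rw [Arith.Mt, Finset.mul_sum]
      exact Finset.sum_le_sum fun z _ => h _ (div_nonneg (by linarith) (A.H_pos z).le)
  linarith

/-- the negligibility lemma -/
lemma Arith.negl (g : ℝ → ℝ) {C : ℝ} (hg : ∀ u, 1 ≤ u → |g u| ≤ C * u) (h0 : Tendsto (fun u => g u / u) atTop (𝓝 0)) :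
    Tendsto (fun X => (∑ x ∈ A.TX typ X, |g (X / Hh nm typ x)|) / A.Mt typ X) atTop (𝓝 0) := by
  obtain ⟨C1, hC1, hW⟩ := A.Wlog (typ := typ)
  have hC : 0 ≤ C := by have := (abs_nonneg _).trans (hg 1 le_rfl); linarith
  rw [Metric.tendsto_atTop]
  intro ε hε
  obtain ⟨U, hU⟩ := (Metric.tendsto_atTop.1 h0) (ε / 2) (by positivity)
  set U' := max U 1
  refine ⟨max 2 (Real.exp (4 * C * U' * C1 / ε + 1)), fun X hX => ?_⟩
  have hX2 : 2 ≤ X := (le_max_left _ _).trans hX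
  have hlog : 4 * C * U' * C1 / ε + 1 ≤ Real.log X := by
    rw [Real.le_log_iff_exp_le (by linarith)]; exact (le_max_right _ _).trans hX
  have hM : 0 < A.Mt typ X := lt_of_lt_of_le one_pos ((A.M_ge (by linarith)).trans A.W_le_M)
  have hU1 : 1 ≤ U' := le_max_right _ _
  rw [Real.dist_eq, sub_zero, abs_of_nonneg (by positivity), div_lt_iff₀ hM]
  have h1 : ∑ x ∈ A.TX typ X, |g (X / Hh nm typ x)| ≤ ∑ x ∈ A.TX typ X, (C * U' + ε / 2 * (X / Hh nm typ x)) := by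
    refine Finset.sum_le_sum fun x hx => ?_
    have hp := A.H_pos (typ := typ) x
    have hu : 1 ≤ X / Hh nm typ x := by rw [one_le_div hp]; exact A.TX_H hx
    rcases le_total (X / Hh nm typ x) U' with h | h
    · refine (hg _ hu).trans ?_
      have : C * (X / Hh nm typ x) ≤ C * U' := by gcongr
      have : 0 ≤ ε / 2 * (X / Hh nm typ x) := by positivity
      linarith
    · have := hU _ ((le_max_left _ _).trans h)
      rw [Real.dist_eq, sub_zero, abs_div, abs_of_pos (by linarith : 0 < X / Hh nm typ x), div_lt_iff₀ (by linarith)] at this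
      have : 0 ≤ C * U' := by positivity
      linarith
  rw [Finset.sum_add_distrib, Finset.sum_const, nsmul_eq_mul, ← Finset.mul_sum] at h1
  change _ ≤ A.Wt typ X * (C * U') + ε / 2 * A.Mt typ X at h1
  have h2 := hW X (by linarith)
  have h3 : A.Wt typ X * (C * U') < ε / 2 * A.Mt typ X := by
    have hW0 : 0 < A.Wt typ X := lt_of_lt_of_le one_pos (A.M_ge (by linarith))
    have h4 : A.Wt typ X * (4 * C * U' * C1 / ε + 1) ≤ C1 * A.Mt typ X := (mul_le_mul_of_nonneg_left hlog hW0.le).trans h2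
    have h5 : A.Wt typ X * (4 * C * U' * C1 / ε) < C1 * A.Mt typ X := by nlinarith
    have h6 : C1 * (A.Wt typ X * (4 * C * U' / ε)) < C1 * A.Mt typ X := by
      convert h5 using 1; ring
    have h7 := lt_of_mul_lt_mul_left h6 hC1.le
    have h8 : A.Wt typ X * (C * U') * 4 < ε * A.Mt typ X := by
      have := mul_lt_mul_of_pos_left h7 hε
      have e : ε * (A.Wt typ X * (4 * C * U' / ε)) = A.Wt typ X * (C * U') * 4 := by
        generalize A.Wt typ X = W
        field_simp
      linarith
    have : 0 ≤ A.Wt typ X * (C * U') := by positivity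
    linarith
  linarith
end F1

end

section
open Filter Topology MeasureTheory Set
section F2
variable {I P G Γ C : Type*} [CancelCommMonoid I] [CommGroup G] [Fintype Γ] [Fintype C]

open scoped Classical in
/-- data for the logarithmic-weight argument -/
structure LTr (nm : I →* ℕ) (pid : P → I) (typ : I →* G) (good : P × ℕ → Prop) (cq : P × ℕ → P × ℕ)
    (tq : Γ → P × ℕ → P × ℕ) (cl : P × ℕ → C) (dl : C → G) (kc : ℝ) : Prop where
  A : Arith nm pid
  cc : ∀ q, cq (cq q) = q
  cg : ∀ q, good q → good (cq q)
  cn : ∀ q, nq nm pid (cq q) = nq nm pid q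
  cL : ∀ q, lgq nm pid (cq q) = lgq nm pid q
  tn : ∀ τ q, nq nm pid (tq τ q) = nq nm pid q
  hdl : ∀ q, good q → typ (qid pid q) = typ (qid pid (cq q)) * dl (cl q)
  j4 : ∀ q, good q → ∀ a m, (∀ τ, ¬ qid pid (tq τ q) ∣ m) → typ a = typ m * typ (qid pid q) →
    qid pid q ∣ a ∨ qid pid (cq q) ∣ a
  k1 : 1 ≤ kc
  k2 : kc ≤ 2
  hk : ∀ q, good q → ∀ a, (qid pid q ∣ a ∨ qid pid (cq q) ∣ a) →
    (((if qid pid q ∣ a then 1 else 0) + (if qid pid (cq q) ∣ a then 1 else 0) : ℝ) = kc) ∨ ∃ τ, qid pid q * qid pid (tq τ q) ∣ a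
  pit : Tendsto (fun x => A.psum (lgq nm pid) x / x) atTop (𝓝 1)
  bad : Tendsto (fun x => A.psum (fun q => if good q then 0 else lgq nm pid q) x / x) atTop (𝓝 0)

variable {nm : I →* ℕ} {pid : P → I} {typ : I →* G} {good : P × ℕ → Prop} {cq : P × ℕ → P × ℕ}
    {tq : Γ → P × ℕ → P × ℕ} {cl : P × ℕ → C} {dl : C → G} {kc : ℝ}

omit [Fintype Γ] [Fintype C] in
lemma Arith.psum_bd (A : Arith nm pid) (g : P × ℕ → ℝ) (hg : ∀ q, |g q| ≤ lgq nm pid q) : ∃ C : ℝ, 0 < C ∧ ∀ u, 0 ≤ u → |A.psum g u| ≤ C * u := by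
  obtain ⟨C, hC, h⟩ := A.psum_le
  refine ⟨C, hC, fun u hu => le_trans ?_ (h u hu)⟩
  exact (Finset.abs_sum_le_sum_abs _ _).trans (Finset.sum_le_sum fun q _ => hg q)

variable (L : LTr nm pid typ good cq tq cl dl kc)

open scoped Classical in
/-- the pairs -/
noncomputable def LTr.QQ (L : LTr nm pid typ good cq tq cl dl kc) (X : ℝ) : Finset (G × (P × ℕ)) :=
  (L.A.TX typ X ×ˢ (L.A.finQ ⌊X⌋₊).toFinset).filter fun p => good p.2 ∧
    ∃ a, (typ a * typ (qid pid p.2) = p.1 ∨ typ a * typ (qid pid (cq p.2)) = p.1) ∧ (nm a : ℝ) * nq nm pid p.2 ≤ X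

open scoped Classical in
/-- error term -/
noncomputable def LTr.Err (L : LTr nm pid typ good cq tq cl dl kc) (X : ℝ) : ℝ :=
  2 * ∑ z ∈ L.A.TX typ X, L.A.psum (fun q => if good q then 0 else lgq nm pid q) (X / Hh nm typ z) +
    4 * Fintype.card Γ * ∑ z ∈ L.A.TX typ X, L.A.psum (lgq nm pid) (Real.sqrt (X / Hh nm typ z))

include L
omit [Fintype C] in
lemma LTr.err_o : Tendsto (fun X => L.Err X / L.A.Mt typ X) atTop (𝓝 0) := by
  classical
  obtain ⟨C1, hC1, h1⟩ := L.A.psum_bd (fun q => if good q then 0 else lgq nm pid q) (fun q => by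
    split_ifs
    · simpa using (L.A.lgq_pos q).le
    · rw [abs_of_pos (L.A.lgq_pos q)])
  obtain ⟨C2, hC2, h2⟩ := L.A.psum_bd (lgq nm pid) (fun q => by rw [abs_of_pos (L.A.lgq_pos q)])
  have t1 := L.A.negl (typ := typ) (L.A.psum (fun q => if good q then 0 else lgq nm pid q)) (C := C1)
    (fun u hu => h1 u (by linarith)) L.bad
  have t2 := L.A.negl (typ := typ) (fun u => L.A.psum (lgq nm pid) (Real.sqrt u)) (C := C2)
    (fun u hu => (h2 _ (Real.sqrt_nonneg _)).trans (by
      gcongr; rw [Real.sqrt_le_left (by linarith)]; nlinarith)) (by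
      have h0 : Tendsto (fun u : ℝ => C2 * (Real.sqrt u)⁻¹) atTop (𝓝 0) := by
        simpa using (tendsto_inv_atTop_zero.comp Real.tendsto_sqrt_atTop).const_mul C2
      refine squeeze_zero_norm' ?_ h0
      filter_upwards [eventually_gt_atTop 0] with u hu
      rw [Real.norm_eq_abs, abs_div, abs_of_pos hu, div_le_iff₀ hu]
      refine (h2 _ (Real.sqrt_nonneg _)).trans (le_of_eq ?_)
      have := Real.mul_self_sqrt hu.le
      have h3 := Real.sqrt_pos.2 hu
      field_simp; nlinarith)
  have := (t1.const_mul 2).add (t2.const_mul (4 * (Fintype.card Γ : ℝ)))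
  simp only [mul_zero, add_zero] at this
  refine this.congr fun X => ?_
  rw [LTr.Err, add_div, mul_div_assoc, mul_div_assoc]
  congr 3
  · refine (Finset.sum_congr rfl fun z _ => abs_of_nonneg ?_)
    refine Finset.sum_nonneg fun q _ => ?_
    split_ifs; exacts [le_rfl, (L.A.lgq_pos q).le]
  · refine (Finset.sum_congr rfl fun z _ => abs_of_nonneg ?_)
    exact Finset.sum_nonneg fun q _ => (L.A.lgq_pos q).le

omit [Fintype Γ] [Fintype C] in
open scoped Classical in
lemma LTr.err_mem {X : ℝ} {x : G} {q : P × ℕ} (hx : x ∈ L.A.TX typ X) (hq : q ∈ (L.A.finQ ⌊X⌋₊).toFinset) (hg : good q)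
    (hD : ((if qid pid q ∣ rho nm typ x then 1 else 0) + (if qid pid (cq q) ∣ rho nm typ x then 1 else 0) : ℝ) ≠
      if (x, q) ∈ L.QQ X then kc else 0) : ∃ (τ : Γ) (j : Bool), ∃ b,
      typ b = x * (typ (qid pid (if j then q else cq q)) * typ (qid pid (tq τ (if j then q else cq q))))⁻¹ ∧
      (nm b : ℝ) * (nq nm pid q) ^ 2 ≤ X := by
  have hH := L.A.TX_H hx
  have hty := L.A.TX_rho hx
  by_cases hdv : qid pid q ∣ rho nm typ x ∨ qid pid (cq q) ∣ rho nm typ x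
  · have hm : (x, q) ∈ L.QQ X := by
      rw [LTr.QQ, Finset.mem_filter, Finset.mem_product]
      refine ⟨⟨hx, hq⟩, hg, ?_⟩
      rcases hdv with ⟨a, ha⟩ | ⟨a, ha⟩
      · refine ⟨a, Or.inl (by rw [← map_mul, mul_comm, ← ha, hty]), ?_⟩
        rw [Hh, ha, map_mul, mul_comm] at hH; exact_mod_cast hH
      · refine ⟨a, Or.inr (by rw [← map_mul, mul_comm, ← ha, hty]), ?_⟩
        rw [Hh, ha, map_mul, mul_comm] at hH
        rw [← L.cn]; exact_mod_cast hH
    rw [if_pos hm] at hD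
    obtain ⟨τ, b, hb⟩ := (L.hk q hg _ hdv).resolve_left hD
    refine ⟨τ, true, b, ?_, ?_⟩
    · simp only [if_true]
      rw [eq_mul_inv_iff_mul_eq, ← map_mul, ← map_mul, mul_comm, ← hb, hty]
    · rw [Hh, hb, map_mul, map_mul] at hH
      have e := L.tn τ q
      rw [nq, nq] at e
      rw [e] at hH; push_cast at hH; rw [nq]; linarith
  · have hnm : (x, q) ∈ L.QQ X := by
      by_contra h
      push Not at hdv
      exact hD (by rw [if_neg hdv.1, if_neg hdv.2, if_neg h]; simp)
    obtain ⟨-, -, a, ha, hn⟩ := Finset.mem_filter.1 hnm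
    obtain ⟨j, hj⟩ : ∃ j : Bool, typ a * typ (qid pid (if j then q else cq q)) = x := by
      rcases ha with h | h
      · exact ⟨true, h⟩
      · exact ⟨false, h⟩
    set q' := if j then q else cq q with hq'
    have hg' : good q' := by rw [hq']; split_ifs; exacts [hg, L.cg q hg]
    have hn' : nq nm pid q' = nq nm pid q := by rw [hq']; split_ifs; exacts [rfl, L.cn q]
    have hdv' : ¬ (qid pid q' ∣ rho nm typ x ∨ qid pid (cq q') ∣ rho nm typ x) := by
      rw [hq']; split_ifs
      · exact hdv
      · rw [L.cc]; tauto
    have : ∃ τ, qid pid (tq τ q') ∣ rho nm typ (typ a) := by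
      by_contra h
      push Not at h
      exact hdv' (L.j4 q' hg' _ _ h (by rw [hty, rho_typ, hj]))
    obtain ⟨τ, b, hb⟩ := this
    refine ⟨τ, j, b, ?_, ?_⟩
    · rw [← hq', ← hj, ← rho_typ (nm := nm) typ a, hb, map_mul]
      rw [eq_mul_inv_iff_mul_eq]
      simp only [mul_comm, mul_left_comm]
    · have h1 : Hh nm typ (typ a) ≤ nm a := Hh_le typ a
      rw [Hh, hb, map_mul] at h1
      have e := L.tn τ q'
      rw [hn', nq] at e
      rw [e] at h1
      have h2 : (nq nm pid q : ℝ) * nm b ≤ nm a := by exact_mod_cast h1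
      refine le_trans ?_ hn
      nlinarith [(Nat.cast_nonneg (nq nm pid q) : (0:ℝ) ≤ _)]

omit [Fintype C] in
open scoped Classical in
lemma LTr.key (F : G → ℂ) (hF : ∀ x, ‖F x‖ ≤ 1) {X : ℝ} (hX : 0 < X) :
    ‖2 * ∑ x ∈ L.A.TX typ X, F x * Real.log (Hh nm typ x) - kc * ∑ p ∈ L.QQ X, F p.1 * lgq nm pid p.2‖ ≤ L.Err X := by
  set T := L.A.TX typ X
  set Q := (L.A.finQ ⌊X⌋₊).toFinset
  set d : G → P × ℕ → ℝ := fun x q => if qid pid q ∣ rho nm typ x then 1 else 0 with hd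
  set D : G × (P × ℕ) → ℝ := fun p => if good p.2 then (d p.1 p.2 + d p.1 (cq p.2) - if p ∈ L.QQ X then kc else 0) else 0 with hD
  have h1 : ∑ x ∈ T, F x * Real.log (Hh nm typ x) = ∑ x ∈ T, ∑ q ∈ Q, F x * (d x q * lgq nm pid q : ℝ) := by
    refine Finset.sum_congr rfl fun x hx => ?_
    rw [L.A.logH hx, ← Finset.mul_sum, ← Complex.ofReal_sum]
    simp only [hd, ite_mul, one_mul, zero_mul]
    rfl
  have hsplit : ∀ x, ∑ q ∈ Q, F x * (d x q * lgq nm pid q : ℝ) = ∑ q ∈ Q, F x * ((if good q then d x q * lgq nm pid q else 0 : ℝ)) +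
      ∑ q ∈ Q, F x * ((if good q then 0 else d x q * lgq nm pid q : ℝ)) := by
    intro x
    rw [← Finset.sum_add_distrib]
    refine Finset.sum_congr rfl fun q _ => ?_
    split_ifs <;> simp
  have hsym : ∀ x, ∑ q ∈ Q, F x * ((if good q then d x q * lgq nm pid q else 0 : ℝ)) =
      ∑ q ∈ Q, F x * ((if good q then d x (cq q) * lgq nm pid q else 0 : ℝ)) := by
    intro x
    refine Finset.sum_nbij' cq cq ?_ ?_ (fun q _ => L.cc q) (fun q _ => L.cc q) ?_
    · intro q hq; rw [L.A.mem_Q] at hq ⊢; rwa [L.cn]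
    · intro q hq; rw [L.A.mem_Q] at hq ⊢; rwa [L.cn]
    · intro q hq
      rw [L.cc, L.cL]
      have : good (cq q) ↔ good q := ⟨fun h => by have := L.cg _ h; rwa [L.cc] at this, L.cg q⟩
      simp only [this]
  have hQ : ∑ p ∈ L.QQ X, F p.1 * lgq nm pid p.2 = ∑ p ∈ T ×ˢ Q, if p ∈ L.QQ X then F p.1 * lgq nm pid p.2 else 0 := by
    rw [← Finset.sum_filter]
    refine Finset.sum_congr ?_ fun _ _ => rfl
    ext p
    rw [Finset.mem_filter]
    refine ⟨fun h => ⟨(Finset.mem_filter.1 h).1, h⟩, fun h => h.2⟩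
  have heq : 2 * ∑ x ∈ T, F x * Real.log (Hh nm typ x) - kc * ∑ p ∈ L.QQ X, F p.1 * lgq nm pid p.2 =
      ∑ p ∈ T ×ˢ Q, F p.1 * (D p * lgq nm pid p.2 : ℝ) + 2 * ∑ p ∈ T ×ˢ Q, F p.1 * ((if good p.2 then 0 else d p.1 p.2 * lgq nm pid p.2 : ℝ)) := by
    rw [h1, Finset.sum_congr rfl fun x _ => hsplit x, Finset.sum_add_distrib, mul_add, two_mul (∑ x ∈ T, _)]
    nth_rw 2 [Finset.sum_congr rfl fun x _ => hsym x]
    rw [hQ, Finset.mul_sum (T ×ˢ Q) _ (kc : ℂ)]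
    simp only [← Finset.sum_product']
    rw [← Finset.sum_add_distrib, add_sub_right_comm, ← Finset.sum_sub_distrib]
    congr 1
    refine Finset.sum_congr rfl fun p hp => ?_
    simp only [hD]
    by_cases hg : good p.2
    · simp only [hg, if_true]
      split_ifs <;> push_cast <;> ring
    · have : p ∉ L.QQ X := fun h => hg (Finset.mem_filter.1 h).2.1
      simp [hg, this]
  have hDb : ∀ p, |D p| ≤ 2 := by
    intro p
    have := L.k1
    have := L.k2
    simp only [hD, hd]
    split_ifs <;> norm_num <;> rw [abs_le] <;> constructor <;> linarith
  have hA : ‖∑ p ∈ T ×ˢ Q, F p.1 * ((if good p.2 then 0 else d p.1 p.2 * lgq nm pid p.2 : ℝ))‖ ≤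
      ∑ z ∈ T, L.A.psum (fun q => if good q then 0 else lgq nm pid q) (X / Hh nm typ z) := by
    refine le_trans ?_ (L.A.pair_bound (typ := typ) (fun q => typ (qid pid q)) ((T ×ˢ Q).filter fun p => qid pid p.2 ∣ rho nm typ p.1)
      (fun q => if good q then 0 else lgq nm pid q) (fun q => by split_ifs; exacts [le_rfl, (L.A.lgq_pos q).le]) id monotone_id hX ?_)
    · rw [Finset.sum_filter]
      refine norm_sum_le_of_le _ fun p _ => ?_
      rw [norm_mul, Complex.norm_real, Real.norm_eq_abs]
      refine (mul_le_of_le_one_left (abs_nonneg _) (hF _)).trans (le_of_eq ?_)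
      simp only [hd]
      split_ifs <;> simp [(L.A.lgq_pos p.2).le]
    · intro p hp
      obtain ⟨h4, h5⟩ := Finset.mem_filter.1 hp
      obtain ⟨a, e1, e2, e3, _⟩ := L.A.dvd_pair (Finset.mem_product.1 h4).1 h5
      exact ⟨a, e1, e2, e3⟩
  set R : Γ → Bool → G × (P × ℕ) → Prop := fun τ j p => ∃ b,
      typ b = p.1 * (typ (qid pid (if j then p.2 else cq p.2)) * typ (qid pid (tq τ (if j then p.2 else cq p.2))))⁻¹ ∧
      (nm b : ℝ) * (nq nm pid p.2) ^ 2 ≤ X with hR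
  have hB : ‖∑ p ∈ T ×ˢ Q, F p.1 * (D p * lgq nm pid p.2 : ℝ)‖ ≤
      ∑ τ : Γ, ∑ j : Bool, 2 * ∑ p ∈ (T ×ˢ Q).filter (R τ j), lgq nm pid p.2 := by
    simp only [Finset.sum_filter, Finset.mul_sum]
    rw [← Finset.sum_product', Finset.sum_comm]
    refine norm_sum_le_of_le _ fun p hp => ?_
    rw [norm_mul, Complex.norm_real, Real.norm_eq_abs]
    refine (mul_le_of_le_one_left (abs_nonneg _) (hF _)).trans ?_
    rw [abs_mul, abs_of_pos (L.A.lgq_pos p.2)]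
    have hl := L.A.lgq_pos p.2
    have hnn : ∀ y ∈ (Finset.univ ×ˢ Finset.univ : Finset (Γ × Bool)), 0 ≤ 2 * (if R y.1 y.2 p then lgq nm pid p.2 else 0) := by
      intro y _; split_ifs <;> positivity
    by_cases h0 : D p = 0
    · rw [h0, abs_zero, zero_mul]; exact Finset.sum_nonneg hnn
    · have hg : good p.2 := by by_contra h; exact h0 (by simp [hD, h])
      simp only [hD, hg, if_true, sub_ne_zero] at h0
      obtain ⟨τ, j, hh⟩ := L.err_mem (Finset.mem_product.1 hp).1 (Finset.mem_product.1 hp).2 hg h0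
      refine le_trans ?_ (Finset.single_le_sum hnn (a := (τ, j)) (by simp))
      rw [if_pos (by exact hh)]
      exact mul_le_mul_of_nonneg_right (hDb p) hl.le
  have hB2 : ∀ (τ : Γ) (j : Bool), ∑ p ∈ (T ×ˢ Q).filter (R τ j), lgq nm pid p.2 ≤ ∑ z ∈ T, L.A.psum (lgq nm pid) (Real.sqrt (X / Hh nm typ z)) := by
    intro τ j
    refine L.A.pair_bound (typ := typ) (fun q => typ (qid pid (if j then q else cq q)) * typ (qid pid (tq τ (if j then q else cq q))))
      _ (lgq nm pid) (fun q => (L.A.lgq_pos q).le) Real.sqrt (fun a b h => Real.sqrt_le_sqrt h) hX ?_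
    intro p hp
    obtain ⟨-, b, hb, hb2⟩ := Finset.mem_filter.1 hp
    have hb1 : (1:ℝ) ≤ nm b := by exact_mod_cast L.A.pos b
    have hq1 : (1:ℝ) ≤ nq nm pid p.2 := by exact_mod_cast (L.A.nq_ge p.2).trans' one_le_two
    refine ⟨b, hb, ?_, ?_⟩
    · nlinarith [one_le_pow₀ hq1 (n := 2)]
    · refine Real.le_sqrt_of_sq_le ?_
      rw [le_div_iff₀ (by linarith)]; linarith
  rw [heq, LTr.Err]
  refine (norm_add_le _ _).trans ?_
  rw [norm_mul, Complex.norm_two, add_comm]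
  refine add_le_add (by gcongr) (hB.trans ?_)
  refine (Finset.sum_le_sum fun τ _ => Finset.sum_le_sum fun j _ => mul_le_mul_of_nonneg_left (hB2 τ j) two_pos.le).trans (le_of_eq ?_)
  simp
  ring
end F2


end

section
open Filter Topology MeasureTheory Set
section F3
variable {I P G Γ C : Type*} [CancelCommMonoid I] [CommGroup G] [Fintype Γ] [Fintype C]
variable {nm : I →* ℕ} {pid : P → I} {typ : I →* G} {good : P × ℕ → Prop} {cq : P × ℕ → P × ℕ}
    {tq : Γ → P × ℕ → P × ℕ} {cl : P × ℕ → C} {dl : C → G} {kc : ℝ}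
variable (L : LTr nm pid typ good cq tq cl dl kc)
include L

omit [Fintype C] in
lemma LTr.M_pos {X : ℝ} (hX : 1 ≤ X) : 0 < L.A.Mt typ X := lt_of_lt_of_le one_pos ((L.A.M_ge hX).trans L.A.W_le_M)

omit [Fintype C] in
lemma LTr.lower : ∀ᶠ X in atTop, L.A.Mt typ X ≤ 4 * (L.A.Wt typ X * Real.log X) := by
  classical
  set bd : P × ℕ → ℝ := fun q => if good q then 0 else lgq nm pid q
  set gd : P × ℕ → ℝ := fun q => if good q then lgq nm pid q else 0
  have hgd : ∀ u, L.A.psum gd u = L.A.psum (lgq nm pid) u - L.A.psum bd u := by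
    intro u
    rw [Arith.psum, Arith.psum, Arith.psum, ← Finset.sum_sub_distrib]
    refine Finset.sum_congr rfl fun q _ => ?_
    simp only [gd, bd]; split_ifs <;> simp
  obtain ⟨C1, hC1, h1⟩ := L.A.psum_bd gd (fun q => by
    simp only [gd]; split_ifs
    · rw [abs_of_pos (L.A.lgq_pos q)]
    · simpa using (L.A.lgq_pos q).le)
  have t1 := L.A.negl (typ := typ) (fun u => L.A.psum gd u - u) (C := C1 + 1)
    (fun u hu => by
      have := h1 u (by linarith)
      refine (abs_sub _ _).trans ?_
      rw [abs_of_nonneg (by linarith : 0 ≤ u)]; linarith) (by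
      have := (L.pit.sub L.bad).sub (tendsto_const_nhds (x := (1:ℝ)))
      simp only [sub_zero, sub_self] at this
      refine this.congr' ?_
      filter_upwards [eventually_gt_atTop 0] with u hu
      rw [hgd]; simp only [bd]; field_simp)
  have t2 := t1.add L.err_o
  rw [add_zero] at t2
  filter_upwards [t2.eventually_lt_const (show (0:ℝ) < 1/2 by norm_num), eventually_ge_atTop 1] with X h2 hX
  have hM := L.M_pos hX
  rw [← add_div, div_lt_iff₀ hM] at h2
  have hk := L.key (fun _ => 1) (by simp) (X := X) (by linarith)
  simp only [one_mul] at hk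
  have hk' : kc * ∑ p ∈ L.QQ X, lgq nm pid p.2 - 2 * ∑ x ∈ L.A.TX typ X, Real.log (Hh nm typ x) ≤ L.Err X := by
    refine le_trans ?_ hk
    rw [norm_sub_rev]
    refine le_trans (le_abs_self _) (le_of_eq ?_)
    rw [← Real.norm_eq_abs, ← Complex.norm_real]; push_cast; rfl
  have hQ0 : 0 ≤ ∑ p ∈ L.QQ X, lgq nm pid p.2 := Finset.sum_nonneg fun p _ => (L.A.lgq_pos _).le
  have hQ1 : ∑ p ∈ L.QQ X, lgq nm pid p.2 ≤ kc * ∑ p ∈ L.QQ X, lgq nm pid p.2 := le_mul_of_one_le_left hQ0 L.k1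
  have hQ2 : ∑ y ∈ L.A.TX typ X, L.A.psum gd (X / Hh nm typ y) ≤ ∑ p ∈ L.QQ X, lgq nm pid p.2 := by
    simp only [Arith.psum]
    simp only [gd, ← Finset.sum_filter]
    rw [Finset.sum_sigma']
    set e : (_ : G) × (P × ℕ) → G × (P × ℕ) := fun s => (s.1 * typ (qid pid s.2), s.2) with he
    have hinj : Function.Injective e := by
      rintro ⟨x, q⟩ ⟨x', q'⟩ h
      simp only [he, Prod.mk.injEq] at h
      obtain ⟨h1, rfl⟩ := h
      rw [mul_left_injective _ h1]
    rw [← Finset.sum_image (f := fun p : G × (P × ℕ) => lgq nm pid p.2) (g := e) hinj.injOn]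
    refine Finset.sum_le_sum_of_subset_of_nonneg ?_ fun p _ _ => (L.A.lgq_pos p.2).le
    intro s hs
    obtain ⟨⟨y, q⟩, hp, rfl⟩ := Finset.mem_image.1 hs
    obtain ⟨hy, hq⟩ := Finset.mem_sigma.1 hp
    obtain ⟨hq, hg⟩ := Finset.mem_filter.1 hq
    simp only at hy hg hq
    have hH := L.A.H_pos (typ := typ) y
    have hH1 : (1:ℝ) ≤ Hh nm typ y := by exact_mod_cast L.A.pos _
    rw [L.A.mem_Q, le_div_iff₀ hH] at hq
    have hr := L.A.TX_rho hy
    rw [LTr.QQ, Finset.mem_filter, Finset.mem_product, L.A.mem_Q, L.A.mem_TX]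
    refine ⟨⟨⟨rho nm typ y * qid pid q, by rw [map_mul, hr], ?_⟩, ?_⟩, hg, rho nm typ y, Or.inl (by rw [hr]), ?_⟩
    · rw [map_mul, mul_comm]; push_cast; exact hq
    · refine le_trans ?_ hq
      exact le_mul_of_one_le_right (by positivity) hH1
    · rw [mul_comm]; exact hq
  have hQ3 : L.A.Mt typ X - ∑ y ∈ L.A.TX typ X, |L.A.psum gd (X / Hh nm typ y) - X / Hh nm typ y| ≤ ∑ y ∈ L.A.TX typ X, L.A.psum gd (X / Hh nm typ y) := by
    rw [Arith.Mt, ← Finset.sum_sub_distrib]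
    refine Finset.sum_le_sum fun y _ => ?_
    have := neg_abs_le (L.A.psum gd (X / Hh nm typ y) - X / Hh nm typ y)
    linarith
  have hlog : ∑ x ∈ L.A.TX typ X, Real.log (Hh nm typ x) ≤ L.A.Wt typ X * Real.log X := by
    rw [Arith.Wt, ← nsmul_eq_mul]
    exact Finset.sum_le_card_nsmul _ _ _ fun x hx => Real.log_le_log (L.A.H_pos x) (L.A.TX_H hx)
  linarith

omit [Fintype C] in
lemma LTr.doub {c0 : ℝ} (hc : 1 ≤ c0) : ∃ c' : ℝ, 0 < c' ∧ ∀ᶠ X in atTop, L.A.Wt typ X ≤ c' * L.A.Wt typ (X / c0) := by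
  classical
  obtain ⟨C1, hC1, hW⟩ := L.A.Wlog (typ := typ)
  refine ⟨8 * C1 * c0, by positivity, ?_⟩
  have hdiv : Tendsto (fun X : ℝ => X / c0) atTop atTop := tendsto_id.atTop_div_const (by linarith)
  filter_upwards [hdiv.eventually L.lower, hdiv.eventually_ge_atTop 1, eventually_ge_atTop 2,
    Real.tendsto_log_atTop.eventually_ge_atTop (2 * C1 * c0)] with X h1 h2 hX hlog
  have hX0 : 0 < X := by linarith
  have hlp : 0 < Real.log X := Real.log_pos (by linarith)
  have hXc : X / c0 ≤ X := div_le_self hX0.le hc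
  have h3 := hW X (by linarith)
  have hsub : L.A.TX typ (X / c0) ⊆ L.A.TX typ X := fun x hx => by
    obtain ⟨a, e, ha⟩ := L.A.mem_TX.1 hx
    exact L.A.mem_TX.2 ⟨a, e, ha.trans hXc⟩
  have h4 : L.A.Mt typ X ≤ c0 * L.A.Mt typ (X / c0) + c0 * L.A.Wt typ X := by
    rw [Arith.Mt, ← Finset.sum_sdiff hsub, add_comm]
    refine add_le_add (le_of_eq ?_) ?_
    · rw [Arith.Mt, Finset.mul_sum]
      refine Finset.sum_congr rfl fun x _ => ?_
      field_simp
    · have : ∑ x ∈ L.A.TX typ X \ L.A.TX typ (X / c0), X / (Hh nm typ x : ℝ) ≤ ∑ x ∈ L.A.TX typ X \ L.A.TX typ (X / c0), c0 := by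
        refine Finset.sum_le_sum fun x hx => ?_
        obtain ⟨e1, e2⟩ := Finset.mem_sdiff.1 hx
        rw [div_le_iff₀ (L.A.H_pos x), ← div_le_iff₀' (by linarith)]
        by_contra h
        push Not at h
        refine e2 ?_
        have := L.A.TX_of (typ := typ) (X / c0) (rho nm typ x)
        rw [L.A.TX_rho e1] at this
        exact this h.le
      refine this.trans ?_
      rw [Finset.sum_const, nsmul_eq_mul, mul_comm]
      refine mul_le_mul_of_nonneg_left ?_ (by linarith)
      rw [Arith.Wt]
      exact_mod_cast Finset.card_le_card Finset.sdiff_subset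
  have h5 : 2 * (c0 * L.A.Wt typ X) ≤ L.A.Mt typ X := by
    have hW0 : 0 ≤ L.A.Wt typ X := Nat.cast_nonneg _
    have : L.A.Wt typ X * (2 * C1 * c0) ≤ C1 * L.A.Mt typ X := (mul_le_mul_of_nonneg_left hlog hW0).trans h3
    refine le_of_mul_le_mul_left (a := C1) ?_ hC1
    linarith
  have h6 : Real.log (X / c0) ≤ Real.log X := Real.log_le_log (by linarith) hXc
  have hW1 : 0 ≤ L.A.Wt typ (X / c0) := Nat.cast_nonneg _
  have h7 : L.A.Mt typ (X / c0) ≤ 4 * (L.A.Wt typ (X / c0) * Real.log X) := h1.trans (by gcongr)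
  refine le_of_mul_le_mul_right (a := Real.log X) ?_ hlp
  calc _ ≤ C1 * L.A.Mt typ X := h3
    _ ≤ C1 * (2 * c0 * L.A.Mt typ (X / c0)) := by gcongr; linarith
    _ ≤ C1 * (2 * c0 * (4 * (L.A.Wt typ (X / c0) * Real.log X))) := by gcongr
    _ = _ := by ring

open scoped Classical in
lemma LTr.qsum (F : G →* ℂ) (hF : ∀ x, ‖F x‖ = 1)
    (hΘ : ∀ c, Tendsto (fun x : ℝ => L.A.psum (fun q => if good q ∧ cl q = c then lgq nm pid q * F (typ (qid pid q)) else 0) x / x) atTop (𝓝 0)) :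
    Tendsto (fun X => ‖∑ p ∈ L.QQ X, F p.1 * lgq nm pid p.2‖ / L.A.Mt typ X) atTop (𝓝 0) := by
  set Θ : C → ℝ → ℂ := fun c x => L.A.psum (fun q => if good q ∧ cl q = c then lgq nm pid q * F (typ (qid pid q)) else 0) x with hΘd
  have hb : ∃ C1 : ℝ, 0 < C1 ∧ ∀ u, 0 ≤ u → ∀ c, ‖Θ c u‖ ≤ C1 * u := by
    obtain ⟨C, hC, h⟩ := L.A.psum_le
    refine ⟨C, hC, fun u hu c => le_trans ?_ (h u hu)⟩
    refine norm_sum_le_of_le _ fun q _ => ?_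
    split_ifs
    · rw [norm_mul, hF, mul_one, Complex.norm_real, Real.norm_eq_abs, abs_of_pos (L.A.lgq_pos q)]
    · simpa using (L.A.lgq_pos q).le
  obtain ⟨C1, hC1, hb⟩ := hb
  have hn : ∀ c, Tendsto (fun X => (∑ x ∈ L.A.TX typ X, |‖Θ c (X / Hh nm typ x)‖|) / L.A.Mt typ X) atTop (𝓝 0) := by
    intro c
    refine L.A.negl (typ := typ) (fun u => ‖Θ c u‖) (C := C1) (fun u hu => by rw [abs_norm]; exact hb u (by linarith) c) ?_
    have := (hΘ c).norm
    rw [norm_zero] at this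
    refine this.congr' ?_
    filter_upwards [eventually_gt_atTop 0] with u hu
    rw [norm_div, Complex.norm_real, Real.norm_eq_abs, abs_of_pos hu]
  have hsum := (tendsto_finsetSum Finset.univ fun c _ => hn c).const_mul 2
  simp only [Finset.sum_const_zero, mul_zero] at hsum
  refine squeeze_zero' ?_ ?_ hsum
  · filter_upwards [eventually_ge_atTop 1] with X hX
    have := L.M_pos hX
    positivity
  filter_upwards [eventually_ge_atTop 1] with X hX
  have hM := L.M_pos hX
  rw [← Finset.sum_div, ← mul_div_assoc]
  refine div_le_div_of_nonneg_right ?_ hM.le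
  simp only [abs_norm]
  have hX0 : 0 < X := by linarith
  set T := L.A.TX typ X
  set h : G → ℝ := fun y => if y ∈ T then X / Hh nm typ y else 0 with hh
  have hh0 : ∀ y, 0 ≤ h y := fun y => by simp only [hh]; split_ifs <;> positivity
  have hhT : ∀ (y : G) (q : P × ℕ), (nq nm pid q : ℝ) ≤ h y ↔ ∃ a, typ a = y ∧ (nm a : ℝ) * nq nm pid q ≤ X := by
    intro y q
    have hq : (2:ℝ) ≤ nq nm pid q := by exact_mod_cast L.A.nq_ge q
    constructor
    · intro hy
      have hyT : y ∈ T := by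
        by_contra hc; simp only [hh, if_neg hc] at hy; linarith
      simp only [hh, if_pos hyT] at hy
      rw [le_div_iff₀ (L.A.H_pos y)] at hy
      exact ⟨rho nm typ y, L.A.TX_rho hyT, by rw [mul_comm]; exact hy⟩
    · rintro ⟨a, rfl, ha⟩
      have ha1 : (1:ℝ) ≤ nm a := by exact_mod_cast L.A.pos a
      have hyT : typ a ∈ T := L.A.mem_TX.2 ⟨a, rfl, by nlinarith⟩
      simp only [hh, if_pos hyT]
      rw [le_div_iff₀ (L.A.H_pos _)]
      have h1 : Hh nm typ (typ a) ≤ nm a := Hh_le typ a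
      have h1 : (Hh nm typ (typ a) : ℝ) ≤ nm a := by exact_mod_cast h1
      nlinarith
  have hΘ0 : ∀ c, Θ c 0 = 0 := by
    intro c
    refine Finset.sum_eq_zero fun q hq => ?_
    rw [L.A.mem_Q] at hq
    have : (2:ℝ) ≤ nq nm pid q := by exact_mod_cast L.A.nq_ge q
    linarith
  have hone : ∀ c, ‖∑ p ∈ (L.QQ X).filter (fun p => cl p.2 = c), F p.1 * lgq nm pid p.2‖ ≤ 2 * ∑ x ∈ T, ‖Θ c (X / Hh nm typ x)‖ := by
    intro c
    set Y : Finset G := T ∪ T.image (fun z => z * (dl c)⁻¹) with hY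
    have e1 : ∑ p ∈ (L.QQ X).filter (fun p => cl p.2 = c), F p.1 * lgq nm pid p.2 = ∑ y ∈ Y, F y * Θ c (max (h y) (h (y * dl c))) := by
      simp only [hΘd, Arith.psum, Finset.mul_sum]
      simp only [mul_ite, mul_zero, ← Finset.sum_filter]
      rw [Finset.sum_sigma']
      refine Finset.sum_nbij' (fun p => ⟨p.1 * (typ (qid pid p.2))⁻¹, p.2⟩) (fun s => (s.1 * typ (qid pid s.2), s.2)) ?_ ?_ ?_ ?_ ?_
      · rintro ⟨x, q⟩ hp
        obtain ⟨hp, hc⟩ := Finset.mem_filter.1 hp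
        obtain ⟨-, hg, a, ha, hn⟩ := Finset.mem_filter.1 hp
        simp only at hc hg ha hn
        have hq : (2:ℝ) ≤ nq nm pid q := by exact_mod_cast L.A.nq_ge q
        have haT : typ a ∈ T := L.A.mem_TX.2 ⟨a, rfl, by nlinarith [(Nat.cast_nonneg (nm a) : (0:ℝ) ≤ _)]⟩
        rw [Finset.mem_sigma, Finset.mem_filter, L.A.mem_Q, le_max_iff, hhT, hhT]
        simp only
        rcases ha with ha | ha
        · have hy : x * (typ (qid pid q))⁻¹ = typ a := by rw [← ha]; group
          rw [hy]
          exact ⟨Finset.mem_union_left _ haT, Or.inl ⟨a, rfl, hn⟩, hg, hc⟩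
        · have hy : x * (typ (qid pid q))⁻¹ * dl c = typ a := by
            rw [L.hdl q hg, hc, ← ha, mul_right_comm, mul_inv_eq_iff_eq_mul, mul_assoc]
          refine ⟨Finset.mem_union_right _ (Finset.mem_image.2 ⟨typ a, haT, by rw [← hy]; group⟩), Or.inr ⟨a, hy.symm, hn⟩, hg, hc⟩
      · rintro ⟨y, q⟩ hs
        rw [Finset.mem_sigma, Finset.mem_filter, L.A.mem_Q, le_max_iff, hhT, hhT] at hs
        obtain ⟨-, hs, hg, hc⟩ := hs
        simp only at hs hg hc
        rw [Finset.mem_filter, LTr.QQ, Finset.mem_filter, Finset.mem_product, L.A.mem_Q, L.A.mem_TX]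
        have : ∃ a, (typ a * typ (qid pid q) = y * typ (qid pid q) ∨ typ a * typ (qid pid (cq q)) = y * typ (qid pid q)) ∧ (nm a : ℝ) * nq nm pid q ≤ X := by
          rcases hs with ⟨a, e, ha⟩ | ⟨a, e, ha⟩
          · exact ⟨a, Or.inl (by rw [e]), ha⟩
          · refine ⟨a, Or.inr ?_, ha⟩
            rw [e, L.hdl q hg, hc, mul_assoc, mul_comm (dl c)]
        refine ⟨⟨⟨?_, ?_⟩, hg, this⟩, hc⟩
        · obtain ⟨a, e | e, ha⟩ := this
          · exact ⟨a * qid pid q, by rw [map_mul, e], by rw [map_mul]; push_cast; exact ha⟩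
          · refine ⟨a * qid pid (cq q), by rw [map_mul, e], ?_⟩
            rw [← L.cn] at ha; rw [map_mul]; push_cast; exact ha
        · obtain ⟨a, -, ha⟩ := this
          have ha1 : (1:ℝ) ≤ nm a := by exact_mod_cast L.A.pos a
          simp only
          nlinarith [(Nat.cast_nonneg (nq nm pid q) : (0:ℝ) ≤ _)]
      · rintro ⟨x, q⟩ _; simp
      · rintro ⟨x, q⟩ _; simp
      · rintro ⟨x, q⟩ _
        simp only
        rw [mul_left_comm, ← map_mul, mul_comm]; congr 2; group
    rw [e1]
    have e2 : ∀ y ∈ Y, ‖F y * Θ c (max (h y) (h (y * dl c)))‖ ≤ ‖Θ c (h y)‖ + ‖Θ c (h (y * dl c))‖ := by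
      intro y _
      rw [norm_mul, hF, one_mul]
      rcases max_choice (h y) (h (y * dl c)) with e | e <;> rw [e] <;> simp
    refine (norm_sum_le_of_le _ e2).trans ?_
    rw [Finset.sum_add_distrib, two_mul]
    have e3 : ∀ Z : Finset G, ∑ z ∈ Z, ‖Θ c (h z)‖ ≤ ∑ x ∈ T, ‖Θ c (X / Hh nm typ x)‖ := by
      intro Z
      have : ∀ z, ‖Θ c (h z)‖ = if z ∈ T then ‖Θ c (X / Hh nm typ z)‖ else 0 := by
        intro z; simp only [hh]; split_ifs <;> simp [hΘ0]
      simp only [this]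
      rw [← Finset.sum_filter]
      refine Finset.sum_le_sum_of_subset_of_nonneg (fun z hz => (Finset.mem_filter.1 hz).2) fun _ _ _ => norm_nonneg _
    refine add_le_add (e3 Y) ?_
    rw [← Finset.sum_image (f := fun z => ‖Θ c (h z)‖) (g := fun y => y * dl c) (mul_left_injective _).injOn]
    exact e3 _
  rw [← Finset.sum_fiberwise (L.QQ X) (fun p => cl p.2), Finset.mul_sum]
  exact norm_sum_le_of_le _ fun c _ => hone c

open scoped Classical in
lemma LTr.main (F : G →* ℂ) (hF : ∀ x, ‖F x‖ = 1)
    (hΘ : ∀ c, Tendsto (fun x : ℝ => L.A.psum (fun q => if good q ∧ cl q = c then lgq nm pid q * F (typ (qid pid q)) else 0) x / x) atTop (𝓝 0)) :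
    Tendsto (fun X => (∑ x ∈ L.A.TX typ X, F x) / (L.A.Wt typ X : ℂ)) atTop (𝓝 0) := by
  have h1 := L.qsum F hF hΘ
  have h2 := L.A.negl (typ := typ) Real.log (C := 1) (fun u hu => by
    rw [abs_of_nonneg (Real.log_nonneg hu), one_mul]
    exact (Real.log_le_sub_one_of_pos (by linarith)).trans (by linarith)) (Real.isLittleO_log_id_atTop.tendsto_div_nhds_zero)
  have h3 := (((h1.const_mul 2).add L.err_o).add (h2.const_mul 2)).const_mul 2
  simp only [mul_zero, add_zero] at h3
  refine squeeze_zero_norm' ?_ h3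
  filter_upwards [L.lower, eventually_ge_atTop 2] with X hl hX
  have hM := L.M_pos (by linarith : 1 ≤ X)
  have hlp : 0 < Real.log X := Real.log_pos (by linarith)
  have hWp : 0 < L.A.Wt typ X := lt_of_lt_of_le one_pos (L.A.M_ge (by linarith))
  rw [norm_div, Complex.norm_real, Real.norm_eq_abs, abs_of_pos hWp, ← mul_div_assoc, ← mul_div_assoc, ← add_div, ← add_div,
    ← mul_div_assoc]
  have hk := L.key F (fun x => (hF x).le) (X := X) (by linarith)
  have e1 : (∑ x ∈ L.A.TX typ X, F x) * Real.log X = ∑ x ∈ L.A.TX typ X, F x * Real.log (Hh nm typ x) + ∑ x ∈ L.A.TX typ X, F x * Real.log (X / Hh nm typ x) := by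
    rw [← Finset.sum_add_distrib, Finset.sum_mul]
    refine Finset.sum_congr rfl fun x _ => ?_
    rw [Real.log_div (by linarith) (L.A.H_pos x).ne']; push_cast; ring
  have e2 : ‖∑ x ∈ L.A.TX typ X, F x * Real.log (X / Hh nm typ x)‖ ≤ ∑ x ∈ L.A.TX typ X, |Real.log (X / Hh nm typ x)| :=
    norm_sum_le_of_le _ fun x _ => by rw [norm_mul, hF, one_mul, Complex.norm_real, Real.norm_eq_abs]
  set S := ∑ x ∈ L.A.TX typ X, F x
  set S1 := ∑ x ∈ L.A.TX typ X, F x * Real.log (Hh nm typ x)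
  set S2 := ∑ x ∈ L.A.TX typ X, F x * Real.log (X / Hh nm typ x)
  set S3 := ∑ p ∈ L.QQ X, F p.1 * lgq nm pid p.2
  set S4 := ∑ x ∈ L.A.TX typ X, |Real.log (X / Hh nm typ x)|
  have e3 : 2 * (‖S‖ * Real.log X) ≤ 2 * ‖S3‖ + L.Err X + 2 * S4 := by
    have : 2 * (‖S‖ * Real.log X) = ‖(2 * S1 - kc * S3) + kc * S3 + 2 * S2‖ := by
      rw [show (2 * S1 - kc * S3) + kc * S3 + 2 * S2 = 2 * (S1 + S2) by ring, ← e1, norm_mul, norm_mul, Complex.norm_two,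
        Complex.norm_real, Real.norm_eq_abs, abs_of_pos hlp]
    rw [this]
    refine (norm_add_le _ _).trans ?_
    refine (add_le_add_left (norm_add_le _ _) _).trans ?_
    rw [norm_mul, norm_mul, Complex.norm_two, Complex.norm_real, Real.norm_eq_abs, abs_of_nonneg (by linarith [L.k1])]
    have := mul_le_mul_of_nonneg_right L.k2 (norm_nonneg S3)
    linarith
  rw [div_le_div_iff₀ hWp hM]
  calc ‖S‖ * L.A.Mt typ X ≤ ‖S‖ * (4 * (L.A.Wt typ X * Real.log X)) := by gcongr
    _ = 2 * (2 * (‖S‖ * Real.log X)) * L.A.Wt typ X := by ring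
    _ ≤ _ := by gcongr
end F3

end

section
open Filter Topology MeasureTheory Set
open NumberField nonZeroDivisors IsDedekindDomain
open scoped Pointwise
section B4
variable {K : Type*} [Field K] [NumberField K]

lemma smul_coe (τ : K ≃ₐ[ℚ] K) (x : 𝓞 K) : ((τ • x : 𝓞 K) : K) = τ x := rfl

lemma smul_span (τ : K ≃ₐ[ℚ] K) (x : 𝓞 K) : τ • Ideal.span {x} = Ideal.span {τ • x} := by
  rw [Ideal.smul_closure, Set.smul_set_singleton]

/-- Galois action on ideals -/
noncomputable def gI (τ : K ≃ₐ[ℚ] K) : ID K →* ID K where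
  toFun a := ⟨τ • (a : Ideal (𝓞 K)), mem_nonZeroDivisors_of_ne_zero (by
    rw [Ne, Ideal.zero_eq_bot, smul_eq_iff_eq_inv_smul, Ideal.smul_bot]; exact nonZeroDivisors.coe_ne_zero a)⟩
  map_one' := Subtype.ext (smul_one τ)
  map_mul' a b := Subtype.ext (smul_mul' τ (a : Ideal (𝓞 K)) b)

lemma gI_coe (τ : K ≃ₐ[ℚ] K) (a : ID K) : (gI τ a : Ideal (𝓞 K)) = τ • (a : Ideal (𝓞 K)) := rfl
lemma gI_gI (τ ρ : K ≃ₐ[ℚ] K) (a : ID K) : gI τ (gI ρ a) = gI (τ * ρ) a := Subtype.ext (mul_smul τ ρ _).symm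
lemma gI_one (a : ID K) : gI 1 a = a := Subtype.ext (one_smul _ _)

lemma gI_dvd (τ : K ≃ₐ[ℚ] K) {a b : ID K} : gI τ a ∣ gI τ b ↔ a ∣ b := by
  refine ⟨fun h => ?_, fun h => map_dvd (gI τ) h⟩
  have := map_dvd (gI τ⁻¹) h
  rwa [gI_gI, gI_gI, inv_mul_cancel, gI_one, gI_one] at this

lemma gI_nm (τ : K ≃ₐ[ℚ] K) (a : ID K) : nmK K (gI τ a) = nmK K a := by
  rw [nmK_apply, nmK_apply, Ideal.absNorm_apply, Ideal.absNorm_apply, Submodule.cardQuot_apply, Submodule.cardQuot_apply]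
  refine (Nat.card_congr (Ideal.quotientEquiv (a : Ideal (𝓞 K)) (gI τ a : Ideal (𝓞 K)) (MulSemiringAction.toRingEquiv _ (𝓞 K) τ) ?_).toEquiv).symm
  rw [gI_coe, Ideal.pointwise_smul_def]; rfl

/-- Galois action on primes -/
noncomputable def gV (τ : K ≃ₐ[ℚ] K) (v : HeightOneSpectrum (𝓞 K)) : HeightOneSpectrum (𝓞 K) :=
  ⟨τ • v.asIdeal, Ideal.IsPrime.smul (H := v.isPrime) τ, nonZeroDivisors.coe_ne_zero (gI τ (pidK K v))⟩

lemma pid_gV (τ : K ≃ₐ[ℚ] K) (v : HeightOneSpectrum (𝓞 K)) : pidK K (gV τ v) = gI τ (pidK K v) := rfl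
lemma gV_gV (τ ρ : K ≃ₐ[ℚ] K) (v : HeightOneSpectrum (𝓞 K)) : gV τ (gV ρ v) = gV (τ * ρ) v :=
  HeightOneSpectrum.ext (mul_smul τ ρ _).symm
lemma gV_one (v : HeightOneSpectrum (𝓞 K)) : gV 1 v = v := HeightOneSpectrum.ext (one_smul _ _)

/-- Galois action on prime powers -/
noncomputable def gQ (τ : K ≃ₐ[ℚ] K) (q : HeightOneSpectrum (𝓞 K) × ℕ) : HeightOneSpectrum (𝓞 K) × ℕ := (gV τ q.1, q.2)

lemma qid_gQ (τ : K ≃ₐ[ℚ] K) (q) : qid (pidK K) (gQ τ q) = gI τ (qid (pidK K) q) := by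
  simp only [qid, gQ, pid_gV, map_pow]
lemma nq_gQ (τ : K ≃ₐ[ℚ] K) (q) : nq (nmK K) (pidK K) (gQ τ q) = nq (nmK K) (pidK K) q := by
  rw [nq, qid_gQ, gI_nm, nq]
lemma lgq_gQ (τ : K ≃ₐ[ℚ] K) (q) : lgq (nmK K) (pidK K) (gQ τ q) = lgq (nmK K) (pidK K) q := by
  rw [lgq, gQ, pid_gV, gI_nm, lgq]

/-- good primes -/
def goodQ (q : HeightOneSpectrum (𝓞 K) × ℕ) : Prop := q.2 = 0 ∧ ∀ τ : K ≃ₐ[ℚ] K, gV τ q.1 = q.1 → τ = 1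

lemma stab_mem {v : HeightOneSpectrum (𝓞 K)} (hp : (nmK K (pidK K v)).Prime) {τ : K ≃ₐ[ℚ] K} (h : gV τ v = v) (x : 𝓞 K) :
    τ • x - x ∈ v.asIdeal := by
  have hv : τ • v.asIdeal = v.asIdeal := congrArg HeightOneSpectrum.asIdeal h
  have hcard : Nat.card (𝓞 K ⧸ v.asIdeal) = nmK K (pidK K v) := by
    rw [nmK_apply, Ideal.absNorm_apply, Submodule.cardQuot_apply]; rfl
  haveI : Fact (nmK K (pidK K v)).Prime := ⟨hp⟩
  have hne : (1 : 𝓞 K ⧸ v.asIdeal) ≠ 0 := by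
    intro h0
    rw [← map_one (Ideal.Quotient.mk _), Ideal.Quotient.eq_zero_iff_mem] at h0
    exact v.isPrime.ne_top ((Ideal.eq_top_iff_one _).2 h0)
  have hz : AddSubgroup.zmultiples (1 : 𝓞 K ⧸ v.asIdeal) = ⊤ := zmultiples_eq_top_of_prime_card hcard hne
  have : Ideal.Quotient.mk v.asIdeal x ∈ AddSubgroup.zmultiples (1 : 𝓞 K ⧸ v.asIdeal) := hz ▸ AddSubgroup.mem_top _
  obtain ⟨n, hn⟩ := AddSubgroup.mem_zmultiples_iff.1 this
  have h1 : x - n ∈ v.asIdeal := by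
    rw [← Ideal.Quotient.eq, ← hn]; simp
  have h2 := Ideal.smul_mem_pointwise_smul τ _ _ h1
  rw [hv, smul_sub] at h2
  have h3 : τ • ((n : 𝓞 K)) = n := by
    ext; rw [smul_coe]; simp
  rw [h3] at h2
  have := sub_mem h2 h1
  simpa using this

lemma fin_bad : {v : HeightOneSpectrum (𝓞 K) | (nmK K (pidK K v)).Prime ∧ ∃ τ : K ≃ₐ[ℚ] K, τ ≠ 1 ∧ gV τ v = v}.Finite := by
  have : ∀ τ : K ≃ₐ[ℚ] K, τ ≠ 1 → ∃ x : 𝓞 K, τ • x - x ≠ 0 := by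
    intro τ hτ
    by_contra hc
    push Not at hc
    refine hτ (AlgEquiv.ext fun y => ?_)
    obtain ⟨a, b, hb, rfl⟩ := IsFractionRing.div_surjective (A := 𝓞 K) y
    have e : ∀ a : 𝓞 K, τ (a : K) = a := fun a => by rw [← smul_coe, sub_eq_zero.1 (hc a)]
    have e1 := e a
    have e2 := e b
    rw [map_div₀]
    exact congrArg₂ (· / ·) e1 e2
  choose! x hx using this
  refine Set.Finite.subset (Set.finite_iUnion fun τ : {τ : K ≃ₐ[ℚ] K // τ ≠ 1} =>
    Ideal.finite_factors (I := Ideal.span {τ.1 • x τ.1 - x τ.1}) ?_) ?_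
  · rw [Ne, Ideal.zero_eq_bot, Ideal.span_singleton_eq_bot]; exact hx _ τ.2
  · rintro v ⟨hp, τ, hτ, hv⟩
    refine Set.mem_iUnion.2 ⟨⟨τ, hτ⟩, ?_⟩
    rw [Set.mem_ofPred_eq, Ideal.dvd_span_singleton]
    exact stab_mem hp hv _

lemma comp_sum (x : ℝ) (hx : 2 ≤ x) (s : Finset (HeightOneSpectrum (𝓞 K) × ℕ)) (hs : ∀ q ∈ s, (nq (nmK K) (pidK K) q : ℝ) ≤ x)
    (hc : ∀ q ∈ s, ∃ j, 2 ≤ j ∧ nq (nmK K) (pidK K) q = rch q.1 ^ j) :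
    ∑ q ∈ s, lgq (nmK K) (pidK K) q ≤ ((Real.sqrt x + 1) * (Real.log x / Real.log 2 + 1)) * (Module.finrank ℚ K * Real.log x) := by
  classical
  set f : HeightOneSpectrum (𝓞 K) × ℕ → ℕ × ℕ := fun q => (rch q.1, q.2) with hf
  have hp1 : ∀ q ∈ s, (rch q.1 : ℝ) ^ 2 ≤ x := by
    intro q hq
    obtain ⟨j, hj, e⟩ := hc q hq
    refine le_trans ?_ (hs q hq)
    rw [e]; push_cast
    exact pow_le_pow_right₀ (by exact_mod_cast (rch_prime q.1).one_lt.le) hj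
  have hp2 : ∀ q ∈ s, (q.2 : ℝ) ≤ Real.log x / Real.log 2 := by
    intro q hq
    have hl2 := Real.log_pos one_lt_two
    rw [le_div_iff₀ hl2]
    have h1 := Real.log_le_log (by exact_mod_cast (arithK.nq_ge q).trans' one_le_two) (hs q hq)
    rw [arithK.log_nq] at h1
    have h2 := arithK.lgq_ge q
    nlinarith [(Nat.cast_nonneg q.2 : (0:ℝ) ≤ _)]
  have hlx : 0 ≤ Real.log x := Real.log_nonneg (by linarith)
  rw [← Finset.sum_fiberwise_of_maps_to (g := f) (t := s.image f) (fun q hq => Finset.mem_image_of_mem f hq)]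
  have h1 : ∀ j ∈ s.image f, ∑ q ∈ s with f q = j, lgq (nmK K) (pidK K) q ≤ Module.finrank ℚ K * Real.log x := by
    intro j hj
    obtain ⟨q0, hq0, rfl⟩ := Finset.mem_image.1 hj
    refine le_trans (le_of_eq ?_) ((sum_over_p (rch_prime q0.1) ((s.filter fun q => f q = f q0).image Prod.fst) ?_).trans ?_)
    · rw [Finset.sum_image]; · rfl
      intro a ha b hb hab
      simp [hf] at ha hb
      refine Prod.ext hab ?_
      rw [ha.2.2, hb.2.2]
    · intro v hv
      simp [hf] at hv
      exact hv.2
    · gcongr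
      · exact_mod_cast (rch_prime q0.1).pos
      · have h3 : (1:ℝ) ≤ rch q0.1 := by exact_mod_cast (rch_prime q0.1).one_lt.le
        have := hp1 q0 hq0
        nlinarith
  refine (Finset.sum_le_card_nsmul _ _ _ h1).trans ?_
  rw [nsmul_eq_mul]
  refine mul_le_mul_of_nonneg_right ?_ (by positivity)
  have h2 : s.image f ⊆ Finset.range (⌊Real.sqrt x⌋₊ + 1) ×ˢ Finset.range (⌊Real.log x / Real.log 2⌋₊ + 1) := by
    intro j hj
    obtain ⟨q, hq, rfl⟩ := Finset.mem_image.1 hj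
    rw [Finset.mem_product, Finset.mem_range, Finset.mem_range, Nat.lt_succ_iff, Nat.lt_succ_iff]
    exact ⟨Nat.le_floor (Real.le_sqrt_of_sq_le (hp1 q hq)), Nat.le_floor (hp2 q hq)⟩
  have h3 := Finset.card_le_card h2
  rw [Finset.card_product, Finset.card_range, Finset.card_range] at h3
  have h4 := Nat.floor_le (Real.sqrt_nonneg x)
  have h5 := Nat.floor_le (div_nonneg hlx (Real.log_pos one_lt_two).le)
  calc ((s.image f).card : ℝ) ≤ (⌊Real.sqrt x⌋₊ + 1) * (⌊Real.log x / Real.log 2⌋₊ + 1) := by exact_mod_cast h3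
    _ ≤ _ := by gcongr

open scoped Classical in
lemma bad_o : Tendsto (fun x : ℝ => (arithK (K := K)).psum (fun q => if goodQ q then 0 else lgq (nmK K) (pidK K) q) x / x) atTop (𝓝 0) := by
  set n : ℝ := (Module.finrank ℚ K : ℝ)
  set S0 := (fin_bad (K := K)).toFinset
  set B0 := ∑ v ∈ S0, Real.log (nmK K (pidK K v))
  have hlim : Tendsto (fun x : ℝ => (B0 + ((Real.sqrt x + 1) * (Real.log x / Real.log 2 + 1)) * (n * Real.log x)) / x) atTop (𝓝 0) := by
    have hB : 0 ≤ B0 := Finset.sum_nonneg fun v _ => Real.log_natCast_nonneg _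
    have hn : 0 ≤ n := Nat.cast_nonneg _
    have hl2 := Real.log_pos one_lt_two
    have h14 : Tendsto (fun x : ℝ => (B0 + 2 * (8 / Real.log 2 + 1) * (n * 8)) * x ^ (-(1/8) : ℝ)) atTop (𝓝 0) := by
      simpa using (tendsto_rpow_neg_atTop (show (0:ℝ) < 1/8 by norm_num)).const_mul (B0 + 2 * (8 / Real.log 2 + 1) * (n * 8))
    refine squeeze_zero' ?_ ?_ h14
    · filter_upwards [eventually_ge_atTop 1] with x hx
      have := Real.log_nonneg hx
      positivity
    · filter_upwards [eventually_ge_atTop 1] with x hx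
      have hlog := Real.log_le_rpow_div (by linarith : 0 ≤ x) (show (0:ℝ) < 1/8 by norm_num)
      have hl0 := Real.log_nonneg hx
      have hx0 : 0 < x := by linarith
      set y := x ^ (1/8 : ℝ) with hy
      have hy1 : 1 ≤ y := Real.one_le_rpow hx (by norm_num)
      have e8 : x = y ^ 8 := by rw [hy, ← Real.rpow_natCast, ← Real.rpow_mul hx0.le]; norm_num
      have e4 : Real.sqrt x = y ^ 4 := by rw [e8, show y ^ 8 = (y ^ 4) ^ 2 by ring, Real.sqrt_sq (by positivity)]
      have e1 : x ^ (-(1/8) : ℝ) = y⁻¹ := by rw [Real.rpow_neg hx0.le]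
      have hlog' : Real.log x ≤ 8 * y := by linarith
      rw [e1, e4, div_le_iff₀ hx0]
      have a1 : y ^ 4 + 1 ≤ 2 * y ^ 4 := by have := one_le_pow₀ hy1 (n := 4); linarith
      have a2 : Real.log x / Real.log 2 + 1 ≤ (8 / Real.log 2 + 1) * y := by
        rw [add_mul, one_mul, div_mul_eq_mul_div]
        gcongr
      have a3 : (y ^ 4 + 1) * (Real.log x / Real.log 2 + 1) * (n * Real.log x) ≤ (2 * y ^ 4) * ((8 / Real.log 2 + 1) * y) * (n * (8 * y)) := by
        gcongr
      have a4 : y⁻¹ * x = y ^ 7 := by rw [e8]; field_simp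
      have a5 : y ^ 6 ≤ y ^ 7 := pow_le_pow_right₀ hy1 (by norm_num)
      have a6 : 1 ≤ y ^ 7 := one_le_pow₀ hy1
      have a7 : 0 ≤ 2 * (8 / Real.log 2 + 1) * (n * 8) := by positivity
      rw [mul_assoc _ y⁻¹, a4]
      nlinarith [mul_le_mul_of_nonneg_left a5 a7, mul_le_mul_of_nonneg_left a6 hB]
  refine squeeze_zero' ?_ ?_ hlim
  · filter_upwards [eventually_gt_atTop 0] with x hx
    refine div_nonneg (Finset.sum_nonneg fun q _ => ?_) hx.le
    split_ifs; exacts [le_rfl, (arithK.lgq_pos q).le]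
  filter_upwards [eventually_ge_atTop 2] with x hx
  refine div_le_div_of_nonneg_right ?_ (by linarith)
  have e : (arithK (K := K)).psum (fun q => if goodQ q then 0 else lgq (nmK K) (pidK K) q) x =
      ∑ q ∈ ((arithK (K := K)).finQ ⌊x⌋₊).toFinset.filter (fun q => ¬ goodQ q), lgq (nmK K) (pidK K) q := by
    rw [Finset.sum_filter, Arith.psum]
    exact Finset.sum_congr rfl fun q _ => by split_ifs <;> rfl
  rw [e, ← Finset.sum_filter_add_sum_filter_not _ (fun q => q.2 = 0 ∧ q.1 ∈ S0)]
  refine add_le_add ?_ (comp_sum x hx _ ?_ ?_)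
  · simp only [lgq]
    rw [← Finset.sum_image (f := fun v => Real.log (nmK K (pidK K v))) (g := Prod.fst)]
    · refine Finset.sum_le_sum_of_subset_of_nonneg ?_ fun v _ _ => Real.log_natCast_nonneg _
      intro v hv
      obtain ⟨q, hq, rfl⟩ := Finset.mem_image.1 hv
      exact (Finset.mem_filter.1 hq).2.2
    · intro a ha b hb hab
      refine Prod.ext hab ?_
      rw [(Finset.mem_filter.1 ha).2.1, (Finset.mem_filter.1 hb).2.1]
  · intro q hq
    exact arithK.mem_Q.1 (Finset.mem_filter.1 (Finset.mem_filter.1 hq).1).1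
  · intro q hq
    obtain ⟨hq, hn⟩ := Finset.mem_filter.1 hq
    have hb := (Finset.mem_filter.1 hq).2
    obtain ⟨f, hf, e⟩ := rch_norm q.1
    refine ⟨f * (q.2 + 1), ?_, by rw [nq, qid, map_pow, e, pow_mul]⟩
    by_contra hlt
    have hq2 : q.2 = 0 := by
      by_contra h0
      have : 1 * 2 ≤ f * (q.2 + 1) := Nat.mul_le_mul hf (by omega)
      omega
    have hf1 : f = 1 := by rw [hq2] at hlt; omega
    refine hn ⟨hq2, (Set.Finite.mem_toFinset _).2 ⟨?_, ?_⟩⟩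
    · rw [e, hf1, pow_one]; exact rch_prime _
    · rw [goodQ] at hb
      push Not at hb
      obtain ⟨τ, h1, h2⟩ := hb hq2
      exact ⟨τ, h2, h1⟩
end B4

end

section
open Filter Topology MeasureTheory Set
open NumberField nonZeroDivisors IsDedekindDomain
section B5
variable {K : Type*} [Field K] [NumberField K]

/-- twist by a class group character -/
noncomputable def twC (χ : ID K →* ℂ) (ψ : AddChar (Additive (ClassGroup (𝓞 K))) ℂ) : ID K →* ℂ where
  toFun a := χ a * ψ (Additive.ofMul (ClassGroup.mk0 a))
  map_one' := by simp
  map_mul' a b := by rw [map_mul, map_mul, ofMul_mul, AddChar.map_add_eq_mul]; ring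

lemma twC_lam {χ : ID K →* ℂ} {lam : InfinitePlace K → ℝ} (h : HasLam χ lam) (ψ) : HasLam (twC χ ψ) lam where
  l0 := h.l0
  nrm a := by
    change ‖χ a * ψ _‖ = 1
    rw [norm_mul, h.nrm, AddChar.norm_apply, one_mul]
  val α b hb := by
    change χ b * ψ _ = _
    have : ClassGroup.mk0 b = 1 := by
      rw [ClassGroup.mk0_eq_one_iff, hb]; exact ⟨⟨α, rfl⟩⟩
    rw [this, ofMul_one, AddChar.map_zero_eq_one, mul_one, h.val α b hb]

open scoped Classical in
lemma cls_ind (C : ClassGroup (𝓞 K)) (a : ID K) : (if ClassGroup.mk0 a = C then 1 else 0 : ℂ) =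
    (Fintype.card (ClassGroup (𝓞 K)) : ℂ)⁻¹ * ∑ ψ : AddChar (Additive (ClassGroup (𝓞 K))) ℂ,
      ψ (-Additive.ofMul C) * ψ (Additive.ofMul (ClassGroup.mk0 a)) := by
  simp only [← AddChar.map_add_eq_mul]
  rw [AddChar.sum_apply_eq_ite]
  have h0 : (Fintype.card (ClassGroup (𝓞 K)) : ℂ) ≠ 0 := by exact_mod_cast Fintype.card_ne_zero
  have : -Additive.ofMul C + Additive.ofMul (ClassGroup.mk0 a) = 0 ↔ ClassGroup.mk0 a = C := by
    rw [neg_add_eq_zero, Additive.ofMul.injective.eq_iff, eq_comm]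
  simp only [this]
  split_ifs
  · rw [Fintype.card_congr Additive.toMul, inv_mul_cancel₀ h0]
  · simp

open scoped Classical in
lemma thetaK {χ : ID K →* ℂ} {lam : InfinitePlace K → ℝ} (h : HasLam χ lam) (hl : lam ≠ 0) (C : ClassGroup (𝓞 K)) :
    Tendsto (fun x : ℝ => (arithK (K := K)).psum (fun q => if goodQ q ∧ ClassGroup.mk0 (qid (pidK K) q) = C then
      lgq (nmK K) (pidK K) q * χ (qid (pidK K) q) else 0) x / x) atTop (𝓝 0) := by
  have h1 : Tendsto (fun x : ℝ => (arithK (K := K)).psum (fun q => if ClassGroup.mk0 (qid (pidK K) q) = C then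
      lgq (nmK K) (pidK K) q * χ (qid (pidK K) q) else 0) x / (x : ℂ)) atTop (𝓝 0) := by
    have := (tendsto_finsetSum Finset.univ fun (ψ : AddChar (Additive (ClassGroup (𝓞 K))) ℂ) _ =>
      (PITchi (twC_lam h ψ) hl).const_mul (ψ (-Additive.ofMul C))).const_mul ((Fintype.card (ClassGroup (𝓞 K)) : ℂ)⁻¹)
    simp only [mul_zero, Finset.sum_const_zero] at this
    refine this.congr fun x => ?_
    simp only [← mul_div_assoc]
    rw [← Finset.sum_div, ← mul_div_assoc]
    congr 1
    simp only [Arith.psum, Finset.mul_sum]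
    rw [Finset.sum_comm]
    refine Finset.sum_congr rfl fun q _ => ?_
    rw [← Finset.mul_sum, ← mul_boole, cls_ind, Finset.mul_sum, Finset.mul_sum, Finset.mul_sum]
    refine Finset.sum_congr rfl fun ψ _ => ?_
    change _ * (_ * (_ * (χ _ * ψ _))) = _
    ring
  have h2 : Tendsto (fun x : ℝ => (arithK (K := K)).psum (fun q => if goodQ q then 0 else if ClassGroup.mk0 (qid (pidK K) q) = C then
      lgq (nmK K) (pidK K) q * χ (qid (pidK K) q) else 0) x / (x : ℂ)) atTop (𝓝 0) := by
    refine squeeze_zero_norm' ?_ (bad_o (K := K))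
    filter_upwards [eventually_gt_atTop 0] with x hx
    rw [norm_div, Complex.norm_real, Real.norm_eq_abs, abs_of_pos hx]
    refine div_le_div_of_nonneg_right (norm_sum_le_of_le _ fun q _ => ?_) hx.le
    have := (arithK (K := K)).lgq_pos q
    split_ifs
    · simp
    · rw [norm_mul, h.nrm, mul_one, Complex.norm_real, Real.norm_eq_abs, abs_of_pos this]
    · simpa using this.le
  have h3 := h1.sub h2
  rw [sub_zero] at h3
  refine h3.congr fun x => ?_
  rw [← sub_div, Arith.psum, Arith.psum, Arith.psum, ← Finset.sum_sub_distrib]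
  congr 1
  refine Finset.sum_congr rfl fun q _ => ?_
  by_cases hg : goodQ q <;> simp [hg]
end B5

end

section
open Filter Topology MeasureTheory Set
open NumberField nonZeroDivisors IsDedekindDomain
open scoped Pointwise
section E1
variable {K : Type*} [Field K] [NumberField K]

noncomputable instance instT1 : AddCommGroup (Torus K) := QuotientAddGroup.Quotient.addCommGroup _
noncomputable instance instT2 : CommGroup (Multiplicative (Torus K)) := Multiplicative.commGroup
noncomputable instance instT3 : CommGroup (ClassGroup (𝓞 K)) := inferInstance
noncomputable instance instT4 : CommGroup (Multiplicative (Torus K) × ClassGroup (𝓞 K)) := Prod.instCommGroup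

lemma gal_comm {σ : K ≃ₐ[ℚ] K} (hσ : ∀ τ : K ≃ₐ[ℚ] K, τ ∈ Subgroup.zpowers σ) (τ ρ : K ≃ₐ[ℚ] K) : τ * ρ = ρ * τ := by
  obtain ⟨m, rfl⟩ := Subgroup.mem_zpowers_iff.1 (hσ τ)
  obtain ⟨n, rfl⟩ := Subgroup.mem_zpowers_iff.1 (hσ ρ)
  exact (Commute.refl σ).zpow_zpow m n

lemma emb_trans [IsGalois ℚ K] (φ ψ : K →+* ℂ) : ∃ τ : K ≃ₐ[ℚ] K, ∀ x, ψ x = φ (τ x) := by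
  obtain ⟨τ, h⟩ := ComplexEmbedding.exists_comp_symm_eq_of_comp_eq (k := ℚ) φ ψ (Subsingleton.elim _ _)
  exact ⟨τ.symm, fun x => by rw [← h]; rfl⟩

lemma exists_conj [IsGalois ℚ K] {σ : K ≃ₐ[ℚ] K} (hσ : ∀ τ : K ≃ₐ[ℚ] K, τ ∈ Subgroup.zpowers σ) :
    ∃ c : K ≃ₐ[ℚ] K, c * c = 1 ∧ (∀ (w : InfinitePlace K) x, w (c x) = w x) ∧
      (∀ x : K, (∀ w : InfinitePlace K, w x = 1) → x * c x = 1) ∧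
      ((∃ w w' : InfinitePlace K, w ≠ w') → ∃ τ : K ≃ₐ[ℚ] K, τ ≠ 1 ∧ τ ≠ c) := by
  have φ : K →+* ℂ := Classical.choice inferInstance
  obtain ⟨c, hc⟩ := emb_trans φ (ComplexEmbedding.conjugate φ)
  have hc' : ∀ ψ : K →+* ℂ, ∀ x, ψ (c x) = starRingEnd ℂ (ψ x) := by
    intro ψ x
    obtain ⟨τ, hτ⟩ := emb_trans φ ψ
    rw [hτ, hτ]
    have : τ (c x) = c (τ x) := congrArg (fun g : K ≃ₐ[ℚ] K => g x) (gal_comm hσ τ c)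
    rw [this, ← hc]; rfl
  have hw : ∀ (w : InfinitePlace K) x, w (c x) = w x := by
    intro w x
    rw [← InfinitePlace.norm_embedding_eq, ← InfinitePlace.norm_embedding_eq, hc', RCLike.norm_conj]
  refine ⟨c, ?_, hw, ?_, ?_⟩
  · ext x
    apply φ.injective
    change φ (c (c x)) = φ x
    rw [hc', hc', Complex.conj_conj]
  · intro x hx
    apply φ.injective
    have h1 := hx (InfinitePlace.mk φ)
    rw [InfinitePlace.apply] at h1
    rw [map_mul, hc', Complex.mul_conj, Complex.normSq_eq_norm_sq, h1]; simp
  · rintro ⟨w, w', hne⟩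
    obtain ⟨τ, hτ⟩ := emb_trans w.embedding w'.embedding
    refine ⟨τ, ?_, ?_⟩ <;> rintro rfl <;> refine hne (InfinitePlace.ext _ _ fun x => ?_)
    · rw [← InfinitePlace.norm_embedding_eq w', hτ, InfinitePlace.norm_embedding_eq]; rfl
    · rw [← InfinitePlace.norm_embedding_eq w', hτ, InfinitePlace.norm_embedding_eq, hw]

lemma ext_div {A B D : Type*} [AddCommGroup A] [AddCommGroup B] [AddCommGroup D] [DivisibleBy D ℤ] (f : A →+ B) (g : A →+ D)
    (h : ∀ a, f a = 0 → g a = 0) : ∃ k : B →+ D, ∀ a, k (f a) = g a := by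
  obtain ⟨k, hk⟩ := (Module.Baer.of_divisible D).extension_property_addMonoidHom (QuotientAddGroup.kerLift f)
    (QuotientAddGroup.kerLift_injective f) (QuotientAddGroup.lift f.ker g h)
  refine ⟨k, fun a => ?_⟩
  have := DFunLike.congr_fun hk (QuotientAddGroup.mk a)
  exact this

lemma ext_div' {A B D : Type*} [CommGroup A] [CommGroup B] [AddCommGroup D] [DivisibleBy D ℤ] (f : A →* B) (g : Additive A →+ D)
    (h : ∀ a, f a = 1 → g (Additive.ofMul a) = 0) : ∃ k : Additive B →+ D, ∀ a, k (Additive.ofMul (f a)) = g (Additive.ofMul a) :=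
  ext_div (MonoidHom.toAdditive f) g h

noncomputable instance divT : DivisibleBy (sumKer K) ℤ where
  div x n := ⟨((n:ℝ)⁻¹) • (x : InfinitePlace K → ℝ), by
    have h : ∑ w, (x : InfinitePlace K → ℝ) w = 0 := x.2
    change ∑ w, _ = (0:ℝ)
    simp only [Pi.smul_apply, smul_eq_mul]
    rw [← Finset.mul_sum, h, mul_zero]⟩
  div_zero x := by ext; simp
  div_cancel {n} x hn := by
    ext w
    simp [hn]

noncomputable instance divTT : DivisibleBy (Torus K) ℤ :=
  Function.Surjective.divisibleBy (QuotientAddGroup.mk' (logUnits K)) (QuotientAddGroup.mk'_surjective _) (fun _ _ => rfl)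

lemma logMap_inv {a : K} (ha : a ≠ 0) : logMap K a⁻¹ = - logMap K a := by
  rw [eq_neg_iff_add_eq_zero, ← logMap_mul K (inv_ne_zero ha) ha, inv_mul_cancel₀ ha, logMap_one]
lemma logMap_div {a b : K} (ha : a ≠ 0) (hb : b ≠ 0) : logMap K (a / b) = logMap K a - logMap K b := by
  rw [div_eq_mul_inv, logMap_mul K ha (inv_ne_zero hb), logMap_inv hb, sub_eq_add_neg]

lemma mem_sumKer_of_norm {b : K} (h : Algebra.norm ℚ b = 1) : logMap K b ∈ sumKer K := by
  have hb : b ≠ 0 := by rintro rfl; simp at h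
  change ∑ w, logMap K b w = 0
  rw [sum_logMap K hb, h]; simp

lemma norm_pi (σ : K ≃ₐ[ℚ] K) {a : K} (ha : a ≠ 0) : Algebra.norm ℚ (a / σ a) = 1 := by
  have h : Algebra.norm ℚ (a / σ a) * Algebra.norm ℚ a = Algebra.norm ℚ a := by
    conv_lhs => rw [← Algebra.norm_eq_of_algEquiv σ a]
    rw [← map_mul, div_mul_cancel₀ _ (by simpa using ha)]
  exact mul_right_cancel₀ (Algebra.norm_ne_zero_iff.2 ha) (h.trans (one_mul _).symm)

lemma pi_mem (σ : K ≃ₐ[ℚ] K) {a : K} (ha : a ≠ 0) : logMap K (a / σ a) ∈ sumKer K := mem_sumKer_of_norm (norm_pi σ ha)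

lemma unit_mem (u : (𝓞 K)ˣ) : logMap K ((u : 𝓞 K) : K) ∈ sumKer K := sum_logMap_unit K u

lemma unit_inv (u : (𝓞 K)ˣ) : (((u⁻¹ : (𝓞 K)ˣ) : 𝓞 K) : K) = ((u : 𝓞 K) : K)⁻¹ := by
  apply eq_inv_of_mul_eq_one_left
  rw [← map_mul, Units.inv_mul, map_one]

lemma unit_pi (σ : K ≃ₐ[ℚ] K) (u : (𝓞 K)ˣ) : ∃ v : (𝓞 K)ˣ, ((v : 𝓞 K) : K) = ((u : 𝓞 K) : K) / σ ((u : 𝓞 K) : K) := by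
  refine ⟨u * Units.map (MulSemiringAction.toRingHom _ (𝓞 K) σ).toMonoidHom u⁻¹, ?_⟩
  change algebraMap (𝓞 K) K (_ * _) = _
  rw [map_mul, div_eq_mul_inv]
  congr 1
  change σ (((u⁻¹ : (𝓞 K)ˣ) : 𝓞 K) : K) = _
  rw [unit_inv, map_inv₀]

lemma logUnits_iff (x : sumKer K) : x ∈ logUnits K ↔ ∃ u : (𝓞 K)ˣ, (x : InfinitePlace K → ℝ) = logMap K ((u : 𝓞 K) : K) := by
  refine ⟨fun h => ?_, fun h => AddSubgroup.subset_closure h⟩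
  have hn : ∀ u : (𝓞 K)ˣ, ((u : 𝓞 K) : K) ≠ 0 := fun u => by simp
  induction h using AddSubgroup.closure_induction with
  | mem x hx => exact hx
  | zero => exact ⟨1, by simp [logMap_one]⟩
  | add x y _ _ hx hy =>
    obtain ⟨u, hu⟩ := hx
    obtain ⟨v, hv⟩ := hy
    exact ⟨u * v, by rw [AddSubgroup.coe_add, hu, hv, ← logMap_mul K (hn u) (hn v)]; simp⟩
  | neg x _ hx =>
    obtain ⟨u, hu⟩ := hx
    refine ⟨u⁻¹, ?_⟩
    rw [AddSubgroup.coe_neg, hu, ← logMap_inv (hn u), unit_inv]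

/-- the map to the torus -/
noncomputable def phiK (σ : K ≃ₐ[ℚ] K) : Additive Kˣ →+ Torus K :=
  AddMonoidHom.mk' (fun a => QuotientAddGroup.mk ⟨logMap K ((a.toMul : K) / σ (a.toMul : K)), pi_mem σ a.toMul.ne_zero⟩) (by
    intro a b
    rw [← QuotientAddGroup.mk_add]
    congr 1
    apply Subtype.ext
    have h : ∀ a : Kˣ, σ (a : K) ≠ 0 := fun a => by simp
    rw [AddSubgroup.coe_add, ← logMap_mul K (div_ne_zero a.toMul.ne_zero (h _)) (div_ne_zero b.toMul.ne_zero (h _))]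
    change logMap K _ = logMap K _
    rw [toMul_add, Units.val_mul, map_mul, div_mul_div_comm])

lemma phiK_unit (σ : K ≃ₐ[ℚ] K) (a : Kˣ) (h : toPrincipalIdeal (𝓞 K) K a = 1) : phiK σ (Additive.ofMul a) = 0 := by
  have key : ∀ a : Kˣ, toPrincipalIdeal (𝓞 K) K a = 1 → ∃ x : 𝓞 K, (x : K) = a := fun a h => by
    rw [toPrincipalIdeal_eq_iff, Units.val_one] at h
    rw [← FractionalIdeal.mem_one_iff, ← h]
    exact FractionalIdeal.mem_spanSingleton_self _ _
  obtain ⟨x, hx⟩ := key a h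
  obtain ⟨y, hy⟩ := key a⁻¹ (by rw [map_inv, h, inv_one])
  have hxy : x * y = 1 := by
    apply FaithfulSMul.algebraMap_injective (𝓞 K) K
    rw [map_mul, map_one]
    exact (congrArg₂ (· * ·) hx hy).trans (Units.mul_inv a)
  obtain ⟨v, hv⟩ := unit_pi σ (Units.mkOfMulEqOne x y hxy)
  change (QuotientAddGroup.mk _ : Torus K) = 0
  rw [QuotientAddGroup.eq_zero_iff, logUnits_iff]
  refine ⟨v, ?_⟩
  rw [hv, Units.val_mkOfMulEqOne, hx]; rfl

/-- the class of `x/σx` -/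
noncomputable def mkT (σ : K ≃ₐ[ℚ] K) (x : K) (hx : x ≠ 0) : Torus K := QuotientAddGroup.mk ⟨logMap K (x / σ x), pi_mem σ hx⟩

lemma mkT_phi (σ : K ≃ₐ[ℚ] K) (x : K) (hx : x ≠ 0) : mkT σ x hx = phiK σ (Additive.ofMul (Units.mk0 x hx)) := rfl

lemma exists_phiHat (σ : K ≃ₐ[ℚ] K) : ∃ F : Additive (FractionalIdeal (𝓞 K)⁰ K)ˣ →+ Torus K, ∀ (x : K) (hx : x ≠ 0),
    F (Additive.ofMul (toPrincipalIdeal (𝓞 K) K (Units.mk0 x hx))) = mkT σ x hx := by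
  obtain ⟨k, hk⟩ := ext_div' (D := Torus K) (toPrincipalIdeal (𝓞 K) K) (phiK σ) (by
    intro a ha
    refine phiK_unit σ a ?_
    rw [toPrincipalIdeal_eq_iff, Units.val_one]
    exact (toPrincipalIdeal_eq_iff.1 ha).trans Units.val_one)
  exact ⟨k, fun x hx => hk (Units.mk0 x hx)⟩

/-- extension to ideals -/
noncomputable def phiHat (σ : K ≃ₐ[ℚ] K) : ID K →* Multiplicative (Torus K) :=
  (AddMonoidHom.toMultiplicativeRight (exists_phiHat σ).choose).comp (FractionalIdeal.mk0 K)

lemma phiHat_span (σ : K ≃ₐ[ℚ] K) (a : ID K) (x : 𝓞 K) (hx : (x : K) ≠ 0) (h : (a : Ideal (𝓞 K)) = Ideal.span {x}) :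
    phiHat σ a = Multiplicative.ofAdd (mkT σ x hx) := by
  have : FractionalIdeal.mk0 K a = toPrincipalIdeal (𝓞 K) K (Units.mk0 (x:K) hx) := by
    apply Units.ext
    rw [FractionalIdeal.coe_mk0, coe_toPrincipalIdeal, h, FractionalIdeal.coeIdeal_span_singleton]; rfl
  rw [phiHat, MonoidHom.comp_apply, this, ← (exists_phiHat σ).choose_spec]
  rfl

end E1

end

section
open Filter Topology MeasureTheory Set
open NumberField nonZeroDivisors IsDedekindDomain
open scoped Pointwise
section E2
variable {K : Type*} [Field K] [NumberField K]

/-- type of an ideal -/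
noncomputable def typK (σ : K ≃ₐ[ℚ] K) : ID K →* Multiplicative (Torus K) × ClassGroup (𝓞 K) := (phiHat σ).prod ClassGroup.mk0

/-- principal ideal -/
noncomputable def pI (x : 𝓞 K) (hx : x ≠ 0) : ID K := ⟨Ideal.span {x}, mem_nonZeroDivisors_of_ne_zero (by
  rwa [Ne, Ideal.zero_eq_bot, Ideal.span_singleton_eq_bot])⟩

lemma coeK_ne {x : 𝓞 K} (hx : x ≠ 0) : (x : K) ≠ 0 := by simpa using hx

lemma pI_mul (x y : 𝓞 K) (hx : x ≠ 0) (hy : y ≠ 0) : pI (x * y) (mul_ne_zero hx hy) = pI x hx * pI y hy :=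
  Subtype.ext (Ideal.span_singleton_mul_span_singleton x y).symm

lemma smul_nz (τ : K ≃ₐ[ℚ] K) {x : 𝓞 K} (hx : x ≠ 0) : τ • x ≠ 0 := by
  rwa [Ne, smul_eq_zero_iff_eq]

lemma gI_pI (τ : K ≃ₐ[ℚ] K) (x : 𝓞 K) (hx : x ≠ 0) : gI τ (pI x hx) = pI (τ • x) (smul_nz τ hx) :=
  Subtype.ext (smul_span τ x)

lemma phiHat_pI (σ : K ≃ₐ[ℚ] K) (x : 𝓞 K) (hx : x ≠ 0) : phiHat σ (pI x hx) = Multiplicative.ofAdd (mkT σ (x:K) (coeK_ne hx)) :=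
  phiHat_span σ _ x _ rfl

lemma mk0_pI (x : 𝓞 K) (hx : x ≠ 0) : ClassGroup.mk0 (pI x hx) = 1 := by
  rw [ClassGroup.mk0_eq_one_iff]; exact ⟨⟨x, rfl⟩⟩

lemma cls_eq {a b : ID K} (h : ClassGroup.mk0 a = ClassGroup.mk0 b) : ∃ (x y : 𝓞 K) (hx : x ≠ 0) (hy : y ≠ 0), pI x hx * a = pI y hy * b := by
  obtain ⟨x, y, hx, hy, h⟩ := ClassGroup.mk0_eq_mk0_iff.1 h
  exact ⟨x, y, hx, hy, Subtype.ext h⟩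

/-- `a * c a` -/
noncomputable def sI (c : K ≃ₐ[ℚ] K) (a : ID K) : ID K := a * gI c a
lemma sI_mul (c : K ≃ₐ[ℚ] K) (a b : ID K) : sI c (a * b) = sI c a * sI c b := by
  simp only [sI, map_mul, mul_assoc, mul_left_comm]
lemma sI_g {σ : K ≃ₐ[ℚ] K} (c τ : K ≃ₐ[ℚ] K) (hτ : τ * c = c * τ) (a : ID K) : sI c (gI τ a) = gI τ (sI c a) := by
  simp only [sI, map_mul, gI_gI, hτ]

lemma mkT_eq (σ : K ≃ₐ[ℚ] K) {x y : K} (hx : x ≠ 0) (hy : y ≠ 0) (h : mkT σ x hx = mkT σ y hy) :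
    ∃ u : (𝓞 K)ˣ, ∀ w : InfinitePlace K, w (x * σ y) * w ((u : 𝓞 K) : K) = w (y * σ x) := by
  rw [mkT, mkT, QuotientAddGroup.eq, logUnits_iff] at h
  obtain ⟨u, hu⟩ := h
  have h0 : ∀ z : K, z ≠ 0 → σ z ≠ 0 := fun z hz => by simpa using hz
  have hu0 : ((u : 𝓞 K) : K) ≠ 0 := by simp
  refine ⟨u, fun w => ?_⟩
  change - logMap K (x / σ x) + logMap K (y / σ y) = _ at hu
  rw [logMap_div hx (h0 _ hx), logMap_div hy (h0 _ hy)] at hu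
  have h1 : logMap K ((x * σ y) * ((u : 𝓞 K) : K)) = logMap K (y * σ x) := by
    rw [logMap_mul K (mul_ne_zero hx (h0 _ hy)) hu0, logMap_mul K hx (h0 _ hy), logMap_mul K hy (h0 _ hx), ← hu]; abel
  have h2 := congrFun h1 w
  rw [logMap_apply, logMap_apply] at h2
  have hm : (w.mult : ℝ) ≠ 0 := by exact_mod_cast w.mult_pos.ne'
  have h3 := mul_left_cancel₀ hm h2
  rw [← map_mul]
  exact Real.log_injOn_pos (InfinitePlace.pos_iff.2 (by simp [hx, hy])) (InfinitePlace.pos_iff.2 (by simp [hx, hy])) h3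

lemma sI_eq {σ c : K ≃ₐ[ℚ] K} (hcc : c * c = 1) (hcs : σ * c = c * σ) 
    (hc1 : ∀ x : K, (∀ w : InfinitePlace K, w x = 1) → x * c x = 1) {a b : ID K} (h : typK σ a = typK σ b) :
    sI c a * gI σ (sI c b) = sI c b * gI σ (sI c a) := by
  have hp : phiHat σ a = phiHat σ b := congrArg Prod.fst h
  obtain ⟨x, y, hx, hy, e⟩ := cls_eq (congrArg Prod.snd h : ClassGroup.mk0 a = ClassGroup.mk0 b)
  have e1 := congrArg (phiHat σ) e
  rw [map_mul, map_mul, hp, mul_left_inj, phiHat_pI, phiHat_pI] at e1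
  obtain ⟨u, hu⟩ := mkT_eq σ _ _ (Multiplicative.ofAdd.injective e1)
  have e2 : y * (σ • x) * c • (y * (σ • x)) = x * (σ • y) * c • (x * (σ • y)) * (u * c • (u : 𝓞 K)) := by
    apply FaithfulSMul.algebraMap_injective (𝓞 K) K
    have hx' := coeK_ne hx
    have hy' := coeK_ne hy
    have hu0 : ((u : 𝓞 K) : K) ≠ 0 := by simp
    have := hc1 ((y : K) * σ x / ((x : K) * σ y * ((u : 𝓞 K) : K))) (fun w => by
      rw [map_div₀, map_mul w _ ((u : 𝓞 K) : K), hu, div_self]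
      simp [hx', hy'])
    simp only [map_div₀, map_mul] at this ⊢
    change (y : K) * σ x * ((c ((y : K) * σ x))) = x * σ y * (c ((x : K) * σ y)) * (u * c ((u : 𝓞 K) : K))
    have hd : ∀ (τ : K ≃ₐ[ℚ] K) (z : K), z ≠ 0 → τ z ≠ 0 := fun τ z hz => by simpa using hz
    have n1 := hd σ _ hy'
    have n2 := hd c _ hx'
    have n3 := hd c _ n1
    have n4 := hd c _ hu0
    field_simp at this
    simp only [map_mul]
    linear_combination this
  have e3 : sI c (pI y hy) * gI σ (sI c (pI x hx)) = sI c (pI x hx) * gI σ (sI c (pI y hy)) := by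
    rw [← sI_g (σ := σ) c σ hcs, ← sI_g (σ := σ) c σ hcs, ← sI_mul, ← sI_mul, gI_pI, gI_pI, ← pI_mul, ← pI_mul, sI, sI, gI_pI, gI_pI, ← pI_mul, ← pI_mul]
    apply Subtype.ext
    change Ideal.span {_} = Ideal.span {_}
    rw [e2]
    refine Ideal.span_singleton_mul_right_unit ?_ _
    refine u.isUnit.mul ?_
    exact u.isUnit.map (MulSemiringAction.toRingHom _ (𝓞 K) c)
  have e4 := congrArg (sI c) e
  rw [sI_mul, sI_mul] at e4
  have e5 := congrArg (gI σ) e4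
  rw [map_mul, map_mul] at e5
  apply mul_left_cancel (a := sI c (pI x hx) * gI σ (sI c (pI y hy)))
  calc _ = (sI c (pI x hx) * sI c a) * (gI σ (sI c (pI y hy)) * gI σ (sI c b)) := by simp only [mul_assoc, mul_comm, mul_left_comm]
    _ = (sI c (pI y hy) * sI c b) * (gI σ (sI c (pI x hx)) * gI σ (sI c a)) := by rw [e4, e5]
    _ = (sI c (pI y hy) * gI σ (sI c (pI x hx))) * (sI c b * gI σ (sI c a)) := by simp only [mul_assoc, mul_comm, mul_left_comm]
    _ = _ := by rw [e3]

lemma all_tau {σ : K ≃ₐ[ℚ] K} (hσ : ∀ τ : K ≃ₐ[ℚ] K, τ ∈ Subgroup.zpowers σ) {A J : ID K} (h : A * gI σ J = J * gI σ A)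
    (τ : K ≃ₐ[ℚ] K) : A * gI τ J = J * gI τ A := by
  let S : Subgroup (K ≃ₐ[ℚ] K) :=
    { carrier := {τ | A * gI τ J = J * gI τ A}
      one_mem' := by
        change A * gI 1 J = J * gI 1 A
        rw [gI_one, gI_one, mul_comm]
      mul_mem' := by
        intro τ ρ h1 h2
        change A * gI (τ * ρ) J = J * gI (τ * ρ) A
        change A * gI τ J = J * gI τ A at h1
        have h3 := congrArg (gI τ) (h2 : A * gI ρ J = J * gI ρ A)
        rw [map_mul, map_mul, gI_gI, gI_gI] at h3
        apply mul_left_cancel (a := gI τ A)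
        rw [mul_left_comm, h3, ← mul_assoc, h1]
        simp only [mul_assoc, mul_comm, mul_left_comm]
      inv_mem' := by
        intro τ h1
        change A * gI τ⁻¹ J = J * gI τ⁻¹ A
        have h3 := congrArg (gI τ⁻¹) (h1 : A * gI τ J = J * gI τ A)
        rw [map_mul, map_mul, gI_gI, gI_gI, inv_mul_cancel, gI_one, gI_one] at h3
        rw [mul_comm A, mul_comm J, h3] }
  exact (Subgroup.zpowers_le.2 (show σ ∈ S from h)) (hσ τ)

lemma pid_prime (v : HeightOneSpectrum (𝓞 K)) {a b : ID K} (h : pidK K v ∣ a * b) : pidK K v ∣ a ∨ pidK K v ∣ b := by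
  rw [ID_dvd] at h
  rw [ID_dvd, ID_dvd]
  exact v.prime.dvd_or_dvd h

lemma pid_dvd {v w : HeightOneSpectrum (𝓞 K)} (h : pidK K v ∣ pidK K w) : v = w := by
  rw [ID_dvd] at h
  have h1 : w.asIdeal ≤ v.asIdeal := Ideal.le_of_dvd h
  exact HeightOneSpectrum.ext (w.isMaximal.eq_of_le v.isPrime.ne_top h1).symm

lemma j4K {σ c : K ≃ₐ[ℚ] K} (hσ : ∀ τ : K ≃ₐ[ℚ] K, τ ∈ Subgroup.zpowers σ) (hcc : c * c = 1)
    (hc1 : ∀ x : K, (∀ w : InfinitePlace K, w x = 1) → x * c x = 1) (h2 : ∃ τ : K ≃ₐ[ℚ] K, τ ≠ 1 ∧ τ ≠ c)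
    (v : HeightOneSpectrum (𝓞 K)) (hv : ∀ τ : K ≃ₐ[ℚ] K, gV τ v = v → τ = 1) (a m : ID K)
    (hm : ∀ τ : K ≃ₐ[ℚ] K, ¬ gI τ (pidK K v) ∣ m) (h : typK σ a = typK σ m * typK σ (pidK K v)) :
    pidK K v ∣ a ∨ gI c (pidK K v) ∣ a := by
  rw [← map_mul] at h
  obtain ⟨τ, h1, hc⟩ := h2
  have e := all_tau hσ (sI_eq hcc (gal_comm hσ _ _) hc1 h) τ
  have hd : pidK K v ∣ sI c a * gI τ (sI c (m * pidK K v)) := by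
    rw [e, sI]
    exact (((dvd_mul_left _ _).mul_right _).mul_right _)
  have key : ∀ τ, ¬ pidK K v ∣ gI τ m := by
    intro τ hd
    apply hm τ⁻¹
    rw [← gI_dvd τ, gI_gI, mul_inv_cancel, gI_one]; exact hd
  rcases pid_prime v hd with hd | hd
  · rw [sI] at hd
    refine (pid_prime v hd).imp id fun hd => ?_
    rwa [← gI_dvd c, gI_gI, hcc, gI_one]
  · exfalso
    rw [sI, map_mul, map_mul, map_mul, map_mul, gI_gI, gI_gI] at hd
    rcases pid_prime v hd with hd | hd <;> rcases pid_prime v hd with hd | hd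
    · exact key _ hd
    · rw [← pid_gV] at hd
      exact h1 (hv τ (pid_dvd hd).symm)
    · exact key _ hd
    · rw [← pid_gV] at hd
      have := hv _ (pid_dvd hd).symm
      exact hc (mul_right_cancel (this.trans hcc.symm))

lemma cross_cancel {G : Type*} [CommGroup G] {p q a b a' b' : G} (h1 : p * a = q * b) (h2 : p * a' = q * b') : a * b' = b * a' := by
  apply mul_left_cancel (a := p * q)
  rw [mul_mul_mul_comm, h1, ← h2]
  simp only [mul_assoc, mul_comm, mul_left_comm]

lemma mkT_conj {σ c : K ≃ₐ[ℚ] K} (hcs : σ * c = c * σ) (hw : ∀ (w : InfinitePlace K) x, w (c x) = w x) (x : K) (hx : x ≠ 0)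
    (hcx : c x ≠ 0) : mkT σ (c x) hcx = mkT σ x hx := by
  rw [mkT, mkT]
  congr 2
  have : c x / σ (c x) = c (x / σ x) := by
    rw [map_div₀]
    congr 1
    exact congrArg (fun g : K ≃ₐ[ℚ] K => g x) hcs
  rw [this]
  ext w
  rw [logMap_apply, logMap_apply, hw]

lemma typ_cpI {σ c : K ≃ₐ[ℚ] K} (hcs : σ * c = c * σ) (hw : ∀ (w : InfinitePlace K) x, w (c x) = w x) (x : 𝓞 K) (hx : x ≠ 0) :
    typK σ (gI c (pI x hx)) = typK σ (pI x hx) := by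
  rw [gI_pI]
  refine Prod.ext ?_ ?_
  · change phiHat σ _ = phiHat σ _
    rw [phiHat_pI, phiHat_pI]
    exact congrArg _ (mkT_conj hcs hw x (coeK_ne hx) _)
  · change ClassGroup.mk0 _ = ClassGroup.mk0 _
    rw [mk0_pI, mk0_pI]

lemma typ_conj {σ c : K ≃ₐ[ℚ] K} (hcs : σ * c = c * σ) (hw : ∀ (w : InfinitePlace K) x, w (c x) = w x) {a b : ID K}
    (h : ClassGroup.mk0 a = ClassGroup.mk0 b) : typK σ a * typK σ (gI c b) = typK σ b * typK σ (gI c a) := by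
  obtain ⟨x, y, hx, hy, e⟩ := cls_eq h
  refine cross_cancel (p := typK σ (pI x hx)) (q := typK σ (pI y hy)) ?_ ?_
  · rw [← map_mul, ← map_mul, e]
  · rw [← typ_cpI hcs hw x hx, ← typ_cpI hcs hw y hy, ← map_mul, ← map_mul, ← map_mul, ← map_mul, e]

end E2

end

section
open Filter Topology MeasureTheory Set
open NumberField nonZeroDivisors IsDedekindDomain
section E3
variable {K : Type*} [Field K] [NumberField K]

/-- representative of a class -/
noncomputable def repC (C : ClassGroup (𝓞 K)) : ID K := (ClassGroup.mk0_surjective C).choose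
lemma repC_spec (C : ClassGroup (𝓞 K)) : ClassGroup.mk0 (repC C) = C := (ClassGroup.mk0_surjective C).choose_spec

lemma qid0 {q : HeightOneSpectrum (𝓞 K) × ℕ} (h : q.2 = 0) : qid (pidK K) q = pidK K q.1 := by
  rw [qid, h, zero_add, pow_one]

lemma goodQ_g {σ : K ≃ₐ[ℚ] K} (hσ : ∀ τ : K ≃ₐ[ℚ] K, τ ∈ Subgroup.zpowers σ) (c : K ≃ₐ[ℚ] K) {q : HeightOneSpectrum (𝓞 K) × ℕ} (h : goodQ q) : goodQ (gQ c q) := by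
  refine ⟨h.1, fun τ hτ => h.2 τ ?_⟩
  change gV τ (gV c q.1) = gV c q.1 at hτ
  rw [gV_gV, gal_comm hσ, ← gV_gV] at hτ
  have := congrArg (gV c⁻¹) hτ
  rwa [gV_gV, gV_gV, gV_gV, inv_mul_cancel, gV_one, one_mul] at this

lemma div_aux {G : Type*} [CommGroup G] {a b a' b' : G} (h : a * b' = b * a') : a = a' * (b / b') := by
  rw [mul_div_assoc', eq_div_iff_mul_eq', h, mul_comm]

open scoped Classical in
lemma LTrK {σ c : K ≃ₐ[ℚ] K} (hσ : ∀ τ : K ≃ₐ[ℚ] K, τ ∈ Subgroup.zpowers σ) (hcc : c * c = 1)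
    (hw : ∀ (w : InfinitePlace K) x, w (c x) = w x)
    (hc1 : ∀ x : K, (∀ w : InfinitePlace K, w x = 1) → x * c x = 1) (h2 : ∃ τ : K ≃ₐ[ℚ] K, τ ≠ 1 ∧ τ ≠ c) :
    LTr (Γ := K ≃ₐ[ℚ] K) (C := ClassGroup (𝓞 K)) (nmK K) (pidK K) (typK σ) goodQ (gQ c) gQ (fun q => ClassGroup.mk0 (qid (pidK K) q))
      (fun C => typK σ (repC C) / typK σ (gI c (repC C))) (if c = 1 then 2 else 1) where
  A := arithK
  cc q := by simp only [gQ, gV_gV, hcc, gV_one]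
  cg q h := goodQ_g hσ c h
  cn q := nq_gQ c q
  cL q := lgq_gQ c q
  tn τ q := nq_gQ τ q
  hdl q h := by
    rw [qid_gQ]
    exact div_aux (typ_conj (gal_comm hσ _ _) hw (repC_spec _).symm)
  j4 q h a m hm ht := by
    simp only [qid_gQ, qid0 h.1] at hm ht ⊢
    exact j4K hσ hcc hc1 h2 q.1 h.2 a m hm ht
  k1 := by split_ifs <;> norm_num
  k2 := by split_ifs <;> norm_num
  pit := PIT1
  bad := bad_o
  hk q h a hd := by
    simp only [qid_gQ, qid0 h.1] at hd ⊢
    by_cases hc : c = 1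
    · subst hc
      simp only [gI_one, or_self] at hd
      left
      simp only [gI_one, if_pos hd, if_true]; norm_num
    · simp only [if_neg hc]
      by_cases h3 : pidK K q.1 ∣ a
      · by_cases h4 : gI c (pidK K q.1) ∣ a
        · right
          refine ⟨c, ?_⟩
          obtain ⟨b, rfl⟩ := h3
          rw [← pid_gV] at h4 ⊢
          rcases pid_prime _ h4 with h5 | h5
          · exact absurd (h.2 c (pid_dvd h5)) hc
          · exact mul_dvd_mul_left _ h5
        · left; simp [h3, h4]
      · left
        simp [h3, hd.resolve_left h3]

end E3

end

section
open Filter Topology MeasureTheory Set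
open NumberField nonZeroDivisors IsDedekindDomain
section E4
variable {K : Type*} [Field K] [NumberField K]

open scoped Classical in
/-- points of bounded height -/
noncomputable def UX (σ : K ≃ₐ[ℚ] K) (X : ℝ) : Finset (Torus K) :=
  (((arithK (K := K)).TX (typK σ) X).filter fun x => x.2 = 1).image fun x => Multiplicative.toAdd x.1

lemma mem_UX {σ : K ≃ₐ[ℚ] K} {X : ℝ} {t : Torus K} : t ∈ UX σ X ↔
    ∃ (γ : 𝓞 K) (h : γ ≠ 0), mkT σ (γ : K) (coeK_ne h) = t ∧ ((Algebra.norm ℤ γ).natAbs : ℝ) ≤ X := by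
  simp only [UX, Finset.mem_image, Finset.mem_filter, Arith.mem_TX]
  constructor
  · rintro ⟨x, ⟨⟨a, rfl, ha⟩, h2⟩, rfl⟩
    have h3 : ClassGroup.mk0 a = 1 := h2
    rw [ClassGroup.mk0_eq_one_iff] at h3
    obtain ⟨⟨γ, hγ⟩⟩ := h3
    have hγ' : (a : Ideal (𝓞 K)) = Ideal.span {γ} := hγ
    have h0 : γ ≠ 0 := by
      rintro rfl
      rw [Ideal.span_singleton_eq_bot.2 rfl] at hγ'
      exact nonZeroDivisors.coe_ne_zero a hγ'
    refine ⟨γ, h0, ?_, ?_⟩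
    · exact (congrArg Multiplicative.toAdd (phiHat_span σ a γ (coeK_ne h0) hγ')).symm
    · rw [nmK_apply, hγ', Ideal.absNorm_span_singleton] at ha; exact ha
  · rintro ⟨γ, h, rfl, hn⟩
    refine ⟨typK σ (pI γ h), ⟨⟨pI γ h, rfl, ?_⟩, mk0_pI γ h⟩, ?_⟩
    · rw [nmK_apply]
      change ((Ideal.absNorm (Ideal.span {γ}) : ℕ) : ℝ) ≤ X
      rwa [Ideal.absNorm_span_singleton]
    · exact congrArg Multiplicative.toAdd (phiHat_pI σ γ h)

open scoped Classical in
lemma sum_UX {σ : K ≃ₐ[ℚ] K} {X : ℝ} (f : Torus K → ℂ) : ∑ t ∈ UX σ X, f t =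
    ∑ x ∈ ((arithK (K := K)).TX (typK σ) X).filter (fun x => x.2 = 1), f (Multiplicative.toAdd x.1) := by
  rw [UX, Finset.sum_image]
  · intro x hx y hy h
    have hx2 := (Finset.mem_filter.1 hx).2
    have hy2 := (Finset.mem_filter.1 hy).2
    exact Prod.ext h (hx2.trans hy2.symm)

open scoped Classical in
lemma card_UX {σ : K ≃ₐ[ℚ] K} {X : ℝ} : (UX σ X).card =
    (((arithK (K := K)).TX (typK σ) X).filter (fun x => x.2 = 1)).card := by
  have := sum_UX (σ := σ) (X := X) (fun _ => 1)
  simp only [Finset.sum_const, nsmul_eq_mul, mul_one] at this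
  exact_mod_cast this

lemma W_le_U (σ : K ≃ₐ[ℚ] K) : ∃ C0 : ℝ, 1 ≤ C0 ∧ ∀ X, (arithK (K := K)).Wt (typK σ) (X / C0) ≤ Fintype.card (ClassGroup (𝓞 K)) * (UX σ X).card := by
  classical
  refine ⟨∑ C : ClassGroup (𝓞 K), (nmK K (repC C) : ℝ), ?_, fun X => ?_⟩
  · have h := Finset.single_le_sum (f := fun C : ClassGroup (𝓞 K) => (nmK K (repC C) : ℝ)) (fun _ _ => Nat.cast_nonneg _) (Finset.mem_univ 1)
    refine le_trans ?_ h
    exact_mod_cast arithK.pos _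
  · set C0 := ∑ C : ClassGroup (𝓞 K), (nmK K (repC C) : ℝ)
    have hC : ∀ C, (nmK K (repC C) : ℝ) ≤ C0 := fun C =>
      Finset.single_le_sum (f := fun C : ClassGroup (𝓞 K) => (nmK K (repC C) : ℝ)) (fun _ _ => Nat.cast_nonneg _) (Finset.mem_univ C)
    have hC0 : 0 < C0 := lt_of_lt_of_le (by exact_mod_cast arithK.pos _) (hC 1)
    rw [card_UX, Arith.Wt, ← Finset.card_univ, ← Nat.cast_mul, ← Finset.card_product, Nat.cast_le]
    refine Finset.card_le_card_of_injOn (fun x => (x.2, x * typK σ (repC x.2⁻¹))) ?_ ?_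
    · intro x hx
      obtain ⟨a, rfl, ha⟩ := Arith.mem_TX _ |>.1 hx
      refine Finset.mem_coe.2 (Finset.mem_product.2 ⟨Finset.mem_univ _, Finset.mem_filter.2 ⟨?_, ?_⟩⟩)
      · refine Arith.mem_TX _ |>.2 ⟨a * repC (typK σ a).2⁻¹, map_mul _ _ _, ?_⟩
        rw [map_mul, Nat.cast_mul]
        calc (nmK K a : ℝ) * _ ≤ X / C0 * C0 := mul_le_mul ha (hC _) (Nat.cast_nonneg _) ((Nat.cast_nonneg _).trans ha)
          _ = X := div_mul_cancel₀ _ hC0.ne'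
      · change (typK σ a).2 * ClassGroup.mk0 (repC _) = 1
        rw [repC_spec, mul_inv_cancel]
    · intro x _ y _ h
      have h1 : x.2 = y.2 := congrArg Prod.fst h
      have h2 : x * typK σ (repC x.2⁻¹) = y * typK σ (repC y.2⁻¹) := congrArg Prod.snd h
      rw [h1] at h2
      exact mul_right_cancel h2

/-- product of characters -/
noncomputable def prodChar (χ : Multiplicative (Torus K) →* ℂ) (ψ : AddChar (Additive (ClassGroup (𝓞 K))) ℂ) :
    Multiplicative (Torus K) × ClassGroup (𝓞 K) →* ℂ where
  toFun x := χ x.1 * ψ (Additive.ofMul x.2)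
  map_one' := by simp
  map_mul' a b := by rw [Prod.fst_mul, Prod.snd_mul, map_mul, ofMul_mul, AddChar.map_add_eq_mul]; ring

lemma weyl_pre [IsGalois ℚ K] {σ : K ≃ₐ[ℚ] K} (hσ : ∀ τ : K ≃ₐ[ℚ] K, τ ∈ Subgroup.zpowers σ) (h2 : ∃ w w' : InfinitePlace K, w ≠ w')
    (χ : Multiplicative (Torus K) →* ℂ) {lam : InfinitePlace K → ℝ} (hχ : HasLam (χ.comp (phiHat σ)) lam) (hl : lam ≠ 0)
    (hn : ∀ x, ‖χ x‖ = 1) : (∃ c' : ℝ, 0 < c' ∧ ∀ᶠ X in atTop, (arithK (K := K)).Wt (typK σ) X ≤ c' * (Fintype.card (ClassGroup (𝓞 K)) * (UX σ X).card)) ∧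
    ∀ ψ, Tendsto (fun X => (∑ x ∈ (arithK (K := K)).TX (typK σ) X, prodChar χ ψ x) / ((arithK (K := K)).Wt (typK σ) X : ℂ)) atTop (𝓝 0) := by
  obtain ⟨c, hcc, hw, hc1, h3⟩ := exists_conj hσ
  have L := LTrK hσ hcc hw hc1 (h3 h2)
  constructor
  · obtain ⟨C0, hC0, hWU⟩ := W_le_U σ
    obtain ⟨c', hc', hd⟩ := L.doub hC0
    exact ⟨c', hc', hd.mono fun X hX => hX.trans (mul_le_mul_of_nonneg_left (hWU X) hc'.le)⟩
  · intro ψ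
    refine L.main (prodChar χ ψ) (fun x => ?_) (fun C => ?_)
    · change ‖χ _ * ψ _‖ = 1
      rw [norm_mul, hn, AddChar.norm_apply, one_mul]
    · exact thetaK (twC_lam hχ ψ) hl C

lemma sum_char (σ : K ≃ₐ[ℚ] K) (χ : Multiplicative (Torus K) →* ℂ) (X : ℝ) : ∑ t ∈ UX σ X, χ (Multiplicative.ofAdd t) =
    ((Fintype.card (ClassGroup (𝓞 K)) : ℝ) : ℂ)⁻¹ * ∑ ψ : AddChar (Additive (ClassGroup (𝓞 K))) ℂ, ∑ x ∈ (arithK (K := K)).TX (typK σ) X, prodChar χ ψ x := by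
  classical
  rw [sum_UX, Finset.sum_filter, Finset.sum_comm, Finset.mul_sum]
  refine Finset.sum_congr rfl fun x _ => ?_
  have h4 := cls_ind (1 : ClassGroup (𝓞 K)) (repC x.2)
  rw [repC_spec] at h4
  rw [← mul_boole, h4]
  simp only [Finset.mul_sum]
  refine Finset.sum_congr rfl fun ψ _ => ?_
  change _ = _ * (χ x.1 * ψ _)
  rw [ofMul_one, neg_zero, AddChar.map_zero_eq_one, ofAdd_toAdd]
  push_cast; ring

lemma abs_weyl {ι : Type*} [Fintype ι] {hK c' : ℝ} (hh : 0 < hK) {W U : ℝ → ℝ} {P : ι → ℝ → ℂ} {Q : ℝ → ℂ}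
    (hU0 : ∀ X, 0 ≤ U X) (hW : ∀ X, 1 ≤ X → 1 ≤ W X) (hWU : ∀ᶠ X in atTop, W X ≤ c' * (hK * U X))
    (hm : ∀ ψ, Tendsto (fun X => P ψ X / (W X : ℂ)) atTop (𝓝 0)) (e : ∀ X, Q X = (hK : ℂ)⁻¹ * ∑ ψ, P ψ X) :
    Tendsto (fun X => Q X / (U X : ℂ)) atTop (𝓝 0) := by
  have hs := (tendsto_finsetSum (Finset.univ : Finset ι) fun ψ _ => (hm ψ).norm).const_mul c'
  simp only [norm_zero, Finset.sum_const_zero, mul_zero] at hs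
  refine squeeze_zero_norm' ?_ hs
  filter_upwards [hWU, eventually_ge_atTop 1] with X hWle hX1
  have hW1 := hW X hX1
  have hU : 0 < U X := by
    refine lt_of_le_of_ne (hU0 X) fun hcon => ?_
    rw [← hcon, mul_zero, mul_zero] at hWle
    linarith
  rw [e, norm_div, norm_mul, norm_inv, Complex.norm_real, Complex.norm_real, Real.norm_of_nonneg hh.le, Real.norm_of_nonneg hU.le, div_le_iff₀ hU]
  have h5 : ‖∑ ψ, P ψ X‖ ≤ (∑ ψ, ‖P ψ X / (W X : ℂ)‖) * W X := by
    refine (norm_sum_le _ _).trans ?_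
    rw [Finset.sum_mul]
    refine Finset.sum_le_sum fun ψ _ => le_of_eq ?_
    rw [norm_div, Complex.norm_real, Real.norm_of_nonneg (by linarith), div_mul_cancel₀ _ (by linarith)]
  set S := ∑ ψ, ‖P ψ X / (W X : ℂ)‖
  have hS : 0 ≤ S := Finset.sum_nonneg fun _ _ => norm_nonneg _
  rw [inv_mul_le_iff₀ hh]
  refine h5.trans ((mul_le_mul_of_nonneg_left hWle hS).trans (le_of_eq ?_))
  ring

lemma weyl_char [IsGalois ℚ K] {σ : K ≃ₐ[ℚ] K} (hσ : ∀ τ : K ≃ₐ[ℚ] K, τ ∈ Subgroup.zpowers σ) (h2 : ∃ w w' : InfinitePlace K, w ≠ w')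
    (χ : Multiplicative (Torus K) →* ℂ) {lam : InfinitePlace K → ℝ} (hχ : HasLam (χ.comp (phiHat σ)) lam) (hl : lam ≠ 0)
    (hn : ∀ x, ‖χ x‖ = 1) :
    Tendsto (fun X : ℝ => (∑ t ∈ UX σ X, χ (Multiplicative.ofAdd t)) / ((UX σ X).card : ℂ)) atTop (𝓝 0) := by
  obtain ⟨⟨c', hc', hWU⟩, hm⟩ := weyl_pre hσ h2 χ hχ hl hn
  refine (abs_weyl (U := fun X => ((UX σ X).card : ℝ)) (by exact_mod_cast Fintype.card_pos) (fun X => Nat.cast_nonneg _)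
    (fun X hX => (arithK (K := K)).M_ge hX) hWU hm (sum_char σ χ)).congr fun X => ?_
  rw [Complex.ofReal_natCast]

end E4

end

section
open Filter Topology MeasureTheory Set
open NumberField nonZeroDivisors IsDedekindDomain
section E5
variable {K : Type*} [Field K] [NumberField K]

open Finset in
lemma h90 {K : Type*} [Field K] [NumberField K] [IsGalois ℚ K] {σ : K ≃ₐ[ℚ] K} (hσ : ∀ τ : K ≃ₐ[ℚ] K, τ ∈ Subgroup.zpowers σ)
    {β : K} (hβ : Algebra.norm ℚ β = 1) : ∃ y : K, y ≠ 0 ∧ y / σ y = β := by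
  classical
  have hb0 : β ≠ 0 := by rintro rfl; simp at hβ
  have ho : 0 < orderOf σ := orderOf_pos σ
  let b : ℕ → K := fun i => ∏ j ∈ range i, (σ ^ j) β
  have hb : ∀ i, b (i+1) = β * σ (b i) := by
    intro i
    simp only [b, prod_range_succ', map_prod, pow_zero, AlgEquiv.one_apply, ← AlgEquiv.mul_apply, pow_succ']
    exact mul_comm _ _
  have hn : b (orderOf σ) = 1 := by
    have h1 := Algebra.norm_eq_prod_automorphisms ℚ β
    rw [hβ, map_one] at h1
    have h2 : (univ : Finset (K ≃ₐ[ℚ] K)) = (range (orderOf σ)).image (fun i => σ ^ i) := by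
      ext τ
      have := mem_zpowers_iff_mem_range_orderOf (x := σ) (y := τ)
      have h3 := this.1 (hσ τ)
      simp only [Finset.mem_image] at h3 
      simpa using h3
    rw [h2, prod_image] at h1
    · exact h1.symm
    · intro i hi j hj h
      exact pow_injOn_Iio_orderOf (by simpa using hi) (by simpa using hj) h
  have hli := linearIndependent_monoidHom K K
  let φ : Fin (orderOf σ) → (K →* K) := fun i => ((σ ^ (i:ℕ) : K ≃ₐ[ℚ] K) : K →* K)
  have hφ : Function.Injective φ := by
    intro i j h
    have : σ ^ (i:ℕ) = σ ^ (j:ℕ) := by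
      ext x; exact DFunLike.congr_fun h x
    exact Fin.ext (pow_injOn_Iio_orderOf (by simp) (by simp) this)
  have h4 := hli.comp φ hφ
  rw [Fintype.linearIndependent_iff] at h4
  have h5 : ∃ θ : K, ∑ i ∈ range (orderOf σ), b i * (σ ^ i) θ ≠ 0 := by
    by_contra! h
    have := h4 (fun i => b i) (by
      ext θ
      rw [Finset.sum_apply, Pi.zero_apply, ← h θ, Finset.sum_range]; rfl) ⟨0, ho⟩
    simp [b] at this
  obtain ⟨θ, hθ⟩ := h5
  refine ⟨_, hθ, ?_⟩
  have hs : β * σ (∑ i ∈ range (orderOf σ), b i * (σ ^ i) θ) = ∑ i ∈ range (orderOf σ), b i * (σ ^ i) θ := by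
    rw [map_sum, mul_sum]
    have : ∀ i ∈ range (orderOf σ), β * σ (b i * (σ ^ i) θ) = b (i+1) * (σ ^ (i+1)) θ := by
      intro i _
      rw [map_mul, ← mul_assoc, ← hb, pow_succ', AlgEquiv.mul_apply]
    rw [sum_congr rfl this]
    have e1 := sum_range_succ (fun i => b i * (σ ^ i) θ) (orderOf σ)
    have e2 := sum_range_succ' (fun i => b i * (σ ^ i) θ) (orderOf σ)
    rw [e1] at e2
    have : b (orderOf σ) * (σ ^ orderOf σ) θ = b 0 * (σ ^ 0) θ := by
      rw [hn, pow_orderOf_eq_one]; simp [b]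
    rw [this] at e2
    exact (add_right_cancel e2).symm
  rw [div_eq_iff ((map_ne_zero _).2 hθ), hs]

lemma mkT_scale (σ : K ≃ₐ[ℚ] K) (n : ℤ) (hn : (n : K) ≠ 0) (y : K) (hy : y ≠ 0) : ((n : K) * y) / σ ((n : K) * y) = y / σ y := by
  rw [map_mul, map_intCast, mul_div_mul_left _ _ hn]

lemma Ntilde_ex [IsGalois ℚ K] {σ : K ≃ₐ[ℚ] K} (hσ : ∀ τ : K ≃ₐ[ℚ] K, τ ∈ Subgroup.zpowers σ) {t : Torus K} (ht : t ∈ Ntilde K) :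
    ∃ (γ : 𝓞 K) (h : γ ≠ 0), mkT σ (γ : K) (coeK_ne h) = t := by
  obtain ⟨β, hβ, hb, rfl⟩ := ht
  obtain ⟨y, hy0, rfl⟩ := h90 hσ hβ
  obtain ⟨n, hn, hi⟩ := ((IsFractionRing.isAlgebraic_iff ℤ ℚ K).2 (Algebra.IsAlgebraic.isAlgebraic (R := ℚ) y)).exists_integral_multiple
  have hn' : (n : K) ≠ 0 := by exact_mod_cast hn
  rw [zsmul_eq_mul] at hi
  have h0 : (⟨(n : K) * y, hi⟩ : 𝓞 K) ≠ 0 := by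
    intro h
    exact mul_ne_zero hn' hy0 (congrArg (algebraMap (𝓞 K) K) h)
  refine ⟨⟨(n : K) * y, hi⟩, h0, ?_⟩
  unfold mkT
  congr 2
  exact congrArg (logMap K) (mkT_scale σ n hn' y hy0)

lemma S_eq [IsGalois ℚ K] {σ : K ≃ₐ[ℚ] K} (hσ : ∀ τ : K ≃ₐ[ℚ] K, τ ∈ Subgroup.zpowers σ) (r : ℝ) :
    {t : Torus K | t ∈ Ntilde K ∧ (hclass K σ t : ℝ) < r} = (UX σ ((⌈r⌉₊ - 1 : ℕ) : ℝ) : Set (Torus K)) := by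
  have hlt : ∀ γ : 𝓞 K, γ ≠ 0 → (((Algebra.norm ℤ γ).natAbs : ℝ) < r ↔ ((Algebra.norm ℤ γ).natAbs : ℝ) ≤ ((⌈r⌉₊ - 1 : ℕ) : ℝ)) := by
    intro γ hγ
    have : (Algebra.norm ℤ γ).natAbs ≠ 0 := by
      rw [Int.natAbs_ne_zero, Algebra.norm_ne_zero_iff]; exact hγ
    rw [Nat.cast_le, ← Nat.lt_ceil]
    omega
  ext t
  rw [Set.mem_ofPred_eq, Finset.mem_coe, mem_UX]
  constructor
  · rintro ⟨ht, hr⟩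
    have hne : {m : ℕ | ∃ γ : 𝓞 K, γ ≠ 0 ∧ m = (Algebra.norm ℤ γ).natAbs ∧ ∃ hg : logMap K ((γ : K) / σ (γ : K)) ∈ sumKer K,
        (QuotientAddGroup.mk ⟨logMap K ((γ : K) / σ (γ : K)), hg⟩ : Torus K) = t}.Nonempty := by
      obtain ⟨γ, h, e⟩ := Ntilde_ex hσ ht
      exact ⟨_, γ, h, rfl, pi_mem σ (coeK_ne h), e⟩
    obtain ⟨γ, h, e, hg, e2⟩ := Nat.sInf_mem hne
    refine ⟨γ, h, e2, (hlt γ h).1 ?_⟩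
    rw [← e]; exact hr
  · rintro ⟨γ, h, rfl, hr⟩
    refine ⟨⟨_, norm_pi σ (coeK_ne h), pi_mem σ (coeK_ne h), rfl⟩, lt_of_le_of_lt ?_ ((hlt γ h).2 hr)⟩
    rw [Nat.cast_le]
    exact Nat.sInf_le ⟨γ, h, rfl, pi_mem σ (coeK_ne h), rfl⟩
end E5

end

section
open Filter Topology MeasureTheory Set
section G1

lemma cont_int {T : Type*} [TopologicalSpace T] [CompactSpace T] [MeasurableSpace T] [BorelSpace T] (μ : Measure T)
    [IsProbabilityMeasure μ] (f : C(T, ℂ)) : Integrable f μ :=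
  f.continuous.integrable_of_hasCompactSupport (HasCompactSupport.of_compactSpace _)

lemma weyl_abs {T : Type*} [TopologicalSpace T] [CompactSpace T] [MeasurableSpace T] [BorelSpace T] (μ : Measure T)
    [IsProbabilityMeasure μ] (U : ℝ → Finset T) (S : Set C(T, ℂ)) (hS : Dense (Submodule.span ℂ S : Set C(T, ℂ)))
    (h : ∀ g ∈ S, Tendsto (fun X => (∑ t ∈ U X, g t) / ((U X).card : ℂ)) atTop (𝓝 (∫ t, g t ∂μ))) (f : C(T, ℂ)) :
    Tendsto (fun X => (∑ t ∈ U X, f t) / ((U X).card : ℂ)) atTop (𝓝 (∫ t, f t ∂μ)) := by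
  have h1 : ∀ g ∈ Submodule.span ℂ S, Tendsto (fun X => (∑ t ∈ U X, g t) / ((U X).card : ℂ)) atTop (𝓝 (∫ t, g t ∂μ)) := by
    intro g hg
    induction hg using Submodule.span_induction with
    | mem x hx => exact h x hx
    | zero => simp
    | add x y _ _ hx hy =>
      simp only [ContinuousMap.add_apply, Finset.sum_add_distrib, add_div]
      rw [integral_add (cont_int μ x) (cont_int μ y)]
      exact hx.add hy
    | smul a x _ hx =>
      simp only [ContinuousMap.smul_apply, smul_eq_mul, ← Finset.mul_sum, mul_div_assoc]
      rw [integral_const_mul]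
      exact hx.const_mul a
  rw [Metric.tendsto_atTop]
  intro ε hε
  obtain ⟨g, hg, hd⟩ := Metric.dense_iff.1 hS f (ε/3) (by positivity)
  rw [Metric.mem_ball, dist_comm, dist_eq_norm] at hg
  obtain ⟨N, hN⟩ := Metric.tendsto_atTop.1 (h1 g hd) (ε/3) (by positivity)
  refine ⟨N, fun X hX => ?_⟩
  have hp : ∀ t, ‖f t - g t‖ ≤ ε / 3 := fun t => ((f - g).norm_coe_le_norm t).trans hg.le
  have e1 : ‖(∑ t ∈ U X, f t) / ((U X).card : ℂ) - (∑ t ∈ U X, g t) / ((U X).card : ℂ)‖ ≤ ε / 3 := by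
    rw [← sub_div, ← Finset.sum_sub_distrib, norm_div, Complex.norm_natCast]
    refine div_le_of_le_mul₀ (by positivity) (by positivity) ((norm_sum_le _ _).trans ?_)
    refine (Finset.sum_le_sum fun t _ => hp t).trans ?_
    rw [Finset.sum_const, nsmul_eq_mul, mul_comm]
  have e2 : ‖(∫ t, g t ∂μ) - ∫ t, f t ∂μ‖ ≤ ε / 3 := by
    rw [← integral_sub (cont_int μ g) (cont_int μ f)]
    have := norm_integral_le_of_norm_le_const (μ := μ) (f := fun t => g t - f t) (C := ε/3) (Eventually.of_forall fun t => by
      rw [norm_sub_rev]; exact hp t)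
    simpa using this
  have e3 := hN X hX
  rw [dist_eq_norm] at e3 ⊢
  have := norm_add₃_le (a := (∑ t ∈ U X, f t) / ((U X).card : ℂ) - (∑ t ∈ U X, g t) / ((U X).card : ℂ))
    (b := (∑ t ∈ U X, g t) / ((U X).card : ℂ) - ∫ t, g t ∂μ) (c := (∫ t, g t ∂μ) - ∫ t, f t ∂μ)
  rw [sub_add_sub_cancel, sub_add_sub_cancel] at this
  linarith

/-- family of characters closed under products and conj spans a dense subspace -/
lemma dense_chars {T M : Type*} [TopologicalSpace T] [CompactSpace T] [AddCommGroup M] (c : M → C(T, ℂ))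
    (h0 : c 0 = 1) (ha : ∀ m n, c (m + n) = c m * c n) (hs : ∀ m, c (-m) = star (c m))
    (hsep : ∀ x y, x ≠ y → ∃ m, c m x ≠ c m y) : Dense (Submodule.span ℂ (range c) : Set C(T, ℂ)) := by
  let A : StarSubalgebra ℂ C(T, ℂ) :=
    { toSubalgebra := Algebra.adjoin ℂ (range c)
      star_mem' := by
        change Algebra.adjoin ℂ (range c) ≤ star (Algebra.adjoin ℂ (range c))
        refine Algebra.adjoin_le ?_
        rintro - ⟨n, rfl⟩
        exact Algebra.subset_adjoin ⟨-n, hs n⟩ }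
  have e : Subalgebra.toSubmodule A.toSubalgebra = Submodule.span ℂ (range c) := by
    apply Algebra.adjoin_eq_span_of_subset
    refine Subset.trans ?_ Submodule.subset_span
    intro x hx
    refine Submonoid.closure_induction (fun _ => id) ⟨0, h0⟩ ?_ hx
    rintro - - - - ⟨m, rfl⟩ ⟨n, rfl⟩
    exact ⟨m + n, ha m n⟩
  have h := ContinuousMap.starSubalgebra_topologicalClosure_eq_top_of_separatesPoints A (by
    intro x y hxy
    obtain ⟨m, hm⟩ := hsep x y hxy
    exact ⟨_, ⟨c m, Algebra.subset_adjoin ⟨m, rfl⟩, rfl⟩, hm⟩)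
  rw [← e]
  intro f
  have : f ∈ A.topologicalClosure := by rw [h]; trivial
  exact this
end G1

end

section
open Filter Topology MeasureTheory Set
open NumberField nonZeroDivisors IsDedekindDomain NumberField.mixedEmbedding.fundamentalCone
open NumberField.Units.dirichletUnitTheorem (w₀)
section G2
variable {K : Type*} [Field K] [NumberField K]

lemma mem_sumKer (x : InfinitePlace K → ℝ) : x ∈ sumKer K ↔ ∑ w, x w = 0 := Iff.rfl

lemma sum_repr (x : InfinitePlace K → ℝ) : ∑ w, x w = (completeBasis K).repr x w₀ * Module.finrank ℚ K := by
  conv_lhs => rw [← (completeBasis K).sum_repr x]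
  simp only [Finset.sum_apply, Pi.smul_apply, smul_eq_mul]
  rw [Finset.sum_comm]
  simp only [← Finset.mul_sum]
  rw [Finset.sum_eq_single w₀, sumB0]
  · intro i _ hi
    rw [sumBi K i hi, mul_zero]
  · simp

lemma sumKer_repr (x : InfinitePlace K → ℝ) : x ∈ sumKer K ↔ (completeBasis K).repr x w₀ = 0 := by
  rw [mem_sumKer, sum_repr]
  have : (Module.finrank ℚ K : ℝ) ≠ 0 := by exact_mod_cast Module.finrank_pos.ne'
  simp [this]

open scoped Classical in
lemma logUnits_int (x : sumKer K) : x ∈ logUnits K ↔ ∀ i, ∃ k : ℤ, (completeBasis K).repr (x : InfinitePlace K → ℝ) i = k := by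
  rw [logUnits_iff]
  obtain ⟨e, he⟩ := unit_equiv K
  constructor
  · rintro ⟨u, hu⟩ i
    have h := he (e.symm u)
    rw [e.apply_symm_apply, ← hu] at h
    rw [h, vk]
    simp only [map_sum, map_smul, Finsupp.coe_finsetSum, Finset.sum_apply, Finsupp.smul_apply, Module.Basis.repr_self,
      Finsupp.single_apply, smul_eq_mul]
    refine ⟨∑ j : {w : InfinitePlace K // w ≠ w₀}, (e.symm u).2 j * (if j.1 = i then 1 else 0), ?_⟩
    push_cast; rfl
  · intro h
    choose k hk using h
    refine ⟨e (1, fun i => k i.1), ?_⟩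
    rw [he, vk, ← (completeBasis K).sum_repr x]
    have h0 := (sumKer_repr _).1 x.2
    rw [← Finset.add_sum_erase _ _ (Finset.mem_univ (w₀ : InfinitePlace K)), h0, zero_smul, zero_add,
      Finset.sum_subtype (p := fun w => w ≠ w₀) (Finset.univ.erase w₀) (by simp)]
    exact Finset.sum_congr rfl fun i _ => by rw [hk]

/-- linear form -/
noncomputable def ell (m : InfinitePlace K → ℤ) : (InfinitePlace K → ℝ) →ₗ[ℝ] ℝ :=
  (2 * Real.pi) • ∑ i, (m i : ℝ) • (completeBasis K).coord i

lemma ell_apply (m : InfinitePlace K → ℤ) (x) : ell m x = 2 * Real.pi * ∑ i, m i * (completeBasis K).repr x i := by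
  simp [ell]

/-- circle character -/
noncomputable def circ (m : InfinitePlace K → ℤ) : Torus K →+ Additive Circle :=
  QuotientAddGroup.lift (logUnits K) (Circle.expHom.comp ((ell m).toAddMonoidHom.comp (sumKer K).subtype)) (by
    intro x hx
    rw [logUnits_int] at hx
    choose k hk using hx
    change Circle.exp (ell m x) = 1
    rw [ell_apply, Circle.exp_eq_one]
    refine ⟨∑ i, m i * k i, ?_⟩
    simp only [hk]
    push_cast; ring)

lemma circ_mk (m : InfinitePlace K → ℤ) (x : sumKer K) : (circ m (QuotientAddGroup.mk x)).toMul = Circle.exp (ell m x) := rfl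

/-- complex character -/
noncomputable def chi (m : InfinitePlace K → ℤ) : Multiplicative (Torus K) →* ℂ :=
  Circle.coeHom.comp (AddMonoidHom.toMultiplicativeLeft (circ m))

lemma chi_mk (m : InfinitePlace K → ℤ) (x : sumKer K) :
    chi m (Multiplicative.ofAdd (QuotientAddGroup.mk x)) = (Circle.exp (ell m x) : ℂ) := rfl

lemma chi_norm (m : InfinitePlace K → ℤ) (x) : ‖chi m x‖ = 1 := Circle.norm_coe _

lemma ell_cont (m : InfinitePlace K → ℤ) : Continuous (ell m : (InfinitePlace K → ℝ) →ₗ[ℝ] ℝ) :=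
  LinearMap.continuous_of_finiteDimensional _

/-- continuous map version -/
noncomputable def chiC (m : InfinitePlace K → ℤ) : C(Torus K, ℂ) where
  toFun t := chi m (Multiplicative.ofAdd t)
  continuous_toFun := by
    have : Continuous (fun x : sumKer K => (Circle.exp (ell m x) : ℂ)) :=
      continuous_subtype_val.comp (Circle.exp.continuous.comp ((ell_cont m).comp continuous_subtype_val))
    exact (QuotientAddGroup.isQuotientMap_mk (N := logUnits K)).continuous_iff.2 this

lemma chiC_mk (m : InfinitePlace K → ℤ) (x : sumKer K) :
    chiC m (QuotientAddGroup.mk x) = (Circle.exp (ell m x) : ℂ) := rfl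

/-- parametrization -/
noncomputable def par (a : InfinitePlace K → ℝ) : InfinitePlace K → ℝ := open scoped Classical in
  (completeBasis K).equivFun.symm (Function.update a w₀ 0)

lemma par_repr (a : InfinitePlace K → ℝ) (i) (hi : i ≠ w₀) : (completeBasis K).repr (par a) i = a i := by
  classical
  rw [← Module.Basis.equivFun_apply, par, LinearEquiv.apply_symm_apply]
  simp [hi]
lemma par_repr0 (a : InfinitePlace K → ℝ) : (completeBasis K).repr (par a) w₀ = 0 := by
  classical
  rw [← Module.Basis.equivFun_apply, par, LinearEquiv.apply_symm_apply]
  simp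

lemma par_mem (a : InfinitePlace K → ℝ) : par a ∈ sumKer K := (sumKer_repr _).2 (par_repr0 a)

lemma par_cont : Continuous (par : (InfinitePlace K → ℝ) → _) := by
  classical
  have h : Continuous (completeBasis K).equivFun.symm :=
    LinearMap.continuous_of_finiteDimensional (completeBasis K).equivFun.symm.toLinearMap
  exact h.comp (continuous_id.update _ continuous_const)

instance compT : CompactSpace (Torus K) := by
  have hc : Continuous (fun a : InfinitePlace K → ℝ => (QuotientAddGroup.mk ⟨par a, par_mem a⟩ : Torus K)) :=
    continuous_quotient_mk'.comp (par_cont.subtype_mk _)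
  have h1 := (isCompact_Icc (a := (0 : InfinitePlace K → ℝ)) (b := 1)).image hc
  refine ⟨?_⟩
  convert h1
  symm
  rw [eq_univ_iff_forall]
  intro t
  induction t using QuotientAddGroup.induction_on with | H x => ?_
  refine ⟨fun i => Int.fract ((completeBasis K).repr (x : InfinitePlace K → ℝ) i), ?_, ?_⟩
  · exact ⟨fun i => Int.fract_nonneg _, fun i => (Int.fract_lt_one _).le⟩
  · rw [QuotientAddGroup.eq, logUnits_int]
    intro i
    simp only [AddSubgroup.coe_add, NegMemClass.coe_neg, map_add, map_neg, Finsupp.add_apply, Finsupp.neg_apply]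
    by_cases hi : i = w₀
    · subst hi
      rw [par_repr0, (sumKer_repr _).1 x.2]
      exact ⟨0, by simp⟩
    · rw [par_repr _ _ hi]
      exact ⟨⌊(completeBasis K).repr (x : InfinitePlace K → ℝ) i⌋, by rw [← Int.self_sub_fract]; ring⟩

lemma chi_dense : Dense (Submodule.span ℂ (range (chiC (K := K))) : Set C(Torus K, ℂ)) := by
  classical
  refine dense_chars _ ?_ ?_ ?_ ?_
  · ext t
    induction t using QuotientAddGroup.induction_on with | H x => ?_
    rw [chiC_mk, ell_apply]; simp
  · intro m n
    ext t
    induction t using QuotientAddGroup.induction_on with | H x => ?_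
    rw [ContinuousMap.mul_apply, chiC_mk, chiC_mk, chiC_mk, ← Circle.coe_mul, ← Circle.exp_add, ell_apply, ell_apply, ell_apply]
    simp only [Pi.add_apply, Int.cast_add, add_mul, Finset.sum_add_distrib, mul_add]
  · intro m
    ext t
    induction t using QuotientAddGroup.induction_on with | H x => ?_
    rw [ContinuousMap.star_apply, chiC_mk, chiC_mk, RCLike.star_def, ← Circle.coe_inv_eq_conj, ← Circle.exp_neg, ell_apply, ell_apply]
    simp
  · intro t s
    induction t using QuotientAddGroup.induction_on with | H x => ?_
    induction s using QuotientAddGroup.induction_on with | H y => ?_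
    intro hne
    by_contra! h
    refine hne ?_
    rw [QuotientAddGroup.eq, logUnits_int]
    intro i
    have := h (Pi.single i 1)
    rw [chiC_mk, chiC_mk, ← Circle.ext_iff, Circle.exp_eq_exp] at this
    obtain ⟨k, hk⟩ := this
    refine ⟨-k, ?_⟩
    rw [ell_apply, ell_apply, Finset.sum_eq_single i (by intro j _ hj; simp [hj]) (by simp),
      Finset.sum_eq_single i (by intro j _ hj; simp [hj]) (by simp)] at hk
    simp only [AddSubgroup.coe_add, NegMemClass.coe_neg, map_add, map_neg, Finsupp.add_apply, Finsupp.neg_apply]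
    have hpi : (2 * Real.pi) ≠ 0 := by positivity
    apply mul_left_cancel₀ hpi
    simp at hk ⊢
    linarith
end G2

end

section
open Filter Topology MeasureTheory Set
open NumberField nonZeroDivisors IsDedekindDomain NumberField.mixedEmbedding.fundamentalCone
open NumberField.Units.dirichletUnitTheorem (w₀)
section G3
variable {K : Type*} [Field K] [NumberField K]

open scoped Classical in
/-- value on the standard basis -/
noncomputable def lev (m : InfinitePlace K → ℤ) (w : InfinitePlace K) : ℝ := ell m (Pi.single w 1)

lemma ell_lev (m : InfinitePlace K → ℤ) (x) : ell m x = ∑ w, lev m w * x w := by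
  classical
  conv_lhs => rw [← Finset.univ_sum_single x]
  rw [map_sum]
  refine Finset.sum_congr rfl fun w _ => ?_
  have : (Pi.single w (x w) : InfinitePlace K → ℝ) = x w • Pi.single w 1 := by
    rw [← Pi.single_smul]; simp
  rw [this, map_smul, smul_eq_mul, mul_comm, lev]

lemma mult_sm (σ : K ≃ₐ[ℚ] K) (w : InfinitePlace K) : (σ • w).mult = w.mult := by
  have h : (σ • w).IsReal ↔ w.IsReal := InfinitePlace.isReal_smul_iff
  unfold InfinitePlace.mult
  by_cases hw : w.IsReal
  · rw [if_pos hw, if_pos (h.2 hw)]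
  · rw [if_neg hw, if_neg (h.not.2 hw)]

lemma logMap_gal (σ : K ≃ₐ[ℚ] K) (x : K) (w : InfinitePlace K) : logMap K (σ x) (σ • w) = logMap K x w := by
  rw [logMap_apply, logMap_apply, mult_sm, InfinitePlace.smul_apply, AlgEquiv.symm_apply_apply]

lemma hasLam_chi (σ : K ≃ₐ[ℚ] K) (m : InfinitePlace K → ℤ) :
    HasLam ((chi m).comp (phiHat σ)) (fun w => lev m w - lev m (σ • w)) := by
  refine ⟨?_, fun a => chi_norm m _, ?_⟩
  · simp only [sub_mul, Finset.sum_sub_distrib]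
    rw [sub_eq_zero, ← Equiv.sum_comp (MulAction.toPerm σ)]
    exact Finset.sum_congr rfl fun w _ => by rw [MulAction.toPerm_apply, mult_sm]
  · intro α b hb
    have hα : α ≠ 0 := by
      rintro rfl
      have := nonZeroDivisors.coe_ne_zero b
      rw [hb] at this
      simp at this
    have hK := coeK_ne hα
    rw [MonoidHom.comp_apply, phiHat_span σ b α hK hb, mkT, chi_mk, Circle.coe_exp, mul_comm]
    congr 3
    rw [ell_lev]
    simp only
    rw [logMap_div hK ((map_ne_zero σ).2 hK)]
    simp only [Pi.sub_apply, mul_sub, sub_mul, Finset.sum_sub_distrib]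
    congr 1
    rw [← Equiv.sum_comp (MulAction.toPerm σ)]
    exact Finset.sum_congr rfl fun w _ => by rw [MulAction.toPerm_apply, logMap_gal]

lemma lam_ne [IsGalois ℚ K] {σ : K ≃ₐ[ℚ] K} (hσ : ∀ τ : K ≃ₐ[ℚ] K, τ ∈ Subgroup.zpowers σ) {m : InfinitePlace K → ℤ}
    {i : InfinitePlace K} (hi : i ≠ w₀) (hm : m i ≠ 0) : (fun w => lev m w - lev m (σ • w)) ≠ 0 := by
  intro h
  have h1 : ∀ w, lev m (σ • w) = lev m w := fun w => (sub_eq_zero.1 (congrFun h w)).symm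
  have h2 : ∀ (τ : K ≃ₐ[ℚ] K) w, lev m (τ • w) = lev m w := by
    intro τ
    have : ∀ τ ∈ Subgroup.zpowers σ, ∀ w, lev m (τ • w) = lev m w := by
      intro τ hτ
      rw [Subgroup.zpowers_eq_closure] at hτ
      induction hτ using Subgroup.closure_induction with
      | mem x hx => rw [Set.mem_singleton_iff] at hx; subst hx; exact h1
      | one => simp
      | mul x y _ _ hx hy => intro w; rw [mul_smul, hx, hy]
      | inv x _ hx => intro w; rw [← hx (x⁻¹ • w), smul_inv_smul]
    exact this τ (hσ τ)
  have h3 : ∀ w, lev m w = lev m w₀ := by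
    intro w
    obtain ⟨τ, rfl⟩ := InfinitePlace.exists_smul_eq_of_comap_eq (k := ℚ) (w := w₀) (w' := w) (Subsingleton.elim _ _)
    exact h2 τ _
  have h4 := ell_lev m (completeBasis K i)
  simp only [h3, ← Finset.mul_sum] at h4
  rw [sumBi K i hi, mul_zero, ell_apply, Finset.sum_eq_single i (by intro j _ hj; simp [Finsupp.single_apply, hj.symm]) (by simp)] at h4
  simp [Real.pi_ne_zero, hm] at h4

lemma chi_triv {m : InfinitePlace K → ℤ} (hm : ∀ i, i ≠ w₀ → m i = 0) (t) : chiC m t = 1 := by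
  induction t using QuotientAddGroup.induction_on with | H x => ?_
  rw [chiC_mk, ell_apply, Finset.sum_eq_zero, mul_zero, Circle.exp_zero, Circle.coe_one]
  intro i _
  by_cases hi : i = w₀
  · subst hi; rw [(sumKer_repr _).1 x.2, mul_zero]
  · rw [hm i hi]; simp

lemma chi_integral (μ : Measure (Torus K)) (hμ : μ.IsAddHaarMeasure) {m : InfinitePlace K → ℤ}
    {i : InfinitePlace K} (hi : i ≠ w₀) (hm : m i ≠ 0) : ∫ t, chiC m t ∂μ = 0 := by
  have hx : (1 / (2 * (m i : ℝ))) • completeBasis K i ∈ sumKer K := by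
    rw [mem_sumKer]
    simp only [Pi.smul_apply, ← Finset.smul_sum]
    rw [sumBi K i hi, smul_zero]
  set t₀ : Torus K := QuotientAddGroup.mk ⟨_, hx⟩ with ht
  have h1 : chiC m t₀ = -1 := by
    rw [ht, chiC_mk, map_smul, ell_apply, Finset.sum_eq_single i (by intro j _ hj; simp [Finsupp.single_apply, hj.symm]) (by simp)]
    have hm' : (m i : ℝ) ≠ 0 := by exact_mod_cast hm
    have : (1 / (2 * (m i : ℝ))) • (2 * Real.pi * (m i * (completeBasis K).repr (completeBasis K i) i)) = Real.pi := by
      simp only [Module.Basis.repr_self, Finsupp.single_eq_same, smul_eq_mul]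
      field_simp
    rw [this, Circle.coe_exp, Complex.exp_pi_mul_I]
  have h2 := integral_add_left_eq_self (μ := μ) (fun t => chiC m t) t₀
  have h3 : ∀ t, chiC m (t₀ + t) = - chiC m t := by
    intro t
    change chi m (Multiplicative.ofAdd t₀ * Multiplicative.ofAdd t) = _
    rw [map_mul]
    change chiC m t₀ * chiC m t = _
    rw [h1, neg_one_mul]
  simp only [h3] at h2
  rw [integral_neg] at h2
  have h4 : (2:ℂ) * ∫ t, chiC m t ∂μ = 0 := by
    rw [two_mul]; nth_rewrite 1 [← h2]; simp
  simpa using h4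

lemma main_thm [IsGalois ℚ K] (σ : K ≃ₐ[ℚ] K) (hσ : ∀ τ : K ≃ₐ[ℚ] K, τ ∈ Subgroup.zpowers σ)
    (μ : Measure (Torus K)) (hμ : μ.IsAddHaarMeasure) (hp : IsProbabilityMeasure μ) (f : Torus K → ℂ) (hf : Continuous f) :
    Tendsto (fun r : ℝ => (∑ᶠ t ∈ {t : Torus K | t ∈ Ntilde K ∧ (hclass K σ t : ℝ) < r}, f t) /
      (Nat.card {t : Torus K // t ∈ Ntilde K ∧ (hclass K σ t : ℝ) < r} : ℂ)) atTop (𝓝 (∫ t, f t ∂μ)) := by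
  have h1 := weyl_abs μ (UX σ) _ chi_dense (by
    rintro - ⟨m, rfl⟩
    by_cases hm : ∀ i, i ≠ w₀ → m i = 0
    · simp only [chi_triv hm]
      rw [integral_const, probReal_univ, one_smul]
      refine tendsto_const_nhds.congr' ?_
      filter_upwards [eventually_ge_atTop 1] with X hX
      have : (UX σ X).card ≠ 0 := by
        rw [Finset.card_ne_zero]
        exact ⟨_, mem_UX.2 ⟨1, one_ne_zero, rfl, by simpa using hX⟩⟩
      rw [Finset.sum_const, nsmul_eq_mul, mul_one, div_self (by exact_mod_cast this)]
    · push Not at hm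
      obtain ⟨i, hi, hm⟩ := hm
      rw [chi_integral μ hμ hi hm]
      exact weyl_char hσ ⟨i, w₀, hi⟩ (chi m) (hasLam_chi σ m) (lam_ne hσ hi hm) (chi_norm m)) ⟨f, hf⟩
  have h2 : Tendsto (fun r : ℝ => ((⌈r⌉₊ - 1 : ℕ) : ℝ)) atTop atTop :=
    tendsto_natCast_atTop_atTop.comp ((tendsto_sub_atTop_nat 1).comp tendsto_nat_ceil_atTop)
  refine (h1.comp h2).congr fun r => ?_
  have h3 := S_eq hσ r
  have h4 : Nat.card {t : Torus K // t ∈ Ntilde K ∧ (hclass K σ t : ℝ) < r} = (UX σ ((⌈r⌉₊ - 1 : ℕ) : ℝ)).card := by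
    rw [← Set.ncard_coe_finset, ← h3]; rfl
  rw [h3, h4, finsum_mem_coe_finset]
  rfl
end G3

end

/-- **Main Theorem.** `Ñ` is equidistributed in `T = ker Σ / log U` with respect
to the ordering by `h`: if `μ` is the Haar probability measure on `T`, then for every continuous
`f : T → ℂ`, the averages of `f` over `Ñ(r)` converge to `∫_T f dμ` as `r → ∞`. -/
theorem ntilde_equidistributed
    (K : Type*) [Field K] [NumberField K] [IsGalois ℚ K]
    (σ : K ≃ₐ[ℚ] K) (hσ : ∀ τ : K ≃ₐ[ℚ] K, τ ∈ Subgroup.zpowers σ)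
    (μ : MeasureTheory.Measure (Torus K))
    (hμHaar : μ.IsAddHaarMeasure)
    (hμprob : MeasureTheory.IsProbabilityMeasure μ)
    (f : Torus K → ℂ) (hf : Continuous f) :
    Filter.Tendsto
      (fun r : ℝ =>
        (∑ᶠ t ∈ {t : Torus K | t ∈ Ntilde K ∧ (hclass K σ t : ℝ) < r}, f t) /
          (Nat.card {t : Torus K // t ∈ Ntilde K ∧ (hclass K σ t : ℝ) < r} : ℂ))
      Filter.atTop (nhds (∫ t, f t ∂μ)) := by
  exact main_thm σ hσ μ hμHaar hμprob f hf
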